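/- Let q be a prime power and let C be an absolutely irreducible plane algebraic curve of degree d over F_q with simple tangency. Then for every k ∈ {0, …, d}, p_k(C) = Σ_{s=k}^{d} ((−1)^{k+s}/s!)·binom(s,k). In particular, p_{d−1}(C) = 0 and p_d(C) = 1/d!. -/

import Mathlib

open MvPolynomial Filter

set_option linter.unusedSectionVars false

namespace IncidenceProb

variable {K : Type} [Field K] {ι κ : Type} [Fintype ι] [Fintype κ]

/-- The common zero set in `K^ι` of a family of polynomials. -/
def zeroLocus (S : Set (MvPolynomial ι K)) : Set (ι → K) :=
  {x | ∀ p ∈ S, eval x p = 0}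

/-- The ideal of all polynomials vanishing on a subset of `K^ι`. -/
def vanishingIdeal (V : Set (ι → K)) : Ideal (MvPolynomial ι K) where
  carrier := {p | ∀ x ∈ V, eval x p = 0}
  add_mem' := by
    intro a b ha hb x hx
    simp only [Set.mem_setOf_eq] at ha hb ⊢
    simp [map_add, ha x hx, hb x hx]
  zero_mem' := by intro x hx; simp
  smul_mem' := by
    intro c p hp x hx
    simp only [Set.mem_setOf_eq] at hp ⊢
    simp [smul_eq_mul, hp x hx]

lemma mem_vanishingIdeal {V : Set (ι → K)} {p : MvPolynomial ι K} :
    p ∈ vanishingIdeal V ↔ ∀ x ∈ V, eval x p = 0 := Iff.rfl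

/-- A subset of `K^ι` is an (affine) algebraic set if it is the zero locus of a
family of polynomials. -/
def IsAlgebraicSet (V : Set (ι → K)) : Prop :=
  ∃ S : Set (MvPolynomial ι K), V = zeroLocus S

/-- The coordinate ring of a subset of affine space. -/
abbrev coordRing (V : Set (ι → K)) : Type :=
  MvPolynomial ι K ⧸ vanishingIdeal V

/-- The Zariski topology on affine space `K^ι`: the open sets are generated by the
complements of hypersurfaces. -/
def zariskiTopology (K ι : Type) [Field K] : TopologicalSpace (ι → K) :=
  TopologicalSpace.generateFrom
    {U | ∃ p : MvPolynomial ι K, U = {x | eval x p ≠ 0}}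

/-- Irreducibility of a subset of affine space with respect to the Zariski topology. -/
def IsIrreducibleSet (V : Set (ι → K)) : Prop :=
  letI := zariskiTopology K ι
  IsIrreducible V

/-- The irreducible components of a subset of affine space: the maximal irreducible
subsets (with respect to the Zariski topology). -/
def irreducibleComponentsOf (V : Set (ι → K)) : Set (Set (ι → K)) :=
  letI := zariskiTopology K ι
  {Z | Maximal (fun T => T ⊆ V ∧ IsIrreducible T) Z}

end IncidenceProb

namespace IncidenceProb

/-- The projective plane over `K`. -/
abbrev P2 (K : Type) [Field K] : Type := Projectivization K (Fin 3 → K)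

variable {K : Type} [Field K]

/-- A point of the projective plane lies on the curve cut out by the homogeneous
polynomial `Q`. -/
def OnCurve (Q : MvPolynomial (Fin 3) K) (x : P2 K) : Prop :=
  MvPolynomial.eval x.rep Q = 0

/-- Incidence between a point `L` of the dual projective plane (i.e. a line) and a
point `x` of the projective plane. -/
def Incid (L x : P2 K) : Prop :=
  ∑ i, L.rep i * x.rep i = 0

/-- The probability that a random line of `ℙ²(K)` meets the plane curve `{Q = 0}` in
exactly `k` points: the number of such lines divided by `q² + q + 1`, the total number
of lines of `ℙ²(K)` (where `q = |K|`). -/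
noncomputable def probLine (K : Type) [Field K] [Fintype K]
    (Q : MvPolynomial (Fin 3) K) (k : ℕ) : ℝ :=
  (Nat.card {L : P2 K // Nat.card {x : P2 K // OnCurve Q x ∧ Incid L x} = k} : ℝ) /
    ((Fintype.card K : ℝ) ^ 2 + (Fintype.card K : ℝ) + 1)

/-- Simple tangency for the plane curve of degree `d` cut out by `Q` (to be applied over
an algebraically closed field): there is a line meeting the curve in exactly `d - 1`
points, all of them smooth points of the curve, which is transversal at all of them
except exactly one, where it is tangent.  (At a smooth point, the line `a` is tangent to
the curve exactly when the gradient of `Q` there is proportional to `a`; the tangency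
point then has intersection multiplicity `2`, since the total intersection multiplicity
is `d`.) -/
def SimpleTangencyPlane (d : ℕ) (Q : MvPolynomial (Fin 3) K) : Prop :=
  ∃ a : Fin 3 → K, a ≠ 0 ∧
    Nat.card {x : P2 K // OnCurve Q x ∧ (∑ i, a i * x.rep i = 0)} = d - 1 ∧
    (∀ x : P2 K, OnCurve Q x → (∑ i, a i * x.rep i = 0) →
      (fun r => MvPolynomial.eval x.rep (MvPolynomial.pderiv r Q)) ≠ 0) ∧
    ∃ x₀ : P2 K, (OnCurve Q x₀ ∧ (∑ i, a i * x₀.rep i = 0)) ∧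
      (∃ c : K, (fun r => MvPolynomial.eval x₀.rep (MvPolynomial.pderiv r Q)) = c • a) ∧
      ∀ x : P2 K, OnCurve Q x → (∑ i, a i * x.rep i = 0) →
        (∃ c : K, (fun r => MvPolynomial.eval x.rep (MvPolynomial.pderiv r Q)) = c • a) →
        x = x₀

end IncidenceProb

namespace IncAux

/-- evaluation of polynomials in `v` and `X_i`. -/
noncomputable def ev {κ A : Type} [Field κ] [CommRing A] [Algebra κ A] {d : ℕ} (v : A)
    (x : Fin d → A) : MvPolynomial (Option (Fin d)) κ →ₐ[κ] A :=
  aeval (fun o => o.elim v x)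

section
variable {κ A B : Type} [Field κ] [CommRing A] [Algebra κ A] [CommRing B] [Algebra κ B] {d : ℕ}

lemma ev_rn (v : A) (x : Fin d → A) (τ : Equiv.Perm (Fin d)) (h : MvPolynomial (Option (Fin d)) κ) :
    ev v x (rename (Option.map τ) h) = ev v (x ∘ τ) h := by
  unfold ev
  rw [aeval_rename]
  congr 2
  funext o; cases o <;> rfl

lemma ev_map (f : A →ₐ[κ] B) (v : A) (x : Fin d → A) (h : MvPolynomial (Option (Fin d)) κ) :
    f (ev v x h) = ev (f v) (f ∘ x) h := by
  unfold ev
  rw [← AlgHom.comp_apply, comp_aeval]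
  congr 2
  funext o; cases o <;> rfl

lemma symm_eval {R : Type} [CommRing R] (g : Polynomial R) (Θ : MvPolynomial (Fin d) R)
    (hΘ : Θ.IsSymmetric) : ∃ θ : R, ∀ (S : Type) [CommRing S] (φ : R →+* S) (y : Fin d → S),
      g.map φ = ∏ i, (Polynomial.X - Polynomial.C (y i)) → eval₂ φ y Θ = φ θ := by
  obtain ⟨p, hp⟩ := (esymmAlgHom_fin_bijective R d).2 ⟨Θ, hΘ⟩
  have hp' : aeval (fun i : Fin d ↦ esymm (Fin d) R (i + 1)) p = Θ := by
    rw [← esymmAlgHom_apply, hp]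
  refine ⟨eval (fun i : Fin d => (-1) ^ ((i : ℕ) + 1) * g.coeff (d - (i + 1))) p, ?_⟩
  intro S _ φ y hy
  let _ := φ.toAlgebra
  have e1 : eval₂ φ y Θ = aeval y Θ := rfl
  have e2 : ∀ q : MvPolynomial (Fin d) R, ∀ z : Fin d → R, φ (eval z q) = aeval (fun i => φ (z i)) q := by
    intro q z
    rw [← eval₂_id, hom_eval₂]; rfl
  rw [e1, e2, ← hp', ← AlgHom.comp_apply, comp_aeval]
  congr 2
  funext i
  rw [aeval_esymm_eq_multiset_esymm, map_mul, map_pow, map_neg, map_one, ← Polynomial.coeff_map, hy]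
  have h2 : (∏ i, (Polynomial.X - Polynomial.C (y i))) =
      ((Finset.univ.val.map y).map (fun t => Polynomial.X - Polynomial.C t)).prod := by
    rw [Multiset.map_map]; rfl
  have hc : Multiset.card (Finset.univ.val.map y) = d := by simp
  rw [h2, Multiset.prod_X_sub_C_coeff _ (by rw [hc]; omega), hc]
  have : d - (d - ((i : ℕ) + 1)) = i + 1 := by omega
  rw [this, ← mul_assoc, ← mul_pow]; simp

/-- ST -/
lemma symm_eval' (g : Polynomial (Polynomial κ)) (Θ : MvPolynomial (Option (Fin d)) κ)
    (hΘ : ∀ τ : Equiv.Perm (Fin d), rename (Option.map τ) Θ = Θ) :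
    ∃ θ : Polynomial κ, ∀ (S : Type) [CommRing S] [Algebra κ S] (v : S) (y : Fin d → S),
      g.map (Polynomial.aeval v : Polynomial κ →ₐ[κ] S).toRingHom
        = ∏ i, (Polynomial.X - Polynomial.C (y i)) → ev v y Θ = Polynomial.aeval v θ := by
  have hs : (optionEquivRight κ (Fin d) Θ).IsSymmetric := by
    intro τ
    conv_rhs => rw [← hΘ τ]
    have : ∀ Q : MvPolynomial (Option (Fin d)) κ,
      rename τ (optionEquivRight κ (Fin d) Q) = optionEquivRight κ (Fin d) (rename (Option.map τ) Q) := by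
      intro Q
      induction Q using MvPolynomial.induction_on with
      | C a => simp [optionEquivRight_C]
      | add p q hp hq => simp only [map_add, eval₂_add, hp, hq]
      | mul_X p n hp =>
        simp only [map_mul, hp, rename_X]
        cases n <;> simp [optionEquivRight_X_none, optionEquivRight_X_some]
    exact this Θ
  obtain ⟨θ, hθ⟩ := symm_eval g _ hs
  refine ⟨θ, fun S _ _ v y hy => ?_⟩
  have := hθ S _ y hy
  rw [AlgHom.toRingHom_eq_coe, RingHom.coe_coe] at this
  rw [← this]
  generalize Θ = Q
  induction Q using MvPolynomial.induction_on with
  | C a => simp [optionEquivRight_C, ev]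
  | add p q hp hq => simp only [map_add, eval₂_add, hp, hq]
  | mul_X p n hp =>
    simp only [map_mul, hp, eval₂_mul]
    cases n <;> simp [optionEquivRight_X_none, optionEquivRight_X_some, ev]

/-- INT -/
lemma interp {L : Type} [Field L] (y : Fin d → L) (hy : Function.Injective y)
    (w : Equiv.Perm (Fin d) → L)
    (h : ∀ e : Fin d → Fin d, ∑ τ, w τ * ∏ i, y (τ i) ^ (e i : ℕ) = 0) : w = 0 := by
  funext τ0
  let f : Fin d → Polynomial L := fun i =>
    ∏ j ∈ Finset.univ.erase (τ0 i), (Polynomial.X - Polynomial.C (y j))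
  have hdeg : ∀ i, (f i).natDegree < d := by
    intro i
    have h1 : (f i).natDegree ≤ d - 1 := by
      refine (Polynomial.natDegree_prod_le _ _).trans ?_
      refine (Finset.sum_le_card_nsmul _ _ 1 (fun j _ => by simp)).trans ?_
      simp
    have : 0 < d := i.pos
    omega
  have key : ∑ τ, w τ * ∏ i, (f i).eval (y (τ i)) = 0 := by
    have : ∀ τ : Equiv.Perm (Fin d), ∏ i, (f i).eval (y (τ i)) =
        ∑ e : Fin d → Fin d, (∏ i, (f i).coeff (e i)) * ∏ i, y (τ i) ^ (e i : ℕ) := by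
      intro τ
      have h1 : ∀ i, (f i).eval (y (τ i)) = ∑ j : Fin d, (f i).coeff j * y (τ i) ^ (j : ℕ) := by
        intro i
        rw [Polynomial.eval_eq_sum_range' (hdeg i), Finset.sum_range]
      simp_rw [h1]
      rw [Finset.prod_univ_sum]
      simp_rw [Finset.prod_mul_distrib]
      simp
    simp_rw [this, Finset.mul_sum]
    rw [Finset.sum_comm]
    apply Finset.sum_eq_zero
    intro e _
    have := h e
    calc _ = (∏ i, (f i).coeff (e i)) * ∑ τ, w τ * ∏ i, y (τ i) ^ (e i : ℕ) := by
          rw [Finset.mul_sum]; apply Finset.sum_congr rfl; intros; ring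
      _ = 0 := by rw [this, mul_zero]
  rw [Finset.sum_eq_single τ0] at key
  · rcases mul_eq_zero.1 key with h0 | h0
    · exact h0
    · exfalso
      rw [Finset.prod_eq_zero_iff] at h0
      obtain ⟨i, -, hi⟩ := h0
      simp only [f, Polynomial.eval_prod, Finset.prod_eq_zero_iff] at hi
      obtain ⟨j, hj, hij⟩ := hi
      simp only [Polynomial.eval_sub, Polynomial.eval_X, Polynomial.eval_C, sub_eq_zero] at hij
      exact (Finset.mem_erase.1 hj).1 (hy hij).symm
  · intro τ _ hτ
    obtain ⟨i, hi⟩ : ∃ i, τ i ≠ τ0 i := by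
      by_contra hcon; push Not at hcon; exact hτ (Equiv.ext hcon)
    rw [Finset.prod_eq_zero (Finset.mem_univ i), mul_zero]
    simp only [f, Polynomial.eval_prod]
    apply Finset.prod_eq_zero (i := τ i) (by simp [hi])
    simp
  · simp
end
end IncAux

namespace IncAux

/-- the element `v = 1/λ`. -/
noncomputable def V (κ : Type) [Field κ] : LaurentSeries κ := HahnSeries.single (-1) 1

noncomputable abbrev ow (κ : Type) [Field κ] := HahnSeries.addVal ℤ κ

section
variable {κ : Type} [Field κ] {d : ℕ}

lemma algL (a : κ) : algebraMap κ (LaurentSeries κ) a = HahnSeries.C a := by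
  rw [HahnSeries.algebraMap_apply']
  simp [PowerSeries.algebraMap_apply, HahnSeries.ofPowerSeries_C]

lemma ow_V : ow κ (V κ) = ((-1 : ℤ) : WithTop ℤ) := by
  rw [HahnSeries.addVal_apply, V, HahnSeries.orderTop_single one_ne_zero]

lemma coeff_zero_of_lt_ow {s : LaurentSeries κ} {n : ℤ} (h : (n : WithTop ℤ) < ow κ s) : s.coeff n = 0 := by
  by_contra h0
  exact absurd (HahnSeries.addVal_le_of_coeff_ne_zero h0) (not_le.2 h)

lemma le_ow_of_coeff {s : LaurentSeries κ} {n : ℤ} (h : ∀ m < n, s.coeff m = 0) :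
    (n : WithTop ℤ) ≤ ow κ s := by
  by_cases hs : s = 0
  · simp [hs]
  rw [HahnSeries.addVal_apply_of_ne hs, WithTop.coe_le_coe]
  by_contra hlt
  push Not at hlt
  exact HahnSeries.coeff_order_eq_zero.not.2 hs (h _ hlt)

lemma coeff_aeval_V (θ : Polynomial κ) (m : ℤ) :
    (Polynomial.aeval (V κ) θ).coeff m = if 0 ≤ -m then θ.coeff (-m).toNat else 0 := by
  have hV : ∀ n : ℕ, (V κ) ^ n = HahnSeries.single (-(n : ℤ)) 1 := by
    intro n; rw [V, HahnSeries.single_pow]; simp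
  rw [Polynomial.aeval_def, Polynomial.eval₂_eq_sum_range, HahnSeries.coeff_sum]
  simp_rw [hV, algL, HahnSeries.C_mul_eq_smul, HahnSeries.coeff_smul, HahnSeries.coeff_single]
  split_ifs with h
  · by_cases h2 : (-m).toNat < θ.natDegree + 1
    · rw [Finset.sum_eq_single (-m).toNat]
      · rw [if_pos (by omega)]; simp
      · intro b _ hb; rw [if_neg (by omega)]; simp
      · intro hh; exact absurd (Finset.mem_range.2 h2) hh
    · rw [Polynomial.coeff_eq_zero_of_natDegree_lt (by omega)]
      apply Finset.sum_eq_zero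
      intro b hb
      rw [Finset.mem_range] at hb
      rw [if_neg (by omega)]; simp
  · apply Finset.sum_eq_zero
    intro b hb
    rw [if_neg (by omega)]; simp

lemma ow_aeval (θ : Polynomial κ) (hθ : θ ≠ 0) :
    ow κ (Polynomial.aeval (V κ) θ) = ((-(θ.natDegree : ℤ) : ℤ) : WithTop ℤ) := by
  have hc := coeff_aeval_V θ
  apply le_antisymm
  · apply HahnSeries.addVal_le_of_coeff_ne_zero
    rw [hc, if_pos (by omega)]
    simpa using hθ
  · apply le_ow_of_coeff
    intro m hm
    rw [hc, if_pos (by omega)]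
    exact Polynomial.coeff_eq_zero_of_natDegree_lt (by omega)

lemma aeval_V_eq_zero {θ : Polynomial κ} (h : Polynomial.aeval (V κ) θ = 0) : θ = 0 := by
  by_contra h0
  have := ow_aeval θ h0
  rw [h, AddValuation.map_zero] at this
  exact WithTop.coe_ne_top this.symm

lemma ow_ev (ξ : Fin d → LaurentSeries κ) (hξ : ∀ i, ((-1 : ℤ) : WithTop ℤ) ≤ ow κ (ξ i))
    (h : MvPolynomial (Option (Fin d)) κ) {n : ℕ} (hn : h.totalDegree ≤ n) :
    ((-(n : ℤ) : ℤ) : WithTop ℤ) ≤ ow κ (ev (V κ) ξ h) := by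
  unfold ev
  rw [aeval_eq_eval₂Hom, coe_eval₂Hom, eval₂_eq']
  apply AddValuation.map_le_sum
  intro m hm
  have hz : ∀ o : Option (Fin d), ((-1 : ℤ) : WithTop ℤ) ≤ ow κ (o.elim (V κ) ξ) := by
    intro o; cases o
    · exact ow_V.ge
    · exact hξ _
  have hp : ∀ s : Finset (Option (Fin d)), ((-(∑ i ∈ s, m i : ℕ) : ℤ) : WithTop ℤ) ≤
      ow κ (∏ i ∈ s, (i.elim (V κ) ξ) ^ m i) := by
    intro s
    induction s using Finset.induction_on with
    | empty => simp
    | insert a s ha ih =>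
      rw [Finset.sum_insert ha, Finset.prod_insert ha, AddValuation.map_mul]
      have h1 : ((-(m a : ℤ) : ℤ) : WithTop ℤ) ≤ ow κ ((a.elim (V κ) ξ) ^ m a) := by
        rw [AddValuation.map_pow]
        have := nsmul_le_nsmul_right (hz a) (m a)
        refine le_trans (le_of_eq ?_) this
        rw [← WithTop.coe_nsmul]; simp
      refine le_trans (le_of_eq ?_) (add_le_add h1 ih)
      rw [← WithTop.coe_add]; congr 1; push_cast; ring
  have hdeg : ∑ i, m i ≤ n := by
    refine le_trans ?_ hn
    have := le_totalDegree hm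
    rwa [Finsupp.sum_fintype _ _ (by simp)] at this
  have hcoef : (0 : WithTop ℤ) ≤ ow κ (algebraMap κ (LaurentSeries κ) (coeff m h)) := by
    rw [algL]
    have := le_ow_of_coeff (s := HahnSeries.C (coeff m h)) (n := 0) ?_
    · simpa using this
    · intro k hk; simp [HahnSeries.C_apply, HahnSeries.coeff_single, hk.ne]
  rw [AddValuation.map_mul]
  calc _ ≤ ((-(∑ i, m i : ℕ) : ℤ) : WithTop ℤ) := by
        rw [WithTop.coe_le_coe]; push_cast at *; have : (∑ i, (m i : ℤ)) ≤ n := by exact_mod_cast hdeg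
        linarith
    _ = 0 + _ := (zero_add _).symm
    _ ≤ _ := add_le_add hcoef (hp _)

/-- `(v,y)` is a splitting point of `g`. -/
def Spl (g : Polynomial (Polynomial κ)) {S : Type} [CommRing S] [Algebra κ S] (v : S) (y : Fin d → S) : Prop :=
  g.map (Polynomial.aeval v : Polynomial κ →ₐ[κ] S).toRingHom
        = ∏ i, (Polynomial.X - Polynomial.C (y i))

structure Frame (κ : Type) [Field κ] (d : ℕ) where
  g : Polynomial (Polynomial κ)
  ξ : Fin d → LaurentSeries κ
  spl : Spl g (V κ) ξ
  inj : Function.Injective ξ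
  ord : ∀ i, ((-1 : ℤ) : WithTop ℤ) ≤ ow κ (ξ i)
  full : ∀ h : MvPolynomial (Option (Fin d)) κ, ev (V κ) ξ h = 0 →
    ∀ τ : Equiv.Perm (Fin d), ev (V κ) (ξ ∘ τ) h = 0

lemma Spl.perm {g : Polynomial (Polynomial κ)} {S : Type} [CommRing S] [Algebra κ S] {v : S} {y : Fin d → S}
    (h : Spl g v y) (τ : Equiv.Perm (Fin d)) : Spl g v (y ∘ τ) := by
  unfold Spl at *
  rw [h]
  exact (Equiv.prod_comp τ (fun i => Polynomial.X - Polynomial.C (y i))).symm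

/-- trace -/
lemma exists_trace (g : Polynomial (Polynomial κ)) (h : MvPolynomial (Option (Fin d)) κ) :
    ∃ θ : Polynomial κ, ∀ (S : Type) [CommRing S] [Algebra κ S] (v : S) (y : Fin d → S),
      Spl g v y → ∑ τ : Equiv.Perm (Fin d), ev v (y ∘ τ) h = Polynomial.aeval v θ := by
  obtain ⟨θ, hθ⟩ := symm_eval' g (∑ τ : Equiv.Perm (Fin d), rename (Option.map τ) h) (by
    intro σ
    rw [map_sum]
    simp_rw [rename_rename, Option.map_comp_map]
    exact Fintype.sum_equiv (Equiv.mulLeft σ) _ _ (fun τ => rfl))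
  refine ⟨θ, fun S _ _ v y hy => ?_⟩
  rw [← hθ S v y hy, map_sum]
  simp_rw [ev_rn]

lemma exists_norm (g : Polynomial (Polynomial κ)) (h : MvPolynomial (Option (Fin d)) κ) :
    ∃ θ : Polynomial κ, ∀ (S : Type) [CommRing S] [Algebra κ S] (v : S) (y : Fin d → S),
      Spl g v y → ∏ τ : Equiv.Perm (Fin d), ev v (y ∘ τ) h = Polynomial.aeval v θ := by
  obtain ⟨θ, hθ⟩ := symm_eval' g (∏ τ : Equiv.Perm (Fin d), rename (Option.map τ) h) (by
    intro σ
    rw [map_prod]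
    simp_rw [rename_rename, Option.map_comp_map]
    exact Fintype.prod_equiv (Equiv.mulLeft σ) _ _ (fun τ => rfl))
  refine ⟨θ, fun S _ _ v y hy => ?_⟩
  rw [← hθ S v y hy, map_prod]
  simp_rw [ev_rn]

variable (Φ : Frame κ d)

lemma Frame.ne (h : MvPolynomial (Option (Fin d)) κ) (h0 : ev (V κ) Φ.ξ h ≠ 0) (τ : Equiv.Perm (Fin d)) :
    ev (V κ) (Φ.ξ ∘ τ) h ≠ 0 := by
  intro h1
  rw [← ev_rn] at h1
  have := Φ.full _ h1 τ⁻¹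
  rw [ev_rn] at this
  apply h0
  rw [← this]
  congr 2
  funext i; simp

lemma ow_prod {ι : Type} (s : Finset ι) (f : ι → LaurentSeries κ) :
    ow κ (∏ i ∈ s, f i) = ∑ i ∈ s, ow κ (f i) := by
  classical
  induction s using Finset.induction_on with
  | empty => simp
  | insert a s ha ih => rw [Finset.prod_insert ha, Finset.sum_insert ha, AddValuation.map_mul, ih]

/-- S1 -/
lemma Frame.norm (h : MvPolynomial (Option (Fin d)) κ) (h0 : ev (V κ) Φ.ξ h ≠ 0) :
    ∃ θ : Polynomial κ, θ ≠ 0 ∧ (∀ (S : Type) [CommRing S] [Algebra κ S] (v : S) (y : Fin d → S),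
      Spl Φ.g v y → ∏ τ : Equiv.Perm (Fin d), ev v (y ∘ τ) h = Polynomial.aeval v θ) ∧
      θ.natDegree ≤ d.factorial * h.totalDegree ∧
      ow κ (ev (V κ) Φ.ξ h) ≤ (((d.factorial - 1) * h.totalDegree : ℤ) : WithTop ℤ) ∧
      ∃ τ : Equiv.Perm (Fin d), ow κ (ev (V κ) (Φ.ξ ∘ τ) h) ≤ 0 := by
  obtain ⟨θ, hθ⟩ := exists_norm Φ.g h
  have hV := hθ _ _ _ Φ.spl
  have hθ0 : θ ≠ 0 := by
    rintro rfl
    rw [map_zero, Finset.prod_eq_zero_iff] at hV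
    obtain ⟨τ, -, hτ⟩ := hV
    exact Φ.ne h h0 τ hτ
  have hord := ow_aeval θ hθ0
  rw [← hV, ow_prod] at hord
  have hfin : ∀ τ : Equiv.Perm (Fin d), ∃ m : ℤ, ow κ (ev (V κ) (Φ.ξ ∘ τ) h) = m ∧ -(h.totalDegree : ℤ) ≤ m := by
    intro τ
    have := ow_ev (Φ.ξ ∘ τ) (fun i => Φ.ord _) h le_rfl
    rw [HahnSeries.addVal_apply_of_ne (Φ.ne h h0 τ)] at this ⊢
    exact ⟨_, rfl, WithTop.coe_le_coe.1 this⟩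
  choose m hm1 hm2 using hfin
  simp_rw [hm1] at hord
  rw [← WithTop.coe_sum] at hord
  have hord' : ∑ τ, m τ = -(θ.natDegree : ℤ) := by exact_mod_cast hord
  have hcard : (Finset.univ : Finset (Equiv.Perm (Fin d))).card = d.factorial := by
    rw [Finset.card_univ, Fintype.card_perm, Fintype.card_fin]
  refine ⟨θ, hθ0, hθ, ?_, ?_, ?_⟩
  · have := Finset.card_nsmul_le_sum Finset.univ m _ (fun τ _ => hm2 τ)
    rw [hord', hcard] at this
    simp only [nsmul_eq_mul] at this
    zify; linarith
  · have e1 : ow κ (ev (V κ) Φ.ξ h) = m 1 := by rw [← hm1 1]; rfl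
    rw [e1, WithTop.coe_le_coe]
    have h2 := Finset.card_nsmul_le_sum (Finset.univ.erase 1) m _ (fun τ _ => hm2 τ)
    rw [Finset.card_erase_of_mem (Finset.mem_univ _), hcard] at h2
    have h3 := Finset.add_sum_erase Finset.univ m (Finset.mem_univ 1)
    have h4 : 1 ≤ d.factorial := Nat.factorial_pos d
    rw [nsmul_eq_mul, Nat.cast_sub h4] at h2
    push_cast at h2
    have : (0 : ℤ) ≤ θ.natDegree := by positivity
    linarith
  · by_contra hcon
    push Not at hcon
    have h1 : ∀ τ ∈ Finset.univ, 0 < m τ := by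
      intro τ _
      have := hcon τ
      rw [hm1] at this
      exact_mod_cast this
    have := Finset.sum_pos h1 ⟨1, Finset.mem_univ _⟩
    omega

/-- S2 -/
lemma Frame.vanish {A : Type} [Field A] [Algebra κ A] (h : MvPolynomial (Option (Fin d)) κ) (h0 : ev (V κ) Φ.ξ h = 0)
    (v : A) (y : Fin d → A) (hy : Function.Injective y) (hs : Spl Φ.g v y) : ev v y h = 0 := by
  have := interp y hy (fun τ => ev v (y ∘ τ) h) (by
    intro e
    obtain ⟨θ, hθ⟩ := exists_trace Φ.g (h * ∏ i, X (some i) ^ (e i : ℕ))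
    have hp : ∀ (S : Type) [CommRing S] [Algebra κ S] (v : S) (y : Fin d → S),
      ev v y (h * ∏ i, X (some i) ^ (e i : ℕ)) = ev v y h * ∏ i, y i ^ (e i : ℕ) := by
      intro S _ _ v y
      rw [map_mul, map_prod]; simp [ev]
    have h1 := hθ _ _ _ Φ.spl
    rw [Finset.sum_eq_zero] at h1
    · have := hθ _ _ _ hs
      rw [aeval_V_eq_zero h1.symm, map_zero] at this
      simp_rw [hp] at this
      simpa using this
    · intro τ _
      rw [hp, Φ.full h h0 τ, zero_mul])
  simpa using congrFun this 1
end
end IncAux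

namespace IncAux

lemma eq_prod_of_roots {A : Type} [CommRing A] [IsDomain A] {d : ℕ} (f : Polynomial A) (hm : f.Monic)
    (hd : f.natDegree = d) (y : Fin d → A) (hy : Function.Injective y) (h0 : ∀ i, f.eval (y i) = 0) :
    f = ∏ i, (Polynomial.X - Polynomial.C (y i)) := by
  have hdvd : (∏ i, (Polynomial.X - Polynomial.C (y i))) ∣ f := by
    have hle : Finset.univ.val.map y ≤ f.roots := by
      rw [Multiset.le_iff_subset (Multiset.Nodup.map hy Finset.univ.nodup)]
      intro a ha
      obtain ⟨i, -, rfl⟩ := Multiset.mem_map.1 ha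
      exact (Polynomial.mem_roots hm.ne_zero).2 (h0 i)
    have := (Multiset.prod_X_sub_C_dvd_iff_le_roots hm.ne_zero (Finset.univ.val.map y)).2 hle
    rwa [Multiset.map_map] at this
  have hm2 : (∏ i, (Polynomial.X - Polynomial.C (y i))).Monic :=
    Polynomial.monic_prod_of_monic _ _ (fun i _ => Polynomial.monic_X_sub_C _)
  refine (Polynomial.eq_of_monic_of_dvd_of_natDegree_le hm2 hm hdvd ?_)
  rw [hd, Polynomial.natDegree_prod_of_monic _ _ (fun i _ => Polynomial.monic_X_sub_C _)]
  simp

/-- Hensel's lemma over `R⟦X⟧`, with control of the coefficients. -/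
lemma hensel {R : Type} [CommRing R] (G : Polynomial (PowerSeries R)) (θ u : R)
    (h0 : (G.map PowerSeries.constantCoeff).eval θ = 0)
    (hu : u * (G.map PowerSeries.constantCoeff).derivative.eval θ = 1) :
    ∃ ξ : PowerSeries R, G.eval ξ = 0 ∧ PowerSeries.constantCoeff ξ = θ ∧
      ∀ B : Subring (PowerSeries R), (∀ n, G.coeff n ∈ B) → PowerSeries.C θ ∈ B → PowerSeries.C u ∈ B →
        ∀ n, ∃ b ∈ B, ∀ m ≤ n, PowerSeries.coeff m ξ = PowerSeries.coeff m b := by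
  let s : ℕ → PowerSeries R := fun n => Nat.rec (PowerSeries.C θ) (fun _ x => x - PowerSeries.C u * G.eval x) n
  have s0 : s 0 = PowerSeries.C θ := rfl
  have ss : ∀ n, s (n + 1) = s n - PowerSeries.C u * G.eval (s n) := fun n => rfl
  have cc : ∀ (H : Polynomial (PowerSeries R)) x, PowerSeries.constantCoeff (H.eval x) =
      (H.map PowerSeries.constantCoeff).eval (PowerSeries.constantCoeff x) := by
    intro H x; rw [Polynomial.eval_map, ← Polynomial.eval₂_at_apply]
  have key : ∀ n, PowerSeries.constantCoeff (s n) = θ ∧ PowerSeries.X ^ (n + 1) ∣ G.eval (s n) := by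
    intro n
    induction n with
    | zero =>
      refine ⟨by rw [s0]; simp, ?_⟩
      rw [zero_add, pow_one, PowerSeries.X_dvd_iff, cc, s0]; simpa using h0
    | succ n ih =>
      obtain ⟨i1, i2⟩ := ih
      have i3 : PowerSeries.X ∣ G.eval (s n) := (dvd_pow_self _ (Nat.succ_ne_zero n)).trans i2
      have i4 := PowerSeries.X_dvd_iff.1 i3
      refine ⟨by rw [ss, map_sub, map_mul, i1, i4]; simp, ?_⟩
      obtain ⟨k, hk⟩ := Polynomial.binomExpansion G (s n) (-(PowerSeries.C u * G.eval (s n)))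
      rw [ss, sub_eq_add_neg, hk]
      have e : G.eval (s n) + G.derivative.eval (s n) * -(PowerSeries.C u * G.eval (s n))
          + k * (-(PowerSeries.C u * G.eval (s n))) ^ 2 =
          G.eval (s n) * ((1 - PowerSeries.C u * G.derivative.eval (s n)) + G.eval (s n) * (k * PowerSeries.C u ^ 2)) := by ring
      rw [e, pow_succ]
      refine mul_dvd_mul i2 (dvd_add ?_ (i3.mul_right _))
      rw [PowerSeries.X_dvd_iff, map_sub, map_mul, cc, i1, Polynomial.derivative_map] at *
      simp only [PowerSeries.constantCoeff_C, map_one]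
      rw [hu, sub_self]
  have hstab : ∀ n j, PowerSeries.X ^ (n + 1) ∣ s (n + j) - s n := by
    intro n j
    induction j with
    | zero => simp
    | succ j ih =>
      rw [← add_assoc, ss]
      have : PowerSeries.X ^ (n + 1) ∣ G.eval (s (n + j)) := (pow_dvd_pow _ (by omega)).trans (key (n + j)).2
      have e : s (n + j) - PowerSeries.C u * G.eval (s (n + j)) - s n =
        (s (n + j) - s n) - PowerSeries.C u * G.eval (s (n + j)) := by ring
      rw [e]
      exact dvd_sub ih (this.mul_left _)
  let ξ : PowerSeries R := PowerSeries.mk fun n => PowerSeries.coeff n (s n)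
  have hξ : ∀ n, ∀ m ≤ n, PowerSeries.coeff m ξ = PowerSeries.coeff m (s n) := by
    intro n m hm
    have := (PowerSeries.X_pow_dvd_iff.1 (hstab m (n - m))) m (by omega)
    rw [map_sub, sub_eq_zero, Nat.add_sub_cancel' hm] at this
    rw [this]; simp [ξ]
  have hξ' : ∀ n, PowerSeries.X ^ (n + 1) ∣ ξ - s n := by
    intro n; rw [PowerSeries.X_pow_dvd_iff]; intro m hm; rw [map_sub, hξ n m (by omega), sub_self]
  refine ⟨ξ, ?_, ?_, ?_⟩
  · ext n
    have h1 : PowerSeries.X ^ (n + 1) ∣ G.eval ξ := by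
      have := (hξ' n).trans (Polynomial.sub_dvd_eval_sub ξ (s n) G)
      simpa using dvd_add this (key n).2
    simpa using PowerSeries.X_pow_dvd_iff.1 h1 n (by omega)
  · have := hξ 0 0 le_rfl
    rw [s0] at this
    simpa using this
  · intro B hB hθ hu n
    refine ⟨s n, ?_, hξ n⟩
    have hev : ∀ x ∈ B, G.eval x ∈ B := by
      intro x hx
      rw [Polynomial.eval_eq_sum_range]
      exact B.sum_mem fun i _ => B.mul_mem (hB i) (B.pow_mem hx i)
    clear * - hev hθ hu s0 ss
    induction n with
    | zero => exact hθ
    | succ n ih => rw [ss]; exact B.sub_mem ih (B.mul_mem hu (hev _ ih))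

lemma spl_monic {κ : Type} [Field κ] {d : ℕ} {g : Polynomial (Polynomial κ)} {ξ : Fin d → LaurentSeries κ}
    (h : Spl g (V κ) ξ) : g.Monic ∧ g.natDegree = d := by
  have hinj : Function.Injective (Polynomial.aeval (V κ) : Polynomial κ →ₐ[κ] LaurentSeries κ).toRingHom :=
    (injective_iff_map_eq_zero _).2 (fun θ h => aeval_V_eq_zero h)
  have hm2 : (∏ i, (Polynomial.X - Polynomial.C (ξ i))).Monic :=
    Polynomial.monic_prod_of_monic _ _ (fun i _ => Polynomial.monic_X_sub_C _)
  unfold Spl at h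
  refine ⟨Polynomial.monic_of_injective hinj (by rw [h]; exact hm2), ?_⟩
  rw [← Polynomial.natDegree_map_eq_of_injective hinj, h,
    Polynomial.natDegree_prod_of_monic _ _ (fun i _ => Polynomial.monic_X_sub_C _)]
  simp

/-- lifting a splitting point -/
lemma spl_lift {k : Type} [Field k] {d : ℕ} {g : Polynomial (Polynomial k)} (hg : g.Monic) (hd : g.natDegree = d)
    (v : k) (x : Fin d → k) (hx : Function.Injective x) (hs : Spl g v x) :
    ∃ y : Fin d → PowerSeries k, Spl g (PowerSeries.C v + PowerSeries.X) y ∧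
      ∀ i, PowerSeries.constantCoeff (y i) = x i := by
  set G := g.map (Polynomial.aeval (PowerSeries.C v + PowerSeries.X) : Polynomial k →ₐ[k] PowerSeries k).toRingHom with hG
  have hGc : G.map PowerSeries.constantCoeff = ∏ i, (Polynomial.X - Polynomial.C (x i)) := by
    rw [← hs, hG, Polynomial.map_map]
    congr 1
    ext <;> simp
  have hder : ∀ i, (G.map PowerSeries.constantCoeff).derivative.eval (x i) ≠ 0 := by
    intro i
    have hsep : (∏ i, (Polynomial.X - Polynomial.C (x i))).Separable := by
      have := (Polynomial.separable_prod_X_sub_C_iff (f := x)).2 hx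
      exact this
    rw [hGc]
    intro h
    have h2 := hsep.aeval_derivative_ne_zero (x := x i) (by
      rw [Polynomial.coe_aeval_eq_eval, Polynomial.eval_prod]
      exact Finset.prod_eq_zero (Finset.mem_univ i) (by simp))
    exact h2 (by rwa [Polynomial.coe_aeval_eq_eval])
  have hz : ∀ i, (G.map PowerSeries.constantCoeff).eval (x i) = 0 := by
    intro i
    rw [hGc, Polynomial.eval_prod]
    exact Finset.prod_eq_zero (Finset.mem_univ i) (by simp)
  choose y hy1 hy2 _ using fun i => hensel G (x i) _ (hz i) (inv_mul_cancel₀ (hder i))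
  refine ⟨y, ?_, hy2⟩
  apply eq_prod_of_roots G (hg.map _) _ y _ hy1
  · rw [hG, hg.natDegree_map, hd]
  · intro i j hij
    apply hx
    rw [← hy2 i, ← hy2 j, hij]
end IncAux

namespace IncAux
section
variable {κ : Type} [Field κ] {d : ℕ} (Φ : Frame κ d)

/-- S7 -/
lemma count_le {k : Type} [Field k] {d : ℕ} (Φ : Frame k d) (h : MvPolynomial (Option (Fin d)) k)
    (h0 : ev (V k) Φ.ξ h ≠ 0) (S : Set (k × (Fin d → k)))
    (hS : ∀ p ∈ S, Function.Injective p.2 ∧ Spl Φ.g p.1 p.2 ∧ ev p.1 p.2 h = 0) :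
    S.Finite ∧ S.ncard ≤ d.factorial * h.totalDegree := by
  classical
  obtain ⟨θ, hθ0, hθ, hdeg, -⟩ := Φ.norm h h0
  obtain ⟨hgm, hgd⟩ := spl_monic Φ.spl
  have key : ∀ (v : k) (x : Fin d → k), Function.Injective x → Spl Φ.g v x →
      (Finset.univ.filter fun τ : Equiv.Perm (Fin d) => ev v (x ∘ τ) h = 0).card ≤ θ.rootMultiplicity v := by
    intro v x hx hs
    obtain ⟨y, hy1, hy2⟩ := spl_lift hgm hgd v x hx hs
    have e := hθ _ _ _ hy1
    rw [Polynomial.le_rootMultiplicity_iff hθ0]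
    have hd1 : (PowerSeries.X : PowerSeries k) ^ (Finset.univ.filter fun τ : Equiv.Perm (Fin d) => ev v (x ∘ τ) h = 0).card ∣
        Polynomial.aeval (PowerSeries.C v + PowerSeries.X) θ := by
      rw [← e, ← Finset.prod_const]
      refine (Finset.prod_dvd_prod_of_dvd _ (fun τ : Equiv.Perm (Fin d) => ev (PowerSeries.C v + PowerSeries.X) (y ∘ τ) h) ?_).trans
        (Finset.prod_dvd_prod_of_subset _ _ _ (Finset.filter_subset _ _))
      intro τ hτ
      rw [PowerSeries.X_dvd_iff]
      let f : PowerSeries k →ₐ[k] k := { PowerSeries.constantCoeff with commutes' := fun r => by simp [PowerSeries.algebraMap_apply] }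
      have := ev_map f (PowerSeries.C v + PowerSeries.X) (y ∘ τ) h
      have e1 : f (PowerSeries.C v + PowerSeries.X) = v := by
        change PowerSeries.constantCoeff _ = _; simp
      have e2 : f ∘ y ∘ τ = x ∘ τ := by funext i; exact hy2 (τ i)
      rw [e1, e2] at this
      exact this.trans (Finset.mem_filter.1 hτ).2
    have e3 : Polynomial.aeval (PowerSeries.C v + PowerSeries.X) θ = ((Polynomial.taylor v θ : Polynomial k) : PowerSeries k) := by
      rw [Polynomial.taylor_apply, Polynomial.comp, Polynomial.aeval_def, ← Polynomial.coeToPowerSeries.ringHom_apply,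
        Polynomial.hom_eval₂]
      congr 1
      · ext1 a; simp [PowerSeries.algebraMap_apply]
      · simp [add_comm]
    rw [e3] at hd1
    have hd2 : (Polynomial.X : Polynomial k) ^ (Finset.univ.filter fun τ : Equiv.Perm (Fin d) => ev v (x ∘ τ) h = 0).card ∣ Polynomial.taylor v θ := by
      rw [Polynomial.X_pow_dvd_iff]
      intro m hm
      simpa using PowerSeries.X_pow_dvd_iff.1 hd1 m hm
    obtain ⟨r, hr⟩ := hd2
    refine ⟨r.comp (Polynomial.X - Polynomial.C v), ?_⟩
    have : θ = (Polynomial.taylor v θ).comp (Polynomial.X - Polynomial.C v) := by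
      rw [Polynomial.taylor_apply, Polynomial.comp_assoc]; simp
    conv_lhs => rw [this, hr]
    simp
  -- fibres
  have hfib : ∀ v : k, {p ∈ S | p.1 = v}.Finite ∧ {p ∈ S | p.1 = v}.ncard ≤ θ.rootMultiplicity v := by
    intro v
    by_cases hne : {p ∈ S | p.1 = v}.Nonempty
    · obtain ⟨⟨v', x⟩, hp, rfl⟩ := hne
      obtain ⟨hx, hs, -⟩ := hS _ hp
      simp only at hx hs ⊢
      have hsub : {p ∈ S | p.1 = v'} ⊆
          (fun τ : Equiv.Perm (Fin d) => (v', x ∘ τ)) '' ((Finset.univ.filter fun τ : Equiv.Perm (Fin d) => ev v' (x ∘ τ) h = 0) : Set _) := by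
        rintro ⟨w, x'⟩ ⟨hp', hw⟩
        simp only at hw
        subst hw
        obtain ⟨hx', hs', hh⟩ := hS _ hp'
        simp only at hx' hs' hh
        have hroot : ∀ i, ∃ j, x j = x' i := by
          intro i
          have e : (∏ j, (Polynomial.X - Polynomial.C (x j))) = ∏ j, (Polynomial.X - Polynomial.C (x' j)) := hs.symm.trans hs'
          have e2 := congrArg (Polynomial.eval (x' i)) e
          rw [Polynomial.eval_prod, Polynomial.eval_prod, Finset.prod_eq_zero (Finset.mem_univ i) (f := fun j => Polynomial.eval (x' i) (Polynomial.X - Polynomial.C (x' j))) (by simp),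
            Finset.prod_eq_zero_iff] at e2
          obtain ⟨j, -, hj⟩ := e2
          refine ⟨j, ?_⟩
          simp [sub_eq_zero] at hj
          exact hj.symm
        choose τ hτ using hroot
        have hτi : Function.Injective τ := by
          intro a b hab; apply hx'; rw [← hτ, ← hτ, hab]
        refine ⟨Equiv.ofBijective τ (Finite.injective_iff_bijective.1 hτi), ?_, ?_⟩
        · simp only [Finset.coe_filter, Finset.mem_univ, true_and, Set.mem_setOf_eq]
          rw [← hh]; congr 2; funext i; exact hτ i
        · simp only [Prod.mk.injEq, true_and]; funext i; exact hτ i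
      have hf := (Set.Finite.image (fun τ : Equiv.Perm (Fin d) => (v', x ∘ τ)) (Finset.finite_toSet (Finset.univ.filter fun τ : Equiv.Perm (Fin d) => ev v' (x ∘ τ) h = 0)))
      refine ⟨hf.subset hsub, ?_⟩
      refine (Set.ncard_le_ncard hsub hf).trans ((Set.ncard_image_le (Finset.finite_toSet _)).trans ?_)
      rw [Set.ncard_coe_finset]
      exact key v' x hx hs
    · rw [Set.not_nonempty_iff_eq_empty] at hne
      rw [hne]; simp
  have hcov : S = ⋃ v ∈ θ.roots.toFinset, {p ∈ S | p.1 = v} := by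
    ext p
    simp only [Set.mem_iUnion, Set.mem_setOf_eq, exists_prop]
    constructor
    · intro hp
      refine ⟨p.1, ?_, hp, rfl⟩
      obtain ⟨hx, hs, hh⟩ := hS _ hp
      have := key _ _ hx hs
      have h1 : 0 < (Finset.univ.filter fun τ : Equiv.Perm (Fin d) => ev p.1 (p.2 ∘ τ) h = 0).card :=
        Finset.card_pos.2 ⟨1, by simpa using hh⟩
      rw [Multiset.mem_toFinset, Polynomial.mem_roots hθ0, ← Polynomial.rootMultiplicity_pos hθ0]
      omega
    · rintro ⟨_, _, h, _⟩; exact h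
  constructor
  · rw [hcov]; exact Set.Finite.biUnion (Finset.finite_toSet _) fun v _ => (hfib v).1
  · refine le_trans ?_ hdeg
    rw [hcov]
    refine (Finset.set_ncard_biUnion_le _ _).trans ?_
    refine (Finset.sum_le_sum fun v _ => (hfib v).2).trans ?_
    refine le_trans (le_of_eq ?_) (Polynomial.card_roots' θ)
    rw [← Multiset.toFinset_sum_count_eq]
    simp [Polynomial.count_roots]

/-- S4 -/
lemma Frame.exists_rel {ι : Type} [Fintype ι] (h : ι → MvPolynomial (Option (Fin d)) κ) (n : ℕ)
    (hn : ∀ i, (h i).totalDegree ≤ n) (hc : d.factorial * (n + 1) < Fintype.card ι) :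
    ∃ c : ι → κ, c ≠ 0 ∧ ev (V κ) Φ.ξ (∑ i, c i • h i) = 0 := by
  classical
  let f : (ι → κ) →ₗ[κ] (Equiv.Perm (Fin d) × Fin (n + 1) → κ) :=
    { toFun := fun c p => (ev (V κ) (Φ.ξ ∘ p.1) (∑ i, c i • h i)).coeff (-(p.2 : ℤ))
      map_add' := by
        intro a b; funext p
        simp [add_smul, Finset.sum_add_distrib]
      map_smul' := by
        intro a b; funext p
        simp only [Pi.smul_apply, smul_eq_mul, RingHom.id_apply, mul_smul, ← Finset.smul_sum]
        rw [← C_mul', map_mul]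
        simp only [ev, algHom_C, algL, HahnSeries.C_mul_eq_smul, HahnSeries.coeff_smul, smul_eq_mul] }
  have hk : LinearMap.ker f ≠ ⊥ := by
    apply LinearMap.ker_ne_bot_of_finrank_lt
    simp only [Module.finrank_fintype_fun_eq_card, Fintype.card_prod, Fintype.card_perm, Fintype.card_fin]
    exact hc
  obtain ⟨c, hc1, hc2⟩ := (Submodule.ne_bot_iff _).1 hk
  refine ⟨c, hc2, ?_⟩
  by_contra hne
  have hdeg : (∑ i, c i • h i).totalDegree ≤ n :=
    totalDegree_finsetSum_le fun i _ => (totalDegree_smul_le _ _).trans (hn i)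
  obtain ⟨θ, -, -, -, -, τ, hτ⟩ := Φ.norm _ hne
  have h1 : ((1 : ℤ) : WithTop ℤ) ≤ ow κ (ev (V κ) (Φ.ξ ∘ τ) (∑ i, c i • h i)) := by
    apply le_ow_of_coeff
    intro m hm
    by_cases hmn : m < -n
    · apply coeff_zero_of_lt_ow
      exact lt_of_lt_of_le (WithTop.coe_lt_coe.2 hmn) (ow_ev (Φ.ξ ∘ τ) (fun i => Φ.ord _) _ hdeg)
    · have := congrFun (LinearMap.mem_ker.1 hc1) (τ, ⟨(-m).toNat, by omega⟩)
      simp only [f, LinearMap.coe_mk, AddHom.coe_mk, Pi.zero_apply] at this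
      rwa [show (-(((-m).toNat : ℕ) : ℤ)) = m by omega] at this
  have := h1.trans hτ
  exact absurd (WithTop.coe_le_coe.1 (this : ((1 : ℤ) : WithTop ℤ) ≤ ((0 : ℤ) : WithTop ℤ))) (by norm_num)

/-- S5 -/
lemma Frame.frob_indep (p : ℕ) [hp : Fact p.Prime] [CharP κ p] (r α : ℕ) (hα : d.factorial * α < p ^ r) {ι : Type} [DecidableEq ι]
    (s : ι → MvPolynomial (Option (Fin d)) κ) (hs : ∀ i, (s i).totalDegree ≤ α) :
    ∀ (n : ℕ) (J : Finset ι) (b : ι → LaurentSeries κ), J.card = n →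
      (∀ c : ι → κ, ∑ j ∈ J, HahnSeries.C (c j) * b j = 0 → ∀ j ∈ J, c j = 0) →
      ∑ j ∈ J, ev (V κ) Φ.ξ (s j) * b j ^ (p ^ r) = 0 → ∀ j ∈ J, ev (V κ) Φ.ξ (s j) = 0 := by
  haveI : CharP (LaurentSeries κ) p := charP_of_injective_ringHom (HahnSeries.C_injective) p
  haveI : ExpChar (LaurentSeries κ) p := ExpChar.prime hp.out
  intro n
  induction n with
  | zero => intro J b hJ; rw [Finset.card_eq_zero] at hJ; subst hJ; simp
  | succ n ih =>
    intro J b hJ hb hsum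
    have hne : J.Nonempty := Finset.card_pos.1 (by omega)
    obtain ⟨j0, hj0, hmin⟩ := Finset.exists_min_image J (fun j => (b j).order) hne
    have hb0 : ∀ j ∈ J, b j ≠ 0 := by
      intro j hj h0
      have := hb (Pi.single j 1) (by
        apply Finset.sum_eq_zero; intro i _
        by_cases h : i = j
        · subst h; rw [h0, mul_zero]
        · simp [Pi.single_eq_of_ne h]) j hj
      simp at this
    let o := (b j0).order
    have hlead : (b j0).coeff o ≠ 0 := HahnSeries.coeff_order_eq_zero.not.2 (hb0 _ hj0)
    let c : ι → κ := fun j => (b j).coeff o / (b j0).coeff o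
    let b' : ι → LaurentSeries κ := fun j => b j - HahnSeries.C (c j) * b j0
    have hc0 : c j0 = 1 := div_self hlead
    have hord : ∀ j ∈ J, ((o + 1 : ℤ) : WithTop ℤ) ≤ ow κ (b' j) := by
      intro j hj
      apply le_ow_of_coeff
      intro m hm
      simp only [b', HahnSeries.coeff_sub, HahnSeries.C_mul_eq_smul, HahnSeries.coeff_smul, smul_eq_mul]
      rcases (Int.lt_add_one_iff.1 hm).lt_or_eq with h | h
      · rw [HahnSeries.coeff_eq_zero_of_lt_order h, HahnSeries.coeff_eq_zero_of_lt_order (lt_of_lt_of_le h (hmin j hj))]; simp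
      · rw [h]; simp only [c]; field_simp; simp
    let u : MvPolynomial (Option (Fin d)) κ := ∑ j ∈ J, (c j ^ p ^ r) • s j
    have hu : u.totalDegree ≤ α := totalDegree_finsetSum_le fun i _ => (totalDegree_smul_le _ _).trans (hs i)
    have hevu : ev (V κ) Φ.ξ u = ∑ j ∈ J, ev (V κ) Φ.ξ (s j) * HahnSeries.C (c j) ^ p ^ r := by
      simp only [u, map_sum]
      apply Finset.sum_congr rfl; intro j _
      rw [← C_mul', map_mul]
      simp only [ev, algHom_C, algL, map_pow]; ring
    have hsum2 : ev (V κ) Φ.ξ u * b j0 ^ p ^ r + ∑ j ∈ J, ev (V κ) Φ.ξ (s j) * b' j ^ p ^ r = 0 := by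
      rw [← hsum, hevu, Finset.sum_mul, ← Finset.sum_add_distrib]
      apply Finset.sum_congr rfl; intro j _
      simp only [b']
      rw [sub_pow_expChar_pow]; ring
    have hb'0 : b' j0 = 0 := by simp [b', hc0]
    have hpp : p ^ r ≠ 0 := pow_ne_zero _ hp.out.ne_zero
    have hu0 : ev (V κ) Φ.ξ u = 0 := by
      by_contra hu0
      obtain ⟨θ, -, -, -, hle, -⟩ := Φ.norm u hu0
      have h1 : ow κ (ev (V κ) Φ.ξ u * b j0 ^ p ^ r) ≤ (((d.factorial - 1) * α + p ^ r * o : ℤ) : WithTop ℤ) := by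
        rw [AddValuation.map_mul, AddValuation.map_pow, HahnSeries.addVal_apply_of_ne (hb0 _ hj0), WithTop.coe_add]
        refine add_le_add (hle.trans (WithTop.coe_le_coe.2 ?_)) (le_of_eq ?_)
        · have : (1 : ℤ) ≤ d.factorial := by exact_mod_cast Nat.factorial_pos d
          have h3 : (u.totalDegree : ℤ) ≤ α := by exact_mod_cast hu
          nlinarith
        · rw [← WithTop.coe_nsmul]; simp [o]
      have h2 : ((-(α : ℤ) + p ^ r * (o + 1) : ℤ) : WithTop ℤ) ≤ ow κ (∑ j ∈ J, ev (V κ) Φ.ξ (s j) * b' j ^ p ^ r) := by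
        apply AddValuation.map_le_sum
        intro j hj
        rw [AddValuation.map_mul, AddValuation.map_pow, WithTop.coe_add]
        refine add_le_add (ow_ev _ Φ.ord _ (hs j)) ?_
        refine le_trans (le_of_eq ?_) (nsmul_le_nsmul_right (hord j hj) _)
        rw [← WithTop.coe_nsmul]; simp
      rw [eq_neg_of_add_eq_zero_left hsum2, AddValuation.map_neg] at h1
      have h3 := WithTop.coe_le_coe.1 (h2.trans h1)
      have h4 : (d.factorial * α : ℤ) < p ^ r := by exact_mod_cast hα
      nlinarith
    rw [hu0, zero_mul, zero_add, ← Finset.add_sum_erase _ _ hj0, hb'0, zero_pow hpp, mul_zero, zero_add] at hsum2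
    have hrest := ih (J.erase j0) b' (by rw [Finset.card_erase_of_mem hj0]; omega) (by
      intro e he j hj
      let e' : ι → κ := fun i => if i = j0 then -(∑ j ∈ J.erase j0, e j * c j) else e i
      have := hb e' (by
        rw [← Finset.add_sum_erase _ _ hj0]
        have e1 : ∑ j ∈ J.erase j0, HahnSeries.C (e' j) * b j = ∑ j ∈ J.erase j0, HahnSeries.C (e j) * b j := by
          apply Finset.sum_congr rfl; intro i hi; simp [e', (Finset.mem_erase.1 hi).1]
        rw [e1]
        have e2 : e' j0 = -(∑ j ∈ J.erase j0, e j * c j) := by simp [e']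
        rw [e2, ← he, map_neg, map_sum, neg_mul, Finset.sum_mul, neg_add_eq_sub, ← Finset.sum_sub_distrib]
        apply Finset.sum_congr rfl; intro i _
        simp only [b', map_mul]; ring) j (Finset.mem_of_mem_erase hj)
      simpa [e', (Finset.mem_erase.1 hj).1] using this) hsum2
    intro j hj
    by_cases hjj : j = j0
    · subst hjj
      rw [hevu, ← Finset.add_sum_erase _ _ hj, hc0, Finset.sum_eq_zero] at hu0
      · simpa using hu0
      · intro i hi; rw [hrest i hi, zero_mul]
    · exact hrest j (Finset.mem_erase.2 ⟨hjj, hj⟩)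

/-- S3 -/
lemma Frame.exists_basis : ∃ E : Finset (Fin d → Fin d), E.card = d.factorial ∧
    ∀ p : (Fin d → Fin d) → Polynomial κ,
      ∑ e ∈ E, Polynomial.aeval (V κ) (p e) * ∏ i, Φ.ξ i ^ (e i : ℕ) = 0 → ∀ e ∈ E, p e = 0 := by
  classical
  let vec : (Fin d → Fin d) → (Equiv.Perm (Fin d) → LaurentSeries κ) := fun e τ => ∏ i, Φ.ξ (τ i) ^ (e i : ℕ)
  have hspan : Submodule.span (LaurentSeries κ) (Set.range vec) = ⊤ := by
    by_contra hne
    obtain ⟨f, hf0, hf⟩ := Submodule.exists_le_ker_of_lt_top _ (lt_top_iff_ne_top.2 hne)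
    apply hf0
    have hfe : ∀ z, f z = ∑ τ, f (Pi.single τ 1) * z τ := by
      intro z
      conv_lhs => rw [pi_eq_sum_univ' z, map_sum]
      apply Finset.sum_congr rfl; intro τ _
      rw [map_smul, smul_eq_mul, mul_comm]
    have := interp Φ.ξ Φ.inj (fun τ => f (Pi.single τ 1)) (by
      intro e
      have h1 : vec e ∈ LinearMap.ker f := hf (Submodule.subset_span ⟨e, rfl⟩)
      rw [LinearMap.mem_ker, hfe] at h1
      exact h1)
    apply LinearMap.pi_ext'
    intro z
    apply LinearMap.ext_ring
    simpa using congrFun this z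
  obtain ⟨I, hI1, hI2, hI3⟩ := exists_linearIndependent (LaurentSeries κ) (Set.range vec)
  rw [hspan] at hI2
  have hIb : ∀ z ∈ I, ∃ e, vec e = z := fun z hz => hI1 hz
  haveI : Nonempty (Fin d → Fin d) := ⟨id⟩
  choose! ee hee using hIb
  have hIf : I.Finite := (Set.finite_range vec).subset hI1
  have hcard : hIf.toFinset.card = d.factorial := by
    haveI := hIf.fintype
    let bs := Module.Basis.mk hI3 (by rw [Subtype.range_coe]; exact hI2.ge)
    have h1 := Module.finrank_eq_card_basis bs
    rw [Module.finrank_fintype_fun_eq_card, Fintype.card_perm, Fintype.card_fin] at h1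
    rw [h1, ← Set.toFinset_card]
    congr 1; ext; simp
  have hinj : Set.InjOn ee (hIf.toFinset : Set _) := by
    intro a ha b hb hab
    rw [← hee a (by simpa using ha), ← hee b (by simpa using hb), hab]
  refine ⟨hIf.toFinset.image ee, by rw [Finset.card_image_of_injOn hinj, hcard], ?_⟩
  intro p hp
  rw [Finset.sum_image hinj] at hp
  -- the relation polynomial
  let h : MvPolynomial (Option (Fin d)) κ := ∑ z ∈ hIf.toFinset, Polynomial.aeval (X none) (p (ee z)) * ∏ i, X (some i) ^ (ee z i : ℕ)
  have hev : ∀ τ : Equiv.Perm (Fin d), ev (V κ) (Φ.ξ ∘ τ) h = ∑ z ∈ hIf.toFinset, Polynomial.aeval (V κ) (p (ee z)) * ∏ i, Φ.ξ (τ i) ^ (ee z i : ℕ) := by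
    intro τ
    simp only [h, map_sum, map_mul, map_prod, map_pow]
    apply Finset.sum_congr rfl; intro z _
    rw [← Polynomial.aeval_algHom_apply]
    simp [ev]
  have h0 := Φ.full h (by have := hev 1; simp only [Equiv.Perm.coe_one, Function.comp_id, id] at this; rw [this]; exact hp)
  haveI := hIf.fintype
  have hts : hIf.toFinset = I.toFinset := by ext; simp
  have hlin := Fintype.linearIndependent_iff.1 hI3 (fun z => Polynomial.aeval (V κ) (p (ee z))) (by
    funext τ
    have := h0 τ
    rw [hev, hts, ← Finset.sum_coe_sort] at this
    simp only [Finset.sum_apply, Pi.smul_apply, smul_eq_mul, Pi.zero_apply]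
    rw [← this]
    refine Fintype.sum_equiv (Equiv.subtypeEquivRight (by simp)) _ _ ?_
    intro z
    simp only [Equiv.subtypeEquivRight_apply_coe]
    congr 1
    exact (congrFun (hee z z.2) τ).symm)
  intro e he
  obtain ⟨z, hz, rfl⟩ := Finset.mem_image.1 he
  exact aeval_V_eq_zero (hlin ⟨z, by simpa using hz⟩)
end
end IncAux

namespace IncAux
section
variable {κ : Type} [Field κ] {d : ℕ}

lemma step_num (D m e : ℕ) (hD : 1 ≤ D) (hm : 2 * D * e + 3 * e + 8 ≤ m) :
    D * (m * (m / (2 * D) + e) + (m / D + 2 * e + 4 + e) + 1) <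
      ((m / (2 * D) + 1) * D) * ((m / D + 2 * e + 4 + 1) * D) ∧ D * (m / (2 * D) + e) < m := by
  have a1 := Nat.div_mul_le_self m (2 * D)
  have a2 := Nat.lt_div_mul_add (a := m) (b := 2 * D) (by omega)
  have b1 := Nat.div_mul_le_self m D
  have b2 := Nat.lt_div_mul_add (a := m) (b := D) (by omega)
  generalize m / (2 * D) = a at *
  generalize m / D = b at *
  constructor
  · have hbm : b ≤ m := by nlinarith
    have key : m * (a + e) + (b + 2 * e + 4 + e) + 1 < (a + 1) * ((b + 2 * e + 4 + 1) * D) := by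
      have h1 : (a + 1) * m ≤ (a + 1) * (b * D + D) := Nat.mul_le_mul_left _ b2.le
      have h2 : m * (e + 2) ≤ (a * (2 * D) + 2 * D) * (e + 2) := Nat.mul_le_mul_right _ a2.le
      nlinarith
    calc _ < D * ((a + 1) * ((b + 2 * e + 4 + 1) * D)) := Nat.mul_lt_mul_of_pos_left key (by omega)
      _ = _ := by ring
  · nlinarith

/-- monomials `v^a ξ^e`. -/
noncomputable def mono (κ : Type) [Field κ] {d : ℕ} (a : ℕ) (e : Fin d → Fin d) : MvPolynomial (Option (Fin d)) κ :=
  X none ^ a * ∏ i, X (some i) ^ (e i : ℕ)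

lemma ev_mono {A : Type} [CommRing A] [Algebra κ A] (v : A) (x : Fin d → A) (a : ℕ) (e : Fin d → Fin d) :
    ev v x (mono κ a e) = v ^ a * ∏ i, x i ^ (e i : ℕ) := by
  simp [mono, ev]

lemma mono_deg (a : ℕ) (e : Fin d → Fin d) : (mono κ a e).totalDegree ≤ a + d ^ 2 := by
  refine (totalDegree_mul _ _).trans (add_le_add (by simp) ?_)
  refine (totalDegree_finset_prod _ _).trans ?_
  refine (Finset.sum_le_card_nsmul _ _ d (fun i _ => ?_)).trans ?_
  · simp only [totalDegree_X_pow]; exact (e i).2.le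
  · simp [pow_two]

lemma mono_indep (Φ : Frame κ d) (E : Finset (Fin d → Fin d))
    (hE : ∀ p : (Fin d → Fin d) → Polynomial κ,
      ∑ e ∈ E, Polynomial.aeval (V κ) (p e) * ∏ i, Φ.ξ i ^ (e i : ℕ) = 0 → ∀ e ∈ E, p e = 0) (B : ℕ)
    (c : Fin B × E → κ) (hc : ∑ j, HahnSeries.C (c j) * ev (V κ) Φ.ξ (mono κ j.1 j.2) = 0) : c = 0 := by
  classical
  let p : (Fin d → Fin d) → Polynomial κ := fun e =>
    if h : e ∈ E then ∑ b : Fin B, Polynomial.C (c (b, ⟨e, h⟩)) * Polynomial.X ^ (b : ℕ) else 0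
  have hp := hE p (by
    rw [← hc, Fintype.sum_prod_type, Finset.sum_comm, ← Finset.sum_coe_sort]
    apply Finset.sum_congr rfl; intro e _
    simp only [p, e.2, dif_pos, ev_mono, map_sum, Finset.sum_mul, map_mul, Polynomial.aeval_C, map_pow, Polynomial.aeval_X, algL]
    apply Finset.sum_congr rfl; intro b _
    ring)
  funext ⟨b, e⟩
  have h1 := hp e e.2
  simp only [p, e.2, dif_pos] at h1
  have h2 := congrArg (fun r => Polynomial.coeff r b) h1
  simpa [Polynomial.finsetSum_coeff, Polynomial.coeff_C_mul, Polynomial.coeff_X_pow, Fin.val_inj] using h2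

theorem stepanov {k : Type} [Field k] [IsAlgClosed k] (p : ℕ) [hp : Fact p.Prime] [CharP k p]
    (Φ : Frame k d) (n : ℕ) (hn : 2 * d.factorial * d ^ 2 + 3 * d ^ 2 + 8 ≤ p ^ (n / 2)) (σ : Equiv.Perm (Fin d)) :
    let S : Set (k × (Fin d → k)) := {w | Function.Injective w.2 ∧ Spl Φ.g w.1 w.2 ∧ w.1 ^ (p ^ n) = w.1 ∧
      ∀ i, w.2 i ^ (p ^ n) = w.2 (σ i)}
    S.Finite ∧ S.ncard ≤ p ^ n + (1 + d.factorial * (4 * d ^ 2 + 4)) * p ^ (n - n / 2) := by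
  classical
  intro S
  haveI : ExpChar k p := ExpChar.prime hp.out
  set m := p ^ (n / 2) with hm
  set m' := p ^ (n - n / 2) with hm'
  have hmm : m' * m = p ^ n := by rw [hm, hm', ← pow_add]; congr 1; omega
  have hmle : m ≤ m' := Nat.pow_le_pow_right hp.out.pos (by omega)
  set D := d.factorial with hD
  have hD1 : 1 ≤ D := Nat.factorial_pos d
  obtain ⟨E, hEc, hE⟩ := Φ.exists_basis
  obtain ⟨num1, num2⟩ := step_num D m (d ^ 2) hD1 hn
  set a := m / (2 * D) with ha
  set b := m / D + 2 * d ^ 2 + 4 with hb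
  let ιa := Fin (a + 1) × E
  let ιb := Fin (b + 1) × E
  let pa : ιa → MvPolynomial (Option (Fin d)) k := fun i => mono k i.1 i.2
  let pb : ιb → MvPolynomial (Option (Fin d)) k := fun i => mono k i.1 i.2
  have hpa : ∀ i, (pa i).totalDegree ≤ a + d ^ 2 := fun i =>
    (mono_deg _ _).trans (by have := i.1.2; omega)
  have hpb : ∀ i, (pb i).totalDegree ≤ b + d ^ 2 := fun i =>
    (mono_deg _ _).trans (by have := i.1.2; omega)
  obtain ⟨c', hc'0, hc'⟩ := Φ.exists_rel (ι := ιa × ιb)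
    (fun ij => pa ij.1 ^ m * rename (Option.map σ) (pb ij.2)) (m * (a + d ^ 2) + (b + d ^ 2)) (by
      intro ij
      refine (totalDegree_mul _ _).trans (add_le_add ?_ ?_)
      · exact (totalDegree_pow _ _).trans (Nat.mul_le_mul_left _ (hpa _))
      · exact (totalDegree_rename_le _ _).trans (hpb _)) (by
      simp only [ιa, ιb, Fintype.card_prod, Fintype.card_fin, Fintype.card_coe, hEc]
      exact num1)
  have hroot : ∀ ij, ∃ z : k, z ^ m = c' ij := fun ij =>
    IsAlgClosed.exists_pow_nat_eq _ (pow_pos hp.out.pos _)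
  choose c hc using hroot
  let s : ιb → MvPolynomial (Option (Fin d)) k := fun j => ∑ i, c (i, j) • pa i
  have hs : ∀ j, (s j).totalDegree ≤ a + d ^ 2 := fun j =>
    totalDegree_finsetSum_le fun i _ => (totalDegree_smul_le _ _).trans (hpa i)
  let h : MvPolynomial (Option (Fin d)) k := ∑ j, s j * pb j ^ m'
  have hhd : h.totalDegree ≤ (a + d ^ 2) + m' * (b + d ^ 2) := by
    refine totalDegree_finsetSum_le fun j _ => ?_
    exact (totalDegree_mul _ _).trans (add_le_add (hs j)
      ((totalDegree_pow _ _).trans (Nat.mul_le_mul_left _ (hpb _))))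
  have hh0 : ev (V k) Φ.ξ h ≠ 0 := by
    intro h0
    have hall := Φ.frob_indep p (n - n / 2) (a + d ^ 2) (num2.trans_le hmle) s hs _ Finset.univ
      (fun j => ev (V k) Φ.ξ (pb j)) rfl (by
        intro e he j _
        exact congrFun (mono_indep Φ E hE _ e he) j) (by
        simp only [h, map_sum, map_mul, map_pow] at h0
        exact h0)
    apply hc'0
    funext ⟨i, j⟩
    have h1 := mono_indep Φ E hE (a + 1) (fun i => c (i, j)) (by
      have := hall j (Finset.mem_univ _)
      simp only [s, map_sum] at this
      rw [← this]
      apply Finset.sum_congr rfl; intro i _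
      rw [← C_mul', map_mul]
      simp only [ev, algHom_C, algL]; rfl)
    rw [← hc, congrFun h1 i]
    exact zero_pow (pow_ne_zero _ hp.out.ne_zero)
  have hcount := count_le Φ h hh0 S (by
    rintro ⟨v, x⟩ ⟨hx, hsp, hv, hxσ⟩
    refine ⟨hx, hsp, ?_⟩
    simp only at hx hsp hv hxσ
    have h1 := Φ.vanish _ hc' v x hx hsp
    have h2 : (ev v x h) ^ m = ev v x (∑ ij : ιa × ιb, c' ij • (pa ij.1 ^ m * rename (Option.map σ) (pb ij.2))) := by
      simp only [h, s, map_sum, map_mul, map_pow, ev_rn]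
      rw [hm, sum_pow_char_pow]
      refine Eq.trans ?_ (Fintype.sum_prod_type_right _).symm
      apply Finset.sum_congr rfl; intro j _
      rw [mul_pow, sum_pow_char_pow, Finset.sum_mul]
      apply Finset.sum_congr rfl; intro i _
      rw [← hc]
      simp only [map_smul, map_mul, map_pow, smul_eq_mul, ev_rn]
      have e1 : ev v (x ∘ σ) (pb j) = (ev v x (pb j)) ^ (m' * m) := by
        rw [hmm]
        simp only [pb, ev_mono, mul_pow, ← Finset.prod_pow]
        congr 1
        · rw [← pow_mul, mul_comm, pow_mul, hv]
        · apply Finset.prod_congr rfl; intro l _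
          rw [← pow_mul, mul_comm, pow_mul, hxσ]; rfl
      rw [e1]; ring
    rw [h1] at h2
    exact (pow_eq_zero_iff (pow_ne_zero _ hp.out.ne_zero)).1 h2)
  refine ⟨hcount.1, hcount.2.trans ((Nat.mul_le_mul_left _ hhd).trans ?_)⟩
  rw [← hmm]
  have a1 : a * (2 * D) ≤ m := Nat.div_mul_le_self m (2 * D)
  have b1 := Nat.div_mul_le_self m D
  have h1 : D * a ≤ m' := by nlinarith
  have h2 : m' * (m / D * D) ≤ m' * m := Nat.mul_le_mul_left _ b1
  have h3 : D * d ^ 2 ≤ m' * (D * d ^ 2) := Nat.le_mul_of_pos_left _ (by omega)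
  rw [← hD]
  generalize m / D = t at *
  rw [hb]
  nlinarith
end
end IncAux

namespace IncAux

section pl
variable {k A B : Type} [CommRing k] [CommRing A] [CommRing B] [Algebra k A] [Algebra k B] {d : ℕ}

/-- restriction of `Q` to the parametrized line `a + X b` -/
noncomputable def pl (Q : MvPolynomial (Fin 3) k) (a b : Fin 3 → A) : Polynomial A :=
  MvPolynomial.aeval (fun i => Polynomial.C (a i) + Polynomial.X * Polynomial.C (b i)) Q

lemma pl_eval (Q : MvPolynomial (Fin 3) k) (a b : Fin 3 → A) (x : A) :
    (pl Q a b).eval x = MvPolynomial.aeval (fun i => a i + x * b i) Q := by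
  induction Q using MvPolynomial.induction_on with
  | C r => simp [pl, Polynomial.algebraMap_apply]
  | add p q hp hq => simp only [pl, map_add, Polynomial.eval_add] at *; rw [hp, hq]
  | mul_X p i hp => simp only [pl, map_mul, Polynomial.eval_mul] at *; rw [hp]; simp; ring

lemma pl_map (Q : MvPolynomial (Fin 3) k) (a b : Fin 3 → A) (f : A →ₐ[k] B) :
    (pl Q a b).map (f : A →+* B) = pl Q (fun i => f (a i)) (fun i => f (b i)) := by
  induction Q using MvPolynomial.induction_on with
  | C r => simp [pl, Polynomial.algebraMap_apply]
  | add p q hp hq => simp only [pl, map_add, Polynomial.map_add] at *; rw [hp, hq]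
  | mul_X p i hp => simp only [pl, map_mul, Polynomial.map_mul] at *; rw [hp]; simp

lemma pl_derivative (Q : MvPolynomial (Fin 3) k) (a b : Fin 3 → A) :
    (pl Q a b).derivative = ∑ i, Polynomial.C (b i) * pl (pderiv i Q) a b := by
  induction Q using MvPolynomial.induction_on with
  | C r => simp [pl, Polynomial.algebraMap_apply]
  | add p q hp hq =>
    simp only [pl, map_add, mul_add, Finset.sum_add_distrib] at *; rw [hp, hq]
  | mul_X p i hp =>
    have : pl (p * X i) a b = pl p a b * (Polynomial.C (a i) + Polynomial.X * Polynomial.C (b i)) := by simp [pl]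
    rw [this, Polynomial.derivative_mul, hp, Finset.sum_mul]
    have h2 : ∀ j, pl (pderiv j (p * X i)) a b = pl (pderiv j p) a b * (Polynomial.C (a i) + Polynomial.X * Polynomial.C (b i))
        + pl p a b * (if i = j then 1 else 0) := by
      intro j
      rw [Derivation.leibniz, pderiv_X]
      simp only [pl, smul_eq_mul, map_add, map_mul, aeval_X, Pi.single_apply]
      by_cases h1 : i = j
      · subst h1; simp; ring
      · simp [h1]; ring
    have h4 : Polynomial.derivative (Polynomial.C (a i) + Polynomial.X * Polynomial.C (b i)) = Polynomial.C (b i) := by simp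
    have h5 : ∑ j, Polynomial.C (b j) * (pl p a b * (if i = j then 1 else 0)) = pl p a b * Polynomial.C (b i) := by
      rw [Finset.sum_eq_single i]
      · rw [if_pos rfl]; ring
      · intro j _ hj; rw [if_neg (fun h => hj h.symm)]; ring
      · intro h; exact absurd (Finset.mem_univ _) h
    rw [h4, ← h5, ← Finset.sum_add_distrib]
    refine Finset.sum_congr rfl (fun j _ => ?_)
    rw [h2]; ring

lemma pl_deg (Q : MvPolynomial (Fin 3) k) (hQ : Q.IsHomogeneous d) (a b : Fin 3 → A) :
    (pl Q a b).natDegree ≤ d ∧ (pl Q a b).coeff d = MvPolynomial.aeval b Q := by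
  have hlin : ∀ i, (Polynomial.C (a i) + Polynomial.X * Polynomial.C (b i)).natDegree ≤ 1 := by
    intro i
    have : (Polynomial.C (a i) + Polynomial.X * Polynomial.C (b i)) = Polynomial.C (b i) * Polynomial.X + Polynomial.C (a i) := by ring
    rw [this]; exact Polynomial.natDegree_linear_le
  have hc : ∀ i, (Polynomial.C (a i) + Polynomial.X * Polynomial.C (b i)).coeff 1 = b i := by
    intro i; simp [Polynomial.coeff_C]
  have hpow : ∀ i n, ((Polynomial.C (a i) + Polynomial.X * Polynomial.C (b i)) ^ n).natDegree ≤ n ∧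
      ((Polynomial.C (a i) + Polynomial.X * Polynomial.C (b i)) ^ n).coeff n = b i ^ n := by
    intro i n
    constructor
    · exact (Polynomial.natDegree_pow_le_of_le n (hlin i)).trans (by simp)
    · have := Polynomial.coeff_pow_of_natDegree_le (m := n) (hlin i)
      simpa [hc] using this
  have hmon : ∀ e : Fin 3 →₀ ℕ, (∑ i, e i) = d → ∀ c : k,
      (pl (monomial e c) a b).natDegree ≤ d ∧ (pl (monomial e c) a b).coeff d = MvPolynomial.aeval b (monomial e c) := by
    intro e he c
    have h1 : pl (monomial e c) a b = Polynomial.C (algebraMap k A c) * ∏ i, (Polynomial.C (a i) + Polynomial.X * Polynomial.C (b i)) ^ (e i) := by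
      rw [pl, aeval_monomial, Finsupp.prod_fintype _ _ (by simp)]; rfl
    have h2 : MvPolynomial.aeval b (monomial e c) = algebraMap k A c * ∏ i, b i ^ e i := by
      rw [aeval_monomial, Finsupp.prod_fintype _ _ (by simp)]
    rw [h1, h2]
    rw [Fin.sum_univ_three] at he
    simp only [Fin.prod_univ_three]
    constructor
    · refine (Polynomial.natDegree_C_mul_le _ _).trans ?_
      rw [← he]
      exact Polynomial.natDegree_mul_le_of_le (Polynomial.natDegree_mul_le_of_le (hpow _ _).1 (hpow _ _).1) (hpow _ _).1
    · rw [Polynomial.coeff_C_mul, ← he,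
        Polynomial.coeff_mul_add_eq_of_natDegree_le (Polynomial.natDegree_mul_le_of_le (hpow _ _).1 (hpow _ _).1) (hpow _ _).1,
        Polynomial.coeff_mul_add_eq_of_natDegree_le (hpow _ _).1 (hpow _ _).1, (hpow _ _).2, (hpow _ _).2, (hpow _ _).2]
  have hsum : pl Q a b = ∑ e ∈ Q.support, pl (monomial e (coeff e Q)) a b := by
    conv_lhs => rw [Q.as_sum]
    simp only [pl, map_sum]
  have hdeg : ∀ e ∈ Q.support, ∑ i, e i = d := by
    intro e he
    have := hQ (mem_support_iff.1 he)
    rw [← this, Finsupp.weight_apply, Finsupp.sum_fintype _ _ (by simp)]; simp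
  constructor
  · rw [hsum]
    exact Polynomial.natDegree_sum_le_of_forall_le _ _ (fun e he => (hmon e (hdeg e he) _).1)
  · rw [hsum, Polynomial.finset_sum_coeff]
    conv_rhs => rw [Q.as_sum, map_sum]
    exact Finset.sum_congr rfl (fun e he => (hmon e (hdeg e he) _).2)

lemma hom_scale (Q : MvPolynomial (Fin 3) k) (hQ : Q.IsHomogeneous d) (c : A) (x : Fin 3 → A) :
    MvPolynomial.aeval (fun i => c * x i) Q = c ^ d * MvPolynomial.aeval x Q := by
  conv_lhs => rw [Q.as_sum]
  conv_rhs => rw [Q.as_sum]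
  simp only [map_sum, Finset.mul_sum]
  refine Finset.sum_congr rfl (fun e he => ?_)
  have : ∑ i, e i = d := by
    have := hQ (mem_support_iff.1 he)
    rw [← this, Finsupp.weight_apply, Finsupp.sum_fintype _ _ (by simp)]; simp
  rw [aeval_monomial, aeval_monomial, Finsupp.prod_fintype _ _ (by simp), Finsupp.prod_fintype _ _ (by simp)]
  simp only [mul_pow, Finset.prod_mul_distrib, Finset.prod_pow_eq_pow_sum, this]
  ring

lemma aeval_map_alg (Q : MvPolynomial (Fin 3) k) (f : A →ₐ[k] B) (x : Fin 3 → A) :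
    f (MvPolynomial.aeval x Q) = MvPolynomial.aeval (fun i => f (x i)) Q := by
  have := MvPolynomial.comp_aeval_apply f (f := x) (p := Q)
  simpa using this
end pl
end IncAux

namespace IncAux

lemma perm_all {G α : Type} [Group G] [Finite α] [DecidableEq α] [MulAction G α]
    (ha : ∀ x y : α, ∃ g : G, g • x = y)
    (a : α) (hb : ∀ x y : α, x ≠ a → y ≠ a → ∃ g : G, g • a = a ∧ g • x = y)
    (g0 : G) (x0 y0 : α) (hne : x0 ≠ y0) (hc : ∀ x, g0 • x = Equiv.swap x0 y0 x) (τ : Equiv.Perm α) :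
    ∃ g : G, ∀ x, g • x = τ x := by
  let H := (MulAction.toPermHom G α).range
  have hmem : ∀ g : G, MulAction.toPermHom G α g ∈ H := fun g => ⟨g, rfl⟩
  have h2 : MulAction.IsMultiplyPretransitive H α 2 := by
    rw [MulAction.is_two_pretransitive_iff]
    intro x y z w hxy hzw
    obtain ⟨g1, h1⟩ := ha x a
    obtain ⟨g2, h2⟩ := ha z a
    have hy : g1 • y ≠ a := fun h => hxy (by rw [← h1] at h; exact (MulAction.injective g1 h).symm)
    have hw : g2 • w ≠ a := fun h => hzw (by rw [← h2] at h; exact (MulAction.injective g2 h).symm)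
    obtain ⟨g3, h3, h4⟩ := hb _ _ hy hw
    refine ⟨⟨_, hmem (g2⁻¹ * g3 * g1)⟩, ?_, ?_⟩
    · change (g2⁻¹ * g3 * g1) • x = z
      rw [mul_smul, mul_smul, h1, h3, ← h2, inv_smul_smul]
    · change (g2⁻¹ * g3 * g1) • y = w
      rw [mul_smul, mul_smul, h4, inv_smul_smul]
  have hp := MulAction.isPreprimitive_of_is_two_pretransitive h2
  have ht := Equiv.Perm.subgroup_eq_top_of_isPreprimitive_of_isSwap_mem hp (Equiv.swap x0 y0)
    ⟨x0, y0, hne, rfl⟩ ⟨g0, Equiv.ext hc⟩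
  obtain ⟨g, hg⟩ : τ ∈ H := by rw [ht]; trivial
  exact ⟨g, fun x => by rw [← hg]; rfl⟩

lemma pl_monic {k A : Type} [CommRing k] [CommRing A] [Nontrivial A] [Algebra k A] {d : ℕ}
    (Q : MvPolynomial (Fin 3) k) (hQ : Q.IsHomogeneous d) (a b : Fin 3 → A)
    (h1 : MvPolynomial.aeval b Q = 1) : (pl Q a b).Monic ∧ (pl Q a b).natDegree = d := by
  obtain ⟨h2, h3⟩ := pl_deg Q hQ a b
  rw [h1] at h3
  have hd : (pl Q a b).natDegree = d := le_antisymm h2 (Polynomial.le_natDegree_of_ne_zero (by rw [h3]; exact one_ne_zero))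
  refine ⟨?_, hd⟩
  rw [Polynomial.Monic, Polynomial.leadingCoeff, hd, h3]

/-- `Q(1,X,Y)` as a polynomial in `Y` over `N[X]` -/
noncomputable def f2 (N : Type) {k : Type} [CommRing k] [CommRing N] [Algebra k N] (Q : MvPolynomial (Fin 3) k) :
    Polynomial (Polynomial N) :=
  pl Q ![1, Polynomial.X, 0] ![0, 0, 1]

lemma aeval_001 {k N : Type} [CommRing k] [CommRing N] [Algebra k N] (Q : MvPolynomial (Fin 3) k)
    (h1 : eval ![0, 0, 1] Q = 1) : MvPolynomial.aeval (![0, 0, 1] : Fin 3 → N) Q = 1 := by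
  have := aeval_map_alg Q (Algebra.ofId k N) ![0,0,1]
  have h2 : MvPolynomial.aeval (![0,0,1] : Fin 3 → k) Q = 1 := by
    refine Eq.trans ?_ h1; rw [← MvPolynomial.coe_aeval_eq_eval]; rfl
  rw [h2] at this
  have e : (fun i => (Algebra.ofId k N) ((![0,0,1] : Fin 3 → k) i)) = (![0,0,1] : Fin 3 → N) := by
    funext i; fin_cases i <;> simp
  rw [e] at this
  rw [← this, map_one]

lemma pl_eval2 {k A B : Type} [CommRing k] [CommRing A] [CommRing B] [Algebra k A] [Algebra k B]
    (Q : MvPolynomial (Fin 3) k) (a b : Fin 3 → A) (f : A →ₐ[k] B) (y : B) :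
    (pl Q a b).eval₂ (f : A →+* B) y = MvPolynomial.aeval (fun i => f (a i) + y * f (b i)) Q := by
  rw [Polynomial.eval₂_eq_eval_map, pl_map, pl_eval]

lemma f2_eval2 {k A B : Type} [CommRing k] [CommRing A] [CommRing B] [Algebra k A] [Algebra k B]
    (Q : MvPolynomial (Fin 3) k) (f : Polynomial A →ₐ[k] B) (y : B) :
    (f2 A Q).eval₂ (f : Polynomial A →+* B) y = MvPolynomial.aeval ![1, f Polynomial.X, y] Q := by
  rw [f2, pl_eval2]
  congr 2
  funext i; fin_cases i <;> simp

lemma f2_map {k A B : Type} [CommRing k] [CommRing A] [CommRing B] [Algebra k A] [Algebra k B]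
    (Q : MvPolynomial (Fin 3) k) (f : A →ₐ[k] B) :
    (f2 A Q).map (Polynomial.mapRingHom (f : A →+* B)) = f2 B Q := by
  have := pl_map Q ![1, Polynomial.X, 0] ![0, 0, 1] (Polynomial.mapAlgHom f)
  rw [f2, f2]
  refine Eq.trans this ?_
  congr 1
  · funext i; fin_cases i <;> simp
  · funext i; fin_cases i <;> simp

lemma homogenize_exists {k : Type} [Field k] (g : Polynomial (Polynomial k)) :
    ∃ M0 : ℕ, ∀ M ≥ M0, ∃ G : MvPolynomial (Fin 3) k,
      MvPolynomial.aeval (![1, Polynomial.C Polynomial.X, Polynomial.X] : Fin 3 → Polynomial (Polynomial k)) G = g ∧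
      ∀ (L : Type) [Field L] [Algebra k L] (z : Fin 3 → L), z 0 ≠ 0 →
        MvPolynomial.aeval z G = z 0 ^ M * g.eval₂ (Polynomial.aeval (z 1 / z 0) : Polynomial k →ₐ[k] L).toRingHom (z 2 / z 0) := by
  induction g using Polynomial.induction_on' with
  | add p q hp hq =>
    obtain ⟨M1, h1⟩ := hp
    obtain ⟨M2, h2⟩ := hq
    refine ⟨max M1 M2, fun M hM => ?_⟩
    obtain ⟨G1, h1, h1'⟩ := h1 M (le_trans (le_max_left _ _) hM)
    obtain ⟨G2, h2, h2'⟩ := h2 M (le_trans (le_max_right _ _) hM)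
    refine ⟨G1 + G2, by rw [map_add, h1, h2], fun L _ _ z hz => ?_⟩
    rw [map_add, h1' L z hz, h2' L z hz, Polynomial.eval₂_add, mul_add]
  | monomial j p =>
    induction p using Polynomial.induction_on' with
    | add p q hp hq =>
      obtain ⟨M1, h1⟩ := hp
      obtain ⟨M2, h2⟩ := hq
      refine ⟨max M1 M2, fun M hM => ?_⟩
      obtain ⟨G1, h1, h1'⟩ := h1 M (le_trans (le_max_left _ _) hM)
      obtain ⟨G2, h2, h2'⟩ := h2 M (le_trans (le_max_right _ _) hM)
      refine ⟨G1 + G2, by rw [map_add, h1, h2, map_add], fun L _ _ z hz => ?_⟩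
      rw [map_add, h1' L z hz, h2' L z hz, map_add, Polynomial.eval₂_add, mul_add]
    | monomial i a =>
      refine ⟨i + j, fun M hM => ⟨C a * X 0 ^ (M - i - j) * X 1 ^ i * X 2 ^ j, ?_, fun L _ _ z hz => ?_⟩⟩
      · simp only [map_mul, map_pow, aeval_X, MvPolynomial.algHom_C]
        rw [← Polynomial.C_mul_X_pow_eq_monomial, ← Polynomial.C_mul_X_pow_eq_monomial]
        simp [Polynomial.algebraMap_apply]
      · obtain ⟨m, rfl⟩ := Nat.exists_eq_add_of_le hM
        rw [Polynomial.eval₂_monomial]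
        simp only [map_mul, map_pow, aeval_X, MvPolynomial.algHom_C]
        have : (Polynomial.aeval (z 1 / z 0) : Polynomial k →ₐ[k] L).toRingHom (Polynomial.monomial i a) = algebraMap k L a * (z 1 / z 0) ^ i := by
          change Polynomial.aeval (z 1 / z 0) (Polynomial.monomial i a) = _
          rw [Polynomial.aeval_monomial]
        rw [this]
        have h3 : i + j + m - i - j = m := by omega
        rw [h3, div_pow, div_pow, pow_add, pow_add]
        field_simp

lemma exists_algHom_algClosed {k : Type} [Field k] [IsAlgClosed k] (R : Type) [CommRing R] [Nontrivial R] [Algebra k R]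
    [Algebra.FiniteType k R] : Nonempty (R →ₐ[k] k) := by
  obtain ⟨m, hmax⟩ := Ideal.exists_maximal R
  let _ : Field (R ⧸ m) := Ideal.Quotient.field m
  haveI : Algebra.FiniteType k (R ⧸ m) := Algebra.FiniteType.of_surjective (Ideal.Quotient.mkₐ k m) Ideal.Quotient.mk_surjective
  haveI := finite_of_finite_type_of_isJacobsonRing k (R ⧸ m)
  exact ⟨(IsAlgClosed.lift (R := k) (S := R ⧸ m) (M := k)).comp (Ideal.Quotient.mkₐ k m)⟩

section
variable {k : Type} [Field k] {d : ℕ} (Q : MvPolynomial (Fin 3) k) (hd : 2 ≤ d) (hQ : Q.IsHomogeneous d)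
  (h1 : eval ![0, 0, 1] Q = 1) (hirr : Irreducible Q)
include hd hQ h1 hirr

lemma f2_monic (N : Type) [Field N] [Algebra k N] : (f2 N Q).Monic ∧ (f2 N Q).natDegree = d :=
  pl_monic Q hQ _ _ (aeval_001 Q h1)

lemma exists_generic : ∃ (M : Type) (_ : Field M) (_ : Algebra k M) (x y : M),
    MvPolynomial.aeval ![1, x, y] Q = 0 ∧
    ∀ g : Polynomial (Polynomial k), g.eval₂ (Polynomial.aeval x : Polynomial k →ₐ[k] M).toRingHom y = 0 → f2 k Q ∣ g := by
  have hpr : (Ideal.span {Q}).IsPrime := (Ideal.span_singleton_prime hirr.ne_zero).2 hirr.prime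
  let A := MvPolynomial (Fin 3) k ⧸ Ideal.span {Q}
  let M := FractionRing A
  let φ : MvPolynomial (Fin 3) k →ₐ[k] M := (IsScalarTower.toAlgHom k A M).comp (Ideal.Quotient.mkₐ k (Ideal.span {Q}))
  have hφ : ∀ G, φ G = 0 ↔ Q ∣ G := by
    intro G
    change algebraMap A M (Ideal.Quotient.mk _ G) = 0 ↔ _
    rw [FaithfulSMul.algebraMap_eq_zero_iff A M, Ideal.Quotient.eq_zero_iff_mem, Ideal.mem_span_singleton]
  let z : Fin 3 → M := fun i => φ (X i)
  have hz : ∀ G, MvPolynomial.aeval z G = φ G := by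
    intro G; rw [MvPolynomial.aeval_unique φ]; rfl
  have hdeg : (f2 k Q).Monic ∧ (f2 k Q).natDegree = d := pl_monic Q hQ _ _ (aeval_001 Q h1)
  have hdeq : MvPolynomial.aeval (![1, Polynomial.C Polynomial.X, Polynomial.X] : Fin 3 → Polynomial (Polynomial k)) Q = f2 k Q := by
    rw [f2, pl]
    congr 2
    funext i; fin_cases i <;> simp
  have hz0 : z 0 ≠ 0 := by
    intro h
    obtain ⟨G, hG⟩ := (hφ _).1 h
    have h3 := congrArg (MvPolynomial.aeval (![1, Polynomial.C Polynomial.X, Polynomial.X] : Fin 3 → Polynomial (Polynomial k))) hG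
    rw [map_mul, hdeq, aeval_X] at h3
    have : IsUnit (f2 k Q) := IsUnit.of_mul_eq_one _ h3.symm
    have := (hdeg.1.isUnit_iff).1 this
    rw [this] at hdeg
    simp at hdeg
    omega
  refine ⟨M, inferInstance, inferInstance, z 1 / z 0, z 2 / z 0, ?_, ?_⟩
  · have h4 := hom_scale Q hQ (z 0) ![1, z 1 / z 0, z 2 / z 0]
    have h5 : (fun i => z 0 * (![1, z 1 / z 0, z 2 / z 0] : Fin 3 → M) i) = z := by
      funext i; fin_cases i
      · simp
      · exact mul_div_cancel₀ _ hz0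
      · exact mul_div_cancel₀ _ hz0
    rw [h5, hz, (hφ Q).2 dvd_rfl] at h4
    exact (mul_eq_zero.1 h4.symm).resolve_left (pow_ne_zero _ hz0)
  · intro g hg
    obtain ⟨M0, hM⟩ := homogenize_exists g
    obtain ⟨G, hG, hG2⟩ := hM M0 le_rfl
    have h6 := hG2 M z hz0
    rw [hg, mul_zero, hz, hφ] at h6
    rw [← hG, ← hdeq]
    exact map_dvd _ h6

lemma f2_irred_k : Irreducible (f2 k Q) := by
  obtain ⟨hm, hdd⟩ := f2_monic Q hd hQ h1 hirr k
  rw [hm.irreducible_iff_natDegree]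
  refine ⟨fun h => by rw [h] at hdd; simp at hdd; omega, fun f g hf hg hfg => ?_⟩
  obtain ⟨M, _, _, x, y, hxy, hdv⟩ := exists_generic Q hd hQ h1 hirr
  have h0 : (f2 k Q).eval₂ (Polynomial.aeval x : Polynomial k →ₐ[k] M).toRingHom y = 0 := by
    have := f2_eval2 Q (Polynomial.aeval x : Polynomial k →ₐ[k] M) y
    rw [Polynomial.aeval_X, hxy] at this
    exact this
  rw [← hfg, Polynomial.eval₂_mul] at h0
  have hadd : f.natDegree + g.natDegree = d := by rw [← hf.natDegree_mul hg, hfg, hdd]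
  rcases mul_eq_zero.1 h0 with h | h
  · have := Polynomial.natDegree_le_of_dvd (hdv f h) hf.ne_zero
    right; omega
  · have := Polynomial.natDegree_le_of_dvd (hdv g h) hg.ne_zero
    left; omega

lemma f2_irred [IsAlgClosed k] (N : Type) [Field N] [Algebra k N] : Irreducible (f2 N Q) := by
  classical
  obtain ⟨hm, hdd⟩ := f2_monic Q hd hQ h1 hirr N
  obtain ⟨hmk, hdk⟩ := f2_monic Q hd hQ h1 hirr k
  rw [hm.irreducible_iff_natDegree]
  refine ⟨fun h => by rw [h] at hdd; simp at hdd; omega, fun f g hf hg hfg => ?_⟩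
  let cf : Polynomial (Polynomial N) → Finset N := fun f => f.support.biUnion (fun i => (f.coeff i).support.image (fun j => (f.coeff i).coeff j))
  let S : Finset N := cf f ∪ cf g
  let R0 := Algebra.adjoin k (S : Set N)
  have hmemcf : ∀ f : Polynomial (Polynomial N), ∀ i j, (f.coeff i).coeff j = 0 ∨ (f.coeff i).coeff j ∈ cf f := by
    intro f i j
    by_cases h : (f.coeff i).coeff j = 0
    · exact Or.inl h
    · right
      simp only [cf, Finset.mem_biUnion, Finset.mem_image, Polynomial.mem_support_iff]
      exact ⟨i, fun h' => h (by rw [h']; simp), j, h, rfl⟩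
  have hmem : ∀ f : Polynomial (Polynomial N), cf f ⊆ S → ∀ i j, (f.coeff i).coeff j ∈ R0 := by
    intro f hf i j
    rcases hmemcf f i j with h | h
    · rw [h]; exact zero_mem _
    · exact Algebra.subset_adjoin (hf h)
  let v : Polynomial R0 →+* Polynomial N := Polynomial.mapRingHom (R0.val : R0 →+* N)
  have hlift : ∀ f : Polynomial (Polynomial N), cf f ⊆ S → f ∈ Polynomial.lifts v := by
    intro f hf
    rw [Polynomial.lifts_iff_coeff_lifts]
    intro i
    have : f.coeff i ∈ Polynomial.lifts (R0.val : R0 →+* N) := by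
      rw [Polynomial.lifts_iff_coeff_lifts]
      intro j
      exact ⟨⟨_, hmem f hf i j⟩, rfl⟩
    obtain ⟨r, hr⟩ := (Polynomial.mem_lifts _).1 this
    exact ⟨r, hr⟩
  obtain ⟨f', hf', hfd, hfm⟩ := Polynomial.lifts_and_natDegree_eq_and_monic (hlift f Finset.subset_union_left) hf
  obtain ⟨g', hg', hgd, hgm⟩ := Polynomial.lifts_and_natDegree_eq_and_monic (hlift g Finset.subset_union_right) hg
  have hvi : Function.Injective v := Polynomial.map_injective _ Subtype.val_injective
  have hfg' : f' * g' = f2 R0 Q := by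
    apply Polynomial.map_injective v hvi
    rw [Polynomial.map_mul, hf', hg', hfg]
    exact (f2_map Q R0.val).symm
  haveI : Algebra.FiniteType k R0 := (Subalgebra.fg_iff_finiteType R0).1 ⟨S, rfl⟩
  obtain ⟨ψ⟩ := exists_algHom_algClosed (k := k) R0
  have hk := f2_map Q ψ
  rw [← hfg', Polynomial.map_mul] at hk
  have hir := f2_irred_k Q hd hQ h1 hirr
  rw [hmk.irreducible_iff_natDegree] at hir
  have := hir.2 _ _ (hfm.map _) (hgm.map _) hk
  rw [hfm.natDegree_map, hgm.natDegree_map, hfd, hgd] at this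
  exact this
end
end IncAux

namespace IncAux

lemma trans_of_not_mem {k N : Type} [Field k] [IsAlgClosed k] [Field N] [Algebra k N] (w : N)
    (hw : ∀ a : k, w ≠ algebraMap k N a) : Transcendental k w := by
  intro h
  have hi := h.isIntegral
  have h1 := IsAlgClosed.degree_eq_one_of_irreducible k (minpoly.irreducible hi)
  obtain ⟨a, ha⟩ := (minpoly.mem_range_of_degree_eq_one k w h1)
  exact hw a ha.symm

lemma algind {k N A : Type} [Field k] [IsAlgClosed k] [Field N] [Algebra k N] [Field A] [Algebra k A] [Algebra N A]
    [IsScalarTower k N A] (x0 y0 : N) (hxy : ¬ ∃ a b : k, x0 = algebraMap k N a ∧ y0 = algebraMap k N b)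
    (t : A) (ht : Transcendental N t) :
    Function.Injective (MvPolynomial.aeval (R := k) ![algebraMap N A y0 - t * algebraMap N A x0, t]) := by
  classical
  rw [injective_iff_map_eq_zero]
  intro H hH
  let h : Polynomial N := MvPolynomial.aeval (![Polynomial.C y0 - Polynomial.X * Polynomial.C x0, Polynomial.X] : Fin 2 → Polynomial N) H
  have h0 : h = 0 := by
    apply transcendental_iff.1 ht
    rw [← hH]
    have := MvPolynomial.comp_aeval_apply ((Polynomial.aeval t : Polynomial N →ₐ[N] A).restrictScalars k)
      (f := (![Polynomial.C y0 - Polynomial.X * Polynomial.C x0, Polynomial.X] : Fin 2 → Polynomial N)) (p := H)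
    refine Eq.trans this ?_
    congr 2
    funext i; fin_cases i <;> simp <;> ring
  have hz : ∀ z : k, MvPolynomial.aeval (![y0 - algebraMap k N z * x0, algebraMap k N z] : Fin 2 → N) H = 0 := by
    intro z
    have := MvPolynomial.comp_aeval_apply ((Polynomial.aeval (algebraMap k N z) : Polynomial N →ₐ[N] N).restrictScalars k)
      (f := (![Polynomial.C y0 - Polynomial.X * Polynomial.C x0, Polynomial.X] : Fin 2 → Polynomial N)) (p := H)
    change _ = _ at this
    have h2 : ((Polynomial.aeval (algebraMap k N z) : Polynomial N →ₐ[N] N).restrictScalars k) h = 0 := by rw [h0, map_zero]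
    rw [← h2]
    refine Eq.trans ?_ this.symm
    congr 2
    funext i; fin_cases i <;> simp <;> ring
  have hs : ∀ z : k, (∀ a : k, y0 - algebraMap k N z * x0 ≠ algebraMap k N a) → ∀ s : k, MvPolynomial.eval ![s, z] H = 0 := by
    intro z hza s
    have htr := trans_of_not_mem _ hza
    let h' : Polynomial k := MvPolynomial.aeval (![Polynomial.X, Polynomial.C z] : Fin 2 → Polynomial k) H
    have h'0 : h' = 0 := by
      apply transcendental_iff.1 htr
      rw [← hz z]
      have := MvPolynomial.comp_aeval_apply (Polynomial.aeval (y0 - algebraMap k N z * x0) : Polynomial k →ₐ[k] N)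
        (f := (![Polynomial.X, Polynomial.C z] : Fin 2 → Polynomial k)) (p := H)
      refine Eq.trans this ?_
      congr 2
      funext i; fin_cases i <;> simp
    have := MvPolynomial.comp_aeval_apply (Polynomial.aeval s : Polynomial k →ₐ[k] k)
        (f := (![Polynomial.X, Polynomial.C z] : Fin 2 → Polynomial k)) (p := H)
    change Polynomial.aeval s h' = _ at this
    rw [h'0, map_zero] at this
    rw [← MvPolynomial.coe_aeval_eq_eval]
    refine Eq.trans ?_ this.symm
    change MvPolynomial.aeval _ H = _
    congr 2
    funext i; fin_cases i <;> simp
  haveI : Infinite k := IsAlgClosed.instInfinite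
  have hex : ∃ z0 : k, ∀ z, z ≠ z0 → ∀ a : k, y0 - algebraMap k N z * x0 ≠ algebraMap k N a := by
    by_contra hcon
    push Not at hcon
    obtain ⟨z1, -, a1, h1⟩ := hcon 0
    obtain ⟨z2, h12, a2, h2⟩ := hcon z1
    have hzz : algebraMap k N z2 - algebraMap k N z1 ≠ 0 := by
      rw [sub_ne_zero]; exact fun h => h12 ((algebraMap k N).injective h)
    have hx : x0 = algebraMap k N ((a1 - a2) / (z2 - z1)) := by
      rw [map_div₀, map_sub, map_sub, eq_div_iff hzz, ← h1, ← h2]; ring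
    refine hxy ⟨_, a1 + z1 * ((a1 - a2) / (z2 - z1)), hx, ?_⟩
    rw [map_add, map_mul, ← hx, ← h1]; ring
  obtain ⟨z0, hz0⟩ := hex
  have hinf : ∀ i : Fin 2, (![Set.univ, {z0}ᶜ] i : Set k).Infinite := by
    intro i; fin_cases i
    · exact Set.infinite_univ
    · exact (Set.finite_singleton z0).infinite_compl
  refine MvPolynomial.funext_set _ hinf (fun x hx => ?_)
  rw [map_zero]
  have h1 : x 1 ≠ z0 := by
    have := hx 1 (Set.mem_univ _); simpa using this
  have := hs (x 1) (hz0 _ h1) (x 0)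
  have e : x = ![x 0, x 1] := by funext i; fin_cases i <;> rfl
  rw [e]; exact this

lemma transfer {E0 E L : Type} [Field E0] [Field E] [Field L] [Algebra E0 L] [Normal E0 L] (j : E0 →+* E) :
    ∃ ι : L →+* AlgebraicClosure E, (∀ x : E0, ι (algebraMap E0 L x) = algebraMap E _ (j x)) ∧
      ∀ ϕ : AlgebraicClosure E ≃ₐ[E] AlgebraicClosure E, ∃ g : L ≃ₐ[E0] L, ∀ x, ι (g x) = ϕ (ι x) := by
  let _ : Algebra E0 (AlgebraicClosure E) := ((algebraMap E (AlgebraicClosure E)).comp j).toAlgebra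
  let ι : L →ₐ[E0] AlgebraicClosure E := IsAlgClosed.lift
  refine ⟨ι, fun x => ι.commutes x, fun ϕ => ?_⟩
  let ϕ' : AlgebraicClosure E ≃ₐ[E0] AlgebraicClosure E :=
    AlgEquiv.ofRingEquiv (f := (ϕ : AlgebraicClosure E ≃+* AlgebraicClosure E)) (fun x => ϕ.commutes (j x))
  let _ : Algebra L (AlgebraicClosure E) := ι.toRingHom.toAlgebra
  haveI : IsScalarTower E0 L (AlgebraicClosure E) := IsScalarTower.of_algebraMap_eq (fun x => (ι.commutes x).symm)
  refine ⟨ϕ'.restrictNormal L, fun x => ?_⟩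
  exact ϕ'.restrictNormal_commutes L x

lemma conj_roots {k : Type} [Field k] [IsAlgClosed k] {d : ℕ} (Q : MvPolynomial (Fin 3) k) (hd : 2 ≤ d) (hQ : Q.IsHomogeneous d)
    (h1 : eval ![0, 0, 1] Q = 1) (hirr : Irreducible Q) {N Ω : Type} [Field N] [Algebra k N] [Field Ω]
    [Algebra k Ω] [Algebra N Ω] [Algebra (FractionRing (Polynomial N)) Ω] [IsScalarTower k N Ω]
    [IsScalarTower N (FractionRing (Polynomial N)) Ω] (x0 y0 : N) (t : Ω)
    (ht : t = algebraMap (FractionRing (Polynomial N)) Ω (algebraMap (Polynomial N) _ Polynomial.X))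
    (b b' : Ω) (hb : MvPolynomial.aeval ![1, b, algebraMap N Ω y0 + t * (b - algebraMap N Ω x0)] Q = 0)
    (hbx : b ≠ algebraMap N Ω x0)
    (hb' : MvPolynomial.aeval ![1, b', algebraMap N Ω y0 + t * (b' - algebraMap N Ω x0)] Q = 0)
    (hbx' : b' ≠ algebraMap N Ω x0) (m : Polynomial (FractionRing (Polynomial N))) (hm : Polynomial.aeval b m = 0) :
    Polynomial.aeval b' m = 0 := by
  set E := FractionRing (Polynomial N) with hE
  have htr : Transcendental N t := by
    rw [transcendental_iff]
    intro p hp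
    have : Polynomial.aeval t p = algebraMap E Ω (algebraMap (Polynomial N) E p) := by
      have h2 : algebraMap (Polynomial N) E p = Polynomial.aeval (algebraMap (Polynomial N) E Polynomial.X) p := by
        rw [Polynomial.aeval_algebraMap_apply, Polynomial.aeval_X_left_apply]
      rw [h2, ht, Polynomial.aeval_algebraMap_apply]
    rw [this, map_eq_zero_iff _ (algebraMap E Ω).injective] at hp
    exact (map_eq_zero_iff _ (IsFractionRing.injective (Polynomial N) E)).1 hp
  obtain ⟨hm2, hd2⟩ := f2_monic Q hd hQ h1 hirr N
  have hir : Irreducible ((f2 N Q).map (algebraMap (Polynomial N) E)) :=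
    (hm2.irreducible_iff_irreducible_map_fraction_map).1 (f2_irred Q hd hQ h1 hirr N)
  haveI : Fact (Irreducible ((f2 N Q).map (algebraMap (Polynomial N) E))) := ⟨hir⟩
  let M := AdjoinRoot ((f2 N Q).map (algebraMap (Polynomial N) E))
  have key : ∀ b : Ω, MvPolynomial.aeval ![1, b, algebraMap N Ω y0 + t * (b - algebraMap N Ω x0)] Q = 0 →
      b ≠ algebraMap N Ω x0 → ∃ ψ : M →+* Ω, (∀ x : N, ψ (AdjoinRoot.of _ (algebraMap (Polynomial N) E (Polynomial.C x))) = algebraMap N Ω x) ∧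
        ψ (AdjoinRoot.of _ (algebraMap (Polynomial N) E Polynomial.X)) = b ∧
        ψ (AdjoinRoot.root _) = algebraMap N Ω y0 + t * (b - algebraMap N Ω x0) := by
    intro b hb hbx
    have hbx0 := sub_ne_zero.2 hbx
    have hbt : Transcendental N b := by
      intro hba
      let S := algebraicClosure N Ω
      have hbS : b ∈ S := mem_algebraicClosure_iff.2 hba
      have hyS : algebraMap N Ω y0 + t * (b - algebraMap N Ω x0) ∈ S := by
        rw [mem_algebraicClosure_iff]
        let bS : S := ⟨b, hbS⟩
        let _ : Algebra k S := ((algebraMap N S).comp (algebraMap k N)).toAlgebra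
        haveI : IsScalarTower k S Ω := IsScalarTower.of_algebraMap_eq (fun x => IsScalarTower.algebraMap_apply k N Ω x)
        obtain ⟨hmo, -⟩ := pl_monic Q hQ (![1, bS, 0] : Fin 3 → S) ![0, 0, 1] (aeval_001 Q h1)
        have : IsIntegral S (algebraMap N Ω y0 + t * (b - algebraMap N Ω x0)) := by
          refine ⟨_, hmo, ?_⟩
          have h3 := pl_eval2 Q (![1, bS, 0] : Fin 3 → S) ![0, 0, 1] (IsScalarTower.toAlgHom k S Ω) (algebraMap N Ω y0 + t * (b - algebraMap N Ω x0))
          refine Eq.trans h3 (Eq.trans ?_ hb)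
          congr 2
          funext i; fin_cases i <;> simp [bS]
        exact this.isAlgebraic.restrictScalars N
      apply htr
      have : t ∈ S := by
        have h4 : t = (algebraMap N Ω y0 + t * (b - algebraMap N Ω x0) - algebraMap N Ω y0) / (b - algebraMap N Ω x0) := by
          field_simp; ring
        rw [h4]
        exact div_mem (sub_mem hyS (algebraMap_mem _ _)) (sub_mem hbS (algebraMap_mem _ _))
      exact mem_algebraicClosure_iff.1 this
    have hinj : Function.Injective (Polynomial.aeval b : Polynomial N →ₐ[N] Ω) := transcendental_iff_injective.1 hbt
    let l : E →+* Ω := IsFractionRing.lift (g := (Polynomial.aeval b : Polynomial N →ₐ[N] Ω).toRingHom) hinj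
    have hl : ∀ p, l (algebraMap _ E p) = Polynomial.aeval b p := fun p => IsFractionRing.lift_algebraMap hinj p
    have h5 : ((f2 N Q).map (algebraMap (Polynomial N) E)).eval₂ l (algebraMap N Ω y0 + t * (b - algebraMap N Ω x0)) = 0 := by
      rw [Polynomial.eval₂_map]
      have : l.comp (algebraMap (Polynomial N) E) = (((Polynomial.aeval b : Polynomial N →ₐ[N] Ω).restrictScalars k : Polynomial N →ₐ[k] Ω) : Polynomial N →+* Ω) := by
        apply RingHom.ext; intro p; exact hl p
      rw [this, f2_eval2]
      simpa using hb
    refine ⟨AdjoinRoot.lift l _ h5, fun x => ?_, ?_, ?_⟩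
    · rw [AdjoinRoot.lift_of, hl]; simp
    · rw [AdjoinRoot.lift_of, hl]; simp
    · rw [AdjoinRoot.lift_root]
  let X' : M := AdjoinRoot.of _ (algebraMap (Polynomial N) E Polynomial.X)
  let cN : N →+* M := (AdjoinRoot.of ((f2 N Q).map (algebraMap (Polynomial N) E))).comp ((algebraMap (Polynomial N) E).comp Polynomial.C)
  let τ : M := (AdjoinRoot.root _ - cN y0) / (X' - cN x0)
  have hψτ : ∀ (ψ : M →+* Ω) (b : Ω), b ≠ algebraMap N Ω x0 → (∀ x : N, ψ (cN x) = algebraMap N Ω x) → ψ X' = b →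
      ψ (AdjoinRoot.root _) = algebraMap N Ω y0 + t * (b - algebraMap N Ω x0) → ψ τ = t := by
    intro ψ b hbx e1 e2 e3
    have hbx0 := sub_ne_zero.2 hbx
    simp only [τ, map_div₀, map_sub, e1, e2, e3]
    field_simp; ring
  obtain ⟨ψ, e1, e2, e3⟩ := key b hb hbx
  obtain ⟨ψ', e1', e2', e3'⟩ := key b' hb' hbx'
  have hτ := hψτ ψ b hbx e1 e2 e3
  have hτ' := hψτ ψ' b' hbx' e1' e2' e3'
  let ε : Polynomial N →+* M := Polynomial.eval₂RingHom cN τ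
  have hψε : ∀ p, ψ (ε p) = Polynomial.aeval t p := by
    intro p
    have : ψ.comp ε = (Polynomial.aeval t : Polynomial N →ₐ[N] Ω).toRingHom := by
      apply Polynomial.ringHom_ext
      · intro a; simp [ε]; exact e1 a
      · simp [ε, hτ]
    exact RingHom.congr_fun this p
  have hψε' : ∀ p, ψ' (ε p) = Polynomial.aeval t p := by
    intro p
    have : ψ'.comp ε = (Polynomial.aeval t : Polynomial N →ₐ[N] Ω).toRingHom := by
      apply Polynomial.ringHom_ext
      · intro a; simp [ε]; exact e1' a
      · simp [ε, hτ']
    exact RingHom.congr_fun this p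
  have hεi : Function.Injective ε := by
    rw [injective_iff_map_eq_zero]
    intro p hp
    apply transcendental_iff.1 htr
    rw [← hψε, hp, map_zero]
  let e : E →+* M := IsFractionRing.lift hεi
  have he : ∀ p, e (algebraMap _ E p) = ε p := fun p => IsFractionRing.lift_algebraMap hεi p
  have hAt : ∀ p : Polynomial N, algebraMap E Ω (algebraMap _ E p) = Polynomial.aeval t p := by
    intro p
    have : (algebraMap E Ω).comp (algebraMap (Polynomial N) E) = (Polynomial.aeval t : Polynomial N →ₐ[N] Ω).toRingHom := by
      apply Polynomial.ringHom_ext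
      · intro a
        have h8 : algebraMap (Polynomial N) E (Polynomial.C a) = algebraMap N E a := by
          rw [IsScalarTower.algebraMap_apply N (Polynomial N) E]; rfl
        simp only [RingHom.comp_apply, h8]
        rw [← IsScalarTower.algebraMap_apply N E Ω]
        simp
      · change algebraMap E Ω (algebraMap _ E Polynomial.X) = Polynomial.aeval t Polynomial.X
        rw [Polynomial.aeval_X, ht]
    exact RingHom.congr_fun this p
  have hc : ψ.comp e = algebraMap E Ω := by
    apply IsLocalization.ringHom_ext (nonZeroDivisors (Polynomial N))
    apply RingHom.ext; intro p
    simp only [RingHom.comp_apply, he, hψε, hAt]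
  have hc' : ψ'.comp e = algebraMap E Ω := by
    apply IsLocalization.ringHom_ext (nonZeroDivisors (Polynomial N))
    apply RingHom.ext; intro p
    simp only [RingHom.comp_apply, he, hψε', hAt]
  have h9 : m.eval₂ e X' = 0 := by
    apply ψ.injective
    rw [map_zero, Polynomial.hom_eval₂, hc, e2]
    exact hm
  have := congrArg ψ' h9
  rw [map_zero, Polynomial.hom_eval₂, hc', e2'] at this
  exact this
end IncAux

namespace IncAux

lemma prod_dvd_of_roots {A : Type} [CommRing A] [IsDomain A] {n : ℕ} (f : Polynomial A) (hf : f ≠ 0)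
    (y : Fin n → A) (hy : Function.Injective y) (h0 : ∀ i, f.eval (y i) = 0) :
    (∏ i, (Polynomial.X - Polynomial.C (y i))) ∣ f := by
  have hle : Finset.univ.val.map y ≤ f.roots := by
    rw [Multiset.le_iff_subset (Multiset.Nodup.map hy Finset.univ.nodup)]
    intro a ha
    obtain ⟨i, -, rfl⟩ := Multiset.mem_map.1 ha
    exact (Polynomial.mem_roots hf).2 (h0 i)
  have := (Multiset.prod_X_sub_C_dvd_iff_le_roots hf (Finset.univ.val.map y)).2 hle
  rwa [Multiset.map_map] at this

lemma swap_abs {κ : Type} [Field κ] {n : ℕ} (f : Polynomial (PowerSeries κ)) (hdeg : f.natDegree = n + 2)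
    (hlead : PowerSeries.constantCoeff f.leadingCoeff ≠ 0) (ρ : Fin n → κ) (hρ : Function.Injective ρ)
    (h0 : ∀ i, (f.map PowerSeries.constantCoeff).eval (ρ i) = 0)
    (h1 : ∀ i, (f.map PowerSeries.constantCoeff).derivative.eval (ρ i) ≠ 0) (ρ0 : κ)
    (h2 : (f.map PowerSeries.constantCoeff).eval ρ0 = 0) (h3 : (f.map PowerSeries.constantCoeff).derivative.eval ρ0 = 0)
    (h4 : PowerSeries.coeff 1 (f.eval (PowerSeries.C ρ0)) ≠ 0)
    (hsep : ((f.map (algebraMap (PowerSeries κ) (LaurentSeries κ))).map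
      (algebraMap (LaurentSeries κ) (AlgebraicClosure (LaurentSeries κ)))).Separable) :
    ∃ (ϕ : AlgebraicClosure (LaurentSeries κ) ≃ₐ[LaurentSeries κ] AlgebraicClosure (LaurentSeries κ))
      (r1 r2 : AlgebraicClosure (LaurentSeries κ)), r1 ≠ r2 ∧
      ((f.map (algebraMap (PowerSeries κ) (LaurentSeries κ))).map
      (algebraMap (LaurentSeries κ) (AlgebraicClosure (LaurentSeries κ)))).eval r1 = 0 ∧
      ((f.map (algebraMap (PowerSeries κ) (LaurentSeries κ))).map
      (algebraMap (LaurentSeries κ) (AlgebraicClosure (LaurentSeries κ)))).eval r2 = 0 ∧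
      ϕ r1 = r2 ∧ ϕ r2 = r1 ∧ ∀ r, r ≠ r1 → r ≠ r2 → ((f.map (algebraMap (PowerSeries κ) (LaurentSeries κ))).map
      (algebraMap (LaurentSeries κ) (AlgebraicClosure (LaurentSeries κ)))).eval r = 0 → ϕ r = r := by
  set Λ := LaurentSeries κ
  set Ω := AlgebraicClosure Λ
  have hf0 : f ≠ 0 := by rintro rfl; simp at hdeg
  have hR : ∀ i, ∃ R : PowerSeries κ, f.eval R = 0 ∧ PowerSeries.constantCoeff R = ρ i := by
    intro i
    obtain ⟨ξ, a, b, -⟩ := hensel f (ρ i) ((f.map PowerSeries.constantCoeff).derivative.eval (ρ i))⁻¹ (h0 i) (inv_mul_cancel₀ (h1 i))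
    exact ⟨ξ, a, b⟩
  choose R hR1 hR2 using hR
  have hRi : Function.Injective R := fun i j h => hρ (by rw [← hR2, ← hR2, h])
  obtain ⟨e, he⟩ := prod_dvd_of_roots f hf0 R hRi hR1
  set D := ∏ i, (Polynomial.X - Polynomial.C (R i)) with hD
  have hDm : D.Monic := Polynomial.monic_prod_of_monic _ _ (fun i _ => Polynomial.monic_X_sub_C _)
  have hDd : D.natDegree = n := by
    rw [hD, Polynomial.natDegree_prod_of_monic _ _ (fun i _ => Polynomial.monic_X_sub_C _)]; simp
  have he0 : e ≠ 0 := by rintro rfl; simp at he; exact hf0 he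
  have hed : e.natDegree = 2 := by
    have := hDm.natDegree_mul' he0
    rw [← he, hdeg, hDd] at this; omega
  have hel : e.leadingCoeff = f.leadingCoeff := by rw [he, Polynomial.leadingCoeff_monic_mul hDm]
  have hcc : ∀ (p : Polynomial (PowerSeries κ)) , PowerSeries.constantCoeff (p.eval (PowerSeries.C ρ0)) = (p.map PowerSeries.constantCoeff).eval ρ0 := by
    intro p
    have := Polynomial.eval_map_apply PowerSeries.constantCoeff (PowerSeries.C ρ0) (p := p)
    rw [← this]; simp
  have hD0 : (D.map PowerSeries.constantCoeff).eval ρ0 ≠ 0 := by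
    rw [hD, Polynomial.map_prod, Polynomial.eval_prod, Finset.prod_ne_zero_iff]
    intro i _
    simp [hR2, sub_ne_zero]
    rintro rfl
    exact h1 i h3
  have hfm : f.map PowerSeries.constantCoeff = D.map PowerSeries.constantCoeff * e.map PowerSeries.constantCoeff := by
    rw [← Polynomial.map_mul, ← he]
  have he1 : (e.map PowerSeries.constantCoeff).eval ρ0 = 0 := by
    rw [hfm, Polynomial.eval_mul] at h2
    exact (mul_eq_zero.1 h2).resolve_left hD0
  have he2 : (e.map PowerSeries.constantCoeff).derivative.eval ρ0 = 0 := by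
    rw [hfm, Polynomial.derivative_mul, Polynomial.eval_add, Polynomial.eval_mul, Polynomial.eval_mul, he1, mul_zero, zero_add] at h3
    exact (mul_eq_zero.1 h3).resolve_left hD0
  set h := Polynomial.taylor (PowerSeries.C ρ0) e with hh
  have hhd : h.natDegree = 2 := by rw [hh, Polynomial.natDegree_taylor, hed]
  have hunit : IsUnit h.leadingCoeff := by
    rw [hh, Polynomial.leadingCoeff_taylor, hel, PowerSeries.isUnit_iff_constantCoeff]
    exact isUnit_iff_ne_zero.2 hlead
  have hprim : h.IsPrimitive := by
    intro r hr
    exact isUnit_of_dvd_unit ((Polynomial.C_dvd_iff_dvd_coeff _ _).1 hr h.natDegree) hunit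
  have hmemX : ∀ a : PowerSeries κ, a ∈ Ideal.span {(PowerSeries.X : PowerSeries κ)} ↔ PowerSeries.constantCoeff a = 0 := by
    intro a; rw [Ideal.mem_span_singleton, PowerSeries.X_dvd_iff]
  have hPp : (Ideal.span {(PowerSeries.X : PowerSeries κ)}).IsPrime := PowerSeries.span_X_isPrime
  have hE : h.IsEisensteinAt (Ideal.span {(PowerSeries.X : PowerSeries κ)}) := by
    refine ⟨?_, ?_, ?_⟩
    · intro hc
      exact hPp.ne_top (Ideal.eq_top_of_isUnit_mem _ hc hunit)
    · intro m hm
      rw [hhd] at hm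
      rw [hmemX]
      interval_cases m
      · rw [hh, Polynomial.taylor_coeff_zero, hcc, he1]
      · rw [hh, Polynomial.taylor_coeff_one, hcc, ← Polynomial.derivative_map, he2]
    · rw [hh, Polynomial.taylor_coeff_zero, Ideal.span_singleton_pow, Ideal.mem_span_singleton]
      intro hc
      apply h4
      have : PowerSeries.X ^ 2 ∣ f.eval (PowerSeries.C ρ0) := by
        rw [he, Polynomial.eval_mul]; exact hc.mul_left _
      exact (PowerSeries.X_pow_dvd_iff.1 this) 1 (by norm_num)
  have hirr := hE.irreducible hPp hprim (by omega)
  have hirrΛ : Irreducible (h.map (algebraMap (PowerSeries κ) Λ)) :=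
    (hprim.irreducible_iff_irreducible_map_fraction_map).1 hirr
  set fΩ := (f.map (algebraMap (PowerSeries κ) Λ)).map (algebraMap Λ Ω) with hfΩ
  set eΩ := (e.map (algebraMap (PowerSeries κ) Λ)).map (algebraMap Λ Ω) with heΩ
  let φ : PowerSeries κ →+* Ω := (algebraMap Λ Ω).comp (algebraMap (PowerSeries κ) Λ)
  have hφi : Function.Injective φ := (algebraMap Λ Ω).injective.comp (IsFractionRing.injective (PowerSeries κ) Λ)
  have heφ : eΩ = e.map φ := by rw [heΩ, Polynomial.map_map]
  have hfφ : fΩ = f.map φ := by rw [hfΩ, Polynomial.map_map]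
  have hmul : fΩ = D.map φ * eΩ := by rw [hfφ, heφ, he, Polynomial.map_mul]
  have hes : eΩ.Separable := hsep.of_dvd ⟨D.map φ, by rw [hmul, mul_comm]⟩
  have hedΩ : eΩ.natDegree = 2 := by rw [heφ, Polynomial.natDegree_map_eq_of_injective hφi, hed]
  have hcard : Multiset.card eΩ.roots = 2 := by
    rw [← hedΩ]; exact (IsAlgClosed.splits eΩ).natDegree_eq_card_roots.symm
  obtain ⟨r1, r2, hr⟩ := Multiset.card_eq_two.1 hcard
  have hnd := Polynomial.nodup_roots hes
  have hne : r1 ≠ r2 := by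
    rw [hr] at hnd
    rintro rfl
    simp at hnd
  have heΩ0 : eΩ ≠ 0 := by intro h; rw [h] at hedΩ; simp at hedΩ
  have hroot : ∀ r, eΩ.eval r = 0 ↔ r = r1 ∨ r = r2 := by
    intro r
    have : r ∈ eΩ.roots ↔ eΩ.IsRoot r := Polynomial.mem_roots heΩ0
    rw [hr] at this
    simpa using this.symm
  have hz : ∀ r, eΩ.eval r = 0 → Polynomial.aeval (r - φ (PowerSeries.C ρ0)) (h.map (algebraMap (PowerSeries κ) Λ)) = 0 := by
    intro r hr
    rw [Polynomial.aeval_def, Polynomial.eval₂_eq_eval_map, Polynomial.map_map]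
    change (h.map φ).eval _ = 0
    rw [hh, Polynomial.taylor_apply, Polynomial.map_comp, Polynomial.eval_comp, ← heφ]
    simpa using hr
  have hr1 := (hroot r1).2 (Or.inl rfl)
  have hr2 := (hroot r2).2 (Or.inr rfl)
  have hconj : IsConjRoot Λ (r2 - φ (PowerSeries.C ρ0)) (r1 - φ (PowerSeries.C ρ0)) := by
    rw [IsConjRoot, ← minpoly.eq_of_irreducible hirrΛ (hz r1 hr1), ← minpoly.eq_of_irreducible hirrΛ (hz r2 hr2)]
  obtain ⟨ϕ, hϕ⟩ := isConjRoot_iff_exists_algEquiv.1 hconj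
  have hϕφ : ∀ x, ϕ (φ x) = φ x := fun x => ϕ.commutes _
  have hϕ1 : ϕ r1 = r2 := by
    rw [map_sub, hϕφ] at hϕ; exact sub_left_injective hϕ
  have hϕe : ∀ r, eΩ.eval r = 0 → eΩ.eval (ϕ r) = 0 := by
    intro r hr
    have : ϕ (eΩ.eval r) = eΩ.eval (ϕ r) := by
      rw [heΩ, Polynomial.eval_map, Polynomial.eval_map, ← Polynomial.aeval_def, ← Polynomial.aeval_def]
      exact (Polynomial.aeval_algHom_apply ϕ.toAlgHom r _).symm
    rw [← this, hr, map_zero]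
  refine ⟨ϕ, r1, r2, hne, ?_, ?_, hϕ1, ?_, ?_⟩
  · rw [hmul, Polynomial.eval_mul, hr1, mul_zero]
  · rw [hmul, Polynomial.eval_mul, hr2, mul_zero]
  · rcases (hroot _).1 (hϕe r2 hr2) with h | h
    · exact h
    · exact absurd (ϕ.injective (h.trans hϕ1.symm)) hne.symm
  · intro r hn1 hn2 hr0
    rw [hmul, Polynomial.eval_mul] at hr0
    have : eΩ.eval r ≠ 0 := fun h => ((hroot r).1 h).elim hn1 hn2
    have := (mul_eq_zero.1 hr0).resolve_right this
    rw [hD, Polynomial.map_prod, Polynomial.eval_prod, Finset.prod_eq_zero_iff] at this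
    obtain ⟨i, -, hi⟩ := this
    simp [sub_eq_zero] at hi
    rw [hi, hϕφ]
end IncAux

namespace IncAux

abbrev E0 (k : Type) [Field k] : Type := FractionRing (MvPolynomial (Fin 2) k)
noncomputable def sE (k : Type) [Field k] : E0 k := algebraMap (MvPolynomial (Fin 2) k) _ (X 0)
noncomputable def tE (k : Type) [Field k] : E0 k := algebraMap (MvPolynomial (Fin 2) k) _ (X 1)

lemma E0_hom {k : Type} [Field k] {B : Type} [Field B] [Algebra k B] (s t : B)
    (h : Function.Injective (MvPolynomial.aeval (R := k) ![s, t])) :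
    ∃ j : E0 k →ₐ[k] B, j (sE k) = s ∧ j (tE k) = t := by
  refine ⟨IsFractionRing.liftAlgHom (g := MvPolynomial.aeval (R := k) ![s, t]) h, ?_, ?_⟩
  · rw [sE, IsFractionRing.liftAlgHom_apply, IsFractionRing.lift_algebraMap]; simp
  · rw [tE, IsFractionRing.liftAlgHom_apply, IsFractionRing.lift_algebraMap]; simp

/-- root of the restriction to the line y = s + t x -/
def Rt {k B : Type} [CommRing k] [CommRing B] [Algebra k B] (Q : MvPolynomial (Fin 3) k) (s t x : B) : Prop :=
  MvPolynomial.aeval (![1, x, s + x * t] : Fin 3 → B) Q = 0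

noncomputable def p0 {k B : Type} [CommRing k] [CommRing B] [Algebra k B] (Q : MvPolynomial (Fin 3) k) (s t : B) : Polynomial B :=
  pl Q ![1, 0, s] ![0, 1, t]

section
variable {k B : Type} [CommRing k] [CommRing B] [Algebra k B] (Q : MvPolynomial (Fin 3) k)

lemma p0_eval (s t x : B) : (p0 Q s t).eval x = MvPolynomial.aeval (![1, x, s + x * t] : Fin 3 → B) Q := by
  rw [p0, pl_eval]
  congr 2; funext i; fin_cases i <;> simp

lemma p0_rt (s t x : B) : (p0 Q s t).eval x = 0 ↔ Rt Q s t x := by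
  rw [p0_eval, Rt]

lemma p0_map {B' : Type} [CommRing B'] [Algebra k B'] (f : B →ₐ[k] B') (s t : B) :
    (p0 Q s t).map (f : B →+* B') = p0 Q (f s) (f t) := by
  rw [p0, pl_map, p0]
  congr 1 <;> (funext i; fin_cases i <;> simp)

lemma rt_map {B' : Type} [CommRing B'] [Algebra k B'] (f : B →ₐ[k] B') (s t x : B) (h : Rt Q s t x) :
    Rt Q (f s) (f t) (f x) := by
  rw [Rt] at h ⊢
  rw [← map_zero f, ← h, aeval_map_alg]
  congr 2; funext i; fin_cases i <;> simp

lemma p0_deg {d : ℕ} (hQ : Q.IsHomogeneous d) (s t : B) : (p0 Q s t).natDegree ≤ d ∧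
    (p0 Q s t).coeff d = MvPolynomial.aeval (![0, 1, t] : Fin 3 → B) Q := pl_deg Q hQ _ _
end

section
variable {k : Type} [Field k] [IsAlgClosed k] {d : ℕ} (Q : MvPolynomial (Fin 3) k) (hd : 2 ≤ d) (hQ : Q.IsHomogeneous d)
    (h1 : eval ![0, 0, 1] Q = 1) (hirr : Irreducible Q)
    (L : Type) [Field L] [Algebra k L] [Algebra (E0 k) L] [IsScalarTower k (E0 k) L] [Normal (E0 k) L]
    (hs : ((p0 Q (sE k) (tE k)).map (algebraMap (E0 k) L)).Splits) (hne : p0 Q (sE k) (tE k) ≠ 0)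

include hs hne in
/-- transfer along a specialization -/
lemma transfer' {E : Type} [Field E] [Algebra k E] (j : E0 k →ₐ[k] E) :
    ∃ ι : L →ₐ[k] AlgebraicClosure E, (∀ x : E0 k, ι (algebraMap (E0 k) L x) = algebraMap E _ (j x)) ∧
      (∀ ϕ : AlgebraicClosure E ≃ₐ[E] AlgebraicClosure E, ∃ g : L ≃ₐ[E0 k] L, ∀ x, ι (g x) = ϕ (ι x)) ∧
      ∀ b, Rt Q (algebraMap E (AlgebraicClosure E) (j (sE k))) (algebraMap E (AlgebraicClosure E) (j (tE k))) b →
        ∃ α, Rt Q (algebraMap _ L (sE k)) (algebraMap _ L (tE k)) α ∧ ι α = b := by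
  obtain ⟨ι, hι, hg⟩ := transfer (L := L) (j : E0 k →+* E)
  have hk : ∀ a : k, ι (algebraMap k L a) = algebraMap k (AlgebraicClosure E) a := by
    intro a
    rw [IsScalarTower.algebraMap_apply k (E0 k) L, hι, IsScalarTower.algebraMap_apply k E (AlgebraicClosure E)]
    simp
  let ι' : L →ₐ[k] AlgebraicClosure E := { ι with commutes' := hk }
  have hι' : ∀ x, ι' x = ι x := fun _ => rfl
  refine ⟨ι', hι, hg, fun b hb => ?_⟩
  set f := (p0 Q (sE k) (tE k)).map (algebraMap (E0 k) L) with hf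
  have hf0 : f ≠ 0 := (Polynomial.map_ne_zero_iff (algebraMap (E0 k) L).injective).2 hne
  have hfe : f = p0 Q (algebraMap _ L (sE k)) (algebraMap _ L (tE k)) := by
    rw [hf]; exact p0_map Q (IsScalarTower.toAlgHom k (E0 k) L) _ _
  have hfb : (f.map ι).eval b = 0 := by
    have : f.map ι = p0 Q (algebraMap E (AlgebraicClosure E) (j (sE k))) (algebraMap E (AlgebraicClosure E) (j (tE k))) := by
      have := p0_map Q ι' (algebraMap _ L (sE k)) (algebraMap _ L (tE k))
      rw [hfe]
      refine Eq.trans this ?_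
      rw [hι', hι', hι, hι]; rfl
    rw [this, p0_rt]; exact hb
  have h2 := Polynomial.Splits.roots_map hs ι
  have hfm : f.map ι ≠ 0 := (Polynomial.map_ne_zero_iff ι.injective).2 hf0
  have h3 : b ∈ (f.map ι).roots := (Polynomial.mem_roots hfm).2 hfb
  rw [h2, Multiset.mem_map] at h3
  obtain ⟨α, ha, hab⟩ := h3
  refine ⟨α, ?_, hab⟩
  rw [← p0_rt, ← hfe]; exact (Polynomial.mem_roots hf0).1 ha

include hd hQ h1 hirr hs hne in
lemma conj_main {N : Type} [Field N] [Algebra k N] (x0 y0 : N)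
    (hxy : ¬ ∃ a b : k, x0 = algebraMap k N a ∧ y0 = algebraMap k N b) :
    ∃ ι : L →ₐ[k] AlgebraicClosure (FractionRing (Polynomial N)),
      (∃ T : AlgebraicClosure (FractionRing (Polynomial N)), Transcendental N T ∧
        ι (algebraMap _ L (tE k)) = T ∧
        ι (algebraMap _ L (sE k)) = algebraMap N _ y0 - T * algebraMap N _ x0 ∧
        ∀ b, Rt Q (algebraMap N _ y0 - T * algebraMap N _ x0) T b →
          ∃ α, Rt Q (algebraMap _ L (sE k)) (algebraMap _ L (tE k)) α ∧ ι α = b) ∧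
      ∀ α α', Rt Q (algebraMap _ L (sE k)) (algebraMap _ L (tE k)) α →
        Rt Q (algebraMap _ L (sE k)) (algebraMap _ L (tE k)) α' → ι α ≠ algebraMap N _ x0 →
        ι α' ≠ algebraMap N _ x0 → ∃ g : L ≃ₐ[E0 k] L, g α = α' ∧ ∀ β, ι β = algebraMap N _ x0 → g β = β := by
  set E := FractionRing (Polynomial N) with hE
  set Ω := AlgebraicClosure E with hΩ
  set t : E := algebraMap (Polynomial N) E Polynomial.X with ht
  have httr : Transcendental N t := by
    rw [transcendental_iff]
    intro p hp
    have : Polynomial.aeval t p = algebraMap (Polynomial N) E p := by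
      have := Polynomial.aeval_algebraMap_apply E (Polynomial.X : Polynomial N) p
      rw [ht, this]; simp
    rw [this] at hp
    exact (IsFractionRing.injective (Polynomial N) E) (by rw [hp, map_zero])
  have httr' : Transcendental N (algebraMap E Ω t) := (transcendental_algebraMap_iff (algebraMap E Ω).injective).2 httr
  obtain ⟨j, js, jt⟩ := E0_hom (k := k) _ _ (algind (A := E) x0 y0 hxy t httr)
  obtain ⟨ι, i1, i2, i3⟩ := transfer' Q L hs hne j
  have hS : algebraMap E Ω (j (sE k)) = algebraMap N Ω y0 - algebraMap E Ω t * algebraMap N Ω x0 := by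
    rw [js, map_sub, map_mul, ← IsScalarTower.algebraMap_apply N E Ω, ← IsScalarTower.algebraMap_apply N E Ω]
  refine ⟨ι, ⟨algebraMap E Ω t, httr', ?_, ?_, ?_⟩, ?_⟩
  · rw [i1, jt]
  · rw [i1, hS]
  · intro b hb
    exact i3 b (by rw [hS, jt]; exact hb)
  · intro α α' ha ha' hax hax'
    have key : ∀ β, Rt Q (algebraMap _ L (sE k)) (algebraMap _ L (tE k)) β →
        MvPolynomial.aeval ![1, ι β, algebraMap N Ω y0 + algebraMap E Ω t * (ι β - algebraMap N Ω x0)] Q = 0 := by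
      intro β hβ
      have := rt_map Q ι _ _ _ hβ
      rw [i1, i1, hS, jt, Rt] at this
      refine Eq.trans ?_ this
      congr 2; funext i; fin_cases i <;> simp <;> ring
    have hc : ∀ m : Polynomial E, Polynomial.aeval (ι α) m = 0 → Polynomial.aeval (ι α') m = 0 := fun m hm =>
      conj_roots Q hd hQ h1 hirr x0 y0 (algebraMap E Ω t) rfl _ _ (key α ha) hax (key α' ha') hax' m hm
    have hcj : IsConjRoot E (ι α') (ι α) := by
      have hai : IsIntegral E (ι α) := (Algebra.IsAlgebraic.isAlgebraic (ι α)).isIntegral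
      have := minpoly.eq_of_irreducible_of_monic (minpoly.irreducible hai) (hc _ (minpoly.aeval E (ι α))) (minpoly.monic hai)
      exact this.symm
    obtain ⟨ϕ, hϕ⟩ := (isConjRoot_iff_exists_algEquiv).1 hcj
    obtain ⟨g, hg⟩ := i2 ϕ
    refine ⟨g, ?_, ?_⟩
    · apply ι.toRingHom.injective
      show ι (g α) = ι α'
      rw [hg]; exact hϕ
    · intro β hβ
      apply ι.toRingHom.injective
      show ι (g β) = ι β
      rw [hg, hβ, IsScalarTower.algebraMap_apply N E Ω, AlgEquiv.commutes]
end
end IncAux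

namespace IncAux

structure Tan {k : Type} [Field k] (Q : MvPolynomial (Fin 3) k) (d : ℕ) (s0 t0 ρ0 : k) (ρ : Fin (d-2) → k) : Prop where
  lead : MvPolynomial.aeval (![0, 1, t0] : Fin 3 → k) Q ≠ 0
  inj : Function.Injective ρ
  root : ∀ i, (p0 Q s0 t0).eval (ρ i) = 0
  simp : ∀ i, (p0 Q s0 t0).derivative.eval (ρ i) ≠ 0
  root0 : (p0 Q s0 t0).eval ρ0 = 0
  dbl : (p0 Q s0 t0).derivative.eval ρ0 = 0
  tr : MvPolynomial.aeval (![1, ρ0, s0 + ρ0 * t0] : Fin 3 → k) (pderiv 2 Q) ≠ 0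

lemma p0_lead_ne {k : Type} [Field k] (Q : MvPolynomial (Fin 3) k) (t0 : k)
    (h : MvPolynomial.aeval (![0, 1, t0] : Fin 3 → k) Q ≠ 0) :
    MvPolynomial.aeval (![0, 1, tE k] : Fin 3 → E0 k) Q ≠ 0 := by
  intro h0
  have e1 := aeval_map_alg Q (IsScalarTower.toAlgHom k (MvPolynomial (Fin 2) k) (E0 k)) ![0, 1, X 1]
  have e2 : MvPolynomial.aeval (![0, 1, X 1] : Fin 3 → MvPolynomial (Fin 2) k) Q = 0 := by
    apply IsFractionRing.injective (MvPolynomial (Fin 2) k) (E0 k)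
    rw [map_zero]
    refine Eq.trans e1 (Eq.trans ?_ h0)
    congr 2; funext i; fin_cases i <;> simp [tE]
  have e3 := aeval_map_alg Q (MvPolynomial.aeval (R := k) (![0, t0] : Fin 2 → k)) ![0, 1, X 1]
  rw [e2, map_zero] at e3
  apply h
  refine Eq.trans ?_ e3.symm
  congr 2; funext i; fin_cases i <;> simp

lemma p0_deriv_eval {k B : Type} [CommRing k] [CommRing B] [Algebra k B] (Q : MvPolynomial (Fin 3) k) (s t x : B) :
    (p0 Q s t).derivative.eval x = MvPolynomial.aeval (![1, x, s + x * t] : Fin 3 → B) (pderiv 1 Q) +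
      t * MvPolynomial.aeval (![1, x, s + x * t] : Fin 3 → B) (pderiv 2 Q) := by
  have h := fun R : MvPolynomial (Fin 3) k => p0_eval (B := B) R s t x
  simp only [p0] at h
  rw [p0, pl_derivative]
  simp [Fin.sum_univ_three, h]

section
variable {k : Type} [Field k] [IsAlgClosed k] {d : ℕ} (Q : MvPolynomial (Fin 3) k) (hd : 2 ≤ d) (hQ : Q.IsHomogeneous d)
    (h1 : eval ![0, 0, 1] Q = 1) (hirr : Irreducible Q) {s0 t0 ρ0 : k} {ρ : Fin (d-2) → k} (hT : Tan Q d s0 t0 ρ0 ρ)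
    (L : Type) [Field L] [Algebra k L] [Algebra (E0 k) L] [IsScalarTower k (E0 k) L] [Normal (E0 k) L]
    (hs : ((p0 Q (sE k) (tE k)).map (algebraMap (E0 k) L)).Splits) (hne : p0 Q (sE k) (tE k) ≠ 0)

include hQ hT in
lemma p0_natDegree : (p0 Q (sE k) (tE k)).natDegree = d := by
  have h := p0_deg Q hQ (sE k) (tE k)
  refine le_antisymm h.1 (Polynomial.le_natDegree_of_ne_zero ?_)
  rw [h.2]; exact p0_lead_ne Q t0 hT.lead

include hQ hT hd in
lemma p0_ne : p0 Q (sE k) (tE k) ≠ 0 := by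
  have := p0_natDegree Q hQ hT
  rintro h; rw [h] at this; simp at this; omega

include hd hQ h1 hirr hs hne in
lemma u1_trans (α α' : L) (ha : Rt Q (algebraMap _ L (sE k)) (algebraMap _ L (tE k)) α)
    (ha' : Rt Q (algebraMap _ L (sE k)) (algebraMap _ L (tE k)) α') : ∃ g : L ≃ₐ[E0 k] L, g α = α' := by
  set N := FractionRing (Polynomial k)
  set c : N := algebraMap (Polynomial k) N Polynomial.X with hc
  have hctr : Transcendental k c := by
    rw [transcendental_iff]
    intro p hp
    have : Polynomial.aeval c p = algebraMap (Polynomial k) N p := by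
      rw [hc, Polynomial.aeval_algebraMap_apply N (Polynomial.X : Polynomial k) p]; simp
    rw [this] at hp
    exact (IsFractionRing.injective (Polynomial k) N) (by rw [hp, map_zero])
  obtain ⟨ι, ⟨T, hT, i1, i2, -⟩, i3⟩ := conj_main Q hd hQ h1 hirr L hs hne (0 : N) c (by
    rintro ⟨a, b, -, hb⟩
    exact hctr (hb ▸ isAlgebraic_algebraMap b))
  have key : ∀ β, Rt Q (algebraMap _ L (sE k)) (algebraMap _ L (tE k)) β → ι β ≠ algebraMap N _ 0 := by
    intro β hβ h0
    have h2 := rt_map Q ι _ _ _ hβ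
    rw [i1, i2, h0, Rt] at h2
    have hm := pl_monic Q hQ (![1, 0, 0] : Fin 3 → k) (![0, 0, 1] : Fin 3 → k) (aeval_001 Q h1)
    apply hctr
    refine ⟨_, hm.1.ne_zero, ?_⟩
    have h3 := pl_eval2 Q (![1, 0, 0] : Fin 3 → k) (![0, 0, 1] : Fin 3 → k) (Algebra.ofId k N) c
    refine Eq.trans h3 ?_
    apply (algebraMap N (AlgebraicClosure (FractionRing (Polynomial N)))).injective
    rw [map_zero]
    refine Eq.trans (aeval_map_alg Q (IsScalarTower.toAlgHom k N (AlgebraicClosure (FractionRing (Polynomial N)))) _) (Eq.trans ?_ h2)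
    congr 2; funext i; fin_cases i <;> simp
  obtain ⟨g, hg, -⟩ := i3 α α' ha ha' (key _ ha) (key _ ha')
  exact ⟨g, hg⟩

include hd hQ h1 hirr hs hne hT in
/-- stabilizer transitivity, plus a simple root -/
lemma u1_stab : ∃ α0, Rt Q (algebraMap _ L (sE k)) (algebraMap _ L (tE k)) α0 ∧
    (p0 Q (algebraMap _ L (sE k)) (algebraMap _ L (tE k))).derivative.eval α0 ≠ 0 ∧
    ∀ α α', Rt Q (algebraMap _ L (sE k)) (algebraMap _ L (tE k)) α →
      Rt Q (algebraMap _ L (sE k)) (algebraMap _ L (tE k)) α' → α ≠ α0 → α' ≠ α0 →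
      ∃ g : L ≃ₐ[E0 k] L, g α0 = α0 ∧ g α = α' := by
  obtain ⟨M, _, _, x, y, hxy, hdv⟩ := exists_generic Q hd hQ h1 hirr
  have hf2 := f2_monic Q hd hQ h1 hirr k
  have hnot : ¬ ∃ a b : k, x = algebraMap k M a ∧ y = algebraMap k M b := by
    rintro ⟨a, b, ha, -⟩
    have := hdv (Polynomial.C (Polynomial.X - Polynomial.C a)) (by simp [ha])
    have h := Polynomial.natDegree_le_of_dvd this (by
      rw [Ne, Polynomial.C_eq_zero]; exact Polynomial.X_sub_C_ne_zero a)
    rw [hf2.2, Polynomial.natDegree_C] at h; omega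
  have hw : MvPolynomial.aeval (![1, x, y] : Fin 3 → M) (pderiv 2 Q) ≠ 0 := by
    intro h0
    have hd2 : (f2 k Q).derivative = f2 k (pderiv 2 Q) := by
      simp only [f2]
      rw [pl_derivative]; simp [Fin.sum_univ_three]
    have h2 := hdv (f2 k Q).derivative (by
      rw [hd2]
      refine Eq.trans (f2_eval2 (pderiv 2 Q) (Polynomial.aeval x : Polynomial k →ₐ[k] M) y) ?_
      rw [Polynomial.aeval_X, h0])
    have h3 : (f2 k Q).derivative = 0 := by
      by_contra hne
      have h := Polynomial.natDegree_le_of_dvd h2 hne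
      have := Polynomial.natDegree_derivative_lt (p := f2 k Q) (by rw [hf2.2]; omega)
      omega
    apply hT.tr
    rw [hd2] at h3
    have h4 := f2_eval2 (pderiv 2 Q) (Polynomial.aeval ρ0 : Polynomial k →ₐ[k] k) (s0 + ρ0 * t0)
    rw [h3] at h4
    rw [Polynomial.eval₂_zero, Polynomial.aeval_X] at h4
    exact h4.symm
  obtain ⟨ι, ⟨T, hTt, i1, i2, i3⟩, i4⟩ := conj_main Q hd hQ h1 hirr L hs hne x y hnot
  have hvec : ∀ R : MvPolynomial (Fin 3) k, MvPolynomial.aeval (![1, algebraMap M _ x, algebraMap M _ y - T * algebraMap M _ x + algebraMap M _ x * T] : Fin 3 → AlgebraicClosure (FractionRing (Polynomial M))) R =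
      algebraMap M _ (MvPolynomial.aeval (![1, x, y] : Fin 3 → M) R) := by
    intro R
    refine Eq.trans ?_ (aeval_map_alg R (IsScalarTower.toAlgHom k M (AlgebraicClosure (FractionRing (Polynomial M)))) _).symm
    congr 2; funext i; fin_cases i <;> simp <;> ring
  obtain ⟨α0, ha0, hι0⟩ := i3 (algebraMap M _ x) (by rw [Rt, hvec, hxy, map_zero])
  refine ⟨α0, ha0, ?_, ?_⟩
  · intro h0
    have h2 := congrArg ι h0
    have h3 := Polynomial.eval_map_apply (ι : L →+* AlgebraicClosure (FractionRing (Polynomial M))) (p := (p0 Q (algebraMap _ L (sE k)) (algebraMap _ L (tE k))).derivative) α0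
    rw [← Polynomial.derivative_map, p0_map, i1, i2] at h3
    have h4 : ι (Polynomial.eval α0 (p0 Q (algebraMap _ L (sE k)) (algebraMap _ L (tE k))).derivative) = 0 := by rw [h0, map_zero]
    have h5 := Eq.trans h3 h4
    have h6 : (ι : L →+* AlgebraicClosure (FractionRing (Polynomial M))) α0 = algebraMap M _ x := hι0
    rw [h6, p0_deriv_eval, hvec, hvec] at h5
    generalize MvPolynomial.aeval (![1, x, y] : Fin 3 → M) (pderiv 1 Q) = u1 at h5
    generalize MvPolynomial.aeval (![1, x, y] : Fin 3 → M) (pderiv 2 Q) = u2 at h5 hw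
    apply hTt
    refine ⟨Polynomial.C u1 + Polynomial.X * Polynomial.C u2, ?_, ?_⟩
    · intro h
      apply hw
      have := congrArg (fun p => Polynomial.coeff p 1) h
      simpa [Polynomial.coeff_C] using this
    · rw [mul_comm T] at h5; simpa using h5
  · intro α α' ha ha' hne hne'
    have inj := ι.toRingHom.injective
    obtain ⟨g, g1, g2⟩ := i4 α α' ha ha' (fun h => hne (inj (h.trans hι0.symm))) (fun h => hne' (inj (h.trans hι0.symm)))
    exact ⟨g, g2 _ hι0, g1⟩

include hs in
lemma p0L : (p0 Q (sE k) (tE k)).map (algebraMap (E0 k) L) = p0 Q (algebraMap _ L (sE k)) (algebraMap _ L (tE k)) :=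
  p0_map Q (IsScalarTower.toAlgHom k (E0 k) L) _ _

lemma rt_g (g : L ≃ₐ[E0 k] L) {α : L} (ha : Rt Q (algebraMap _ L (sE k)) (algebraMap _ L (tE k)) α) :
    Rt Q (algebraMap _ L (sE k)) (algebraMap _ L (tE k)) (g α) := by
  have := rt_map Q (((g : L →ₐ[E0 k] L)).restrictScalars k) _ _ _ ha
  simpa using this

include hd hQ h1 hirr hs hne hT in
lemma u1_sep : (p0 Q (sE k) (tE k)).Separable := by
  classical
  obtain ⟨α0, ha0, hder, -⟩ := u1_stab Q hd hQ h1 hirr hT L hs hne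
  rw [← Polynomial.separable_map (algebraMap (E0 k) L)]
  have hn0 : (p0 Q (sE k) (tE k)).map (algebraMap (E0 k) L) ≠ 0 := (Polynomial.map_ne_zero_iff (algebraMap (E0 k) L).injective).2 hne
  rw [← Polynomial.nodup_roots_iff_of_splits hn0 hs, Multiset.nodup_iff_count_le_one]
  intro α
  by_contra hlt
  push Not at hlt
  rw [Polynomial.count_roots, Polynomial.one_lt_rootMultiplicity_iff_isRoot hn0] at hlt
  obtain ⟨hr2, hr1⟩ := hlt
  rw [p0L Q L hs] at hr1 hr2
  obtain ⟨g, hg⟩ := u1_trans Q hd hQ h1 hirr L hs hne α α0 ((p0_rt Q _ _ _).1 hr2) ha0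
  apply hder
  have h3 := Polynomial.eval_map_apply ((g : L →ₐ[E0 k] L) : L →+* L) (p := (p0 Q (algebraMap _ L (sE k)) (algebraMap _ L (tE k))).derivative) α
  have h4 : (p0 Q (algebraMap _ L (sE k)) (algebraMap _ L (tE k))).map ((g : L →ₐ[E0 k] L) : L →+* L) = p0 Q (algebraMap _ L (sE k)) (algebraMap _ L (tE k)) := by
    have := p0_map Q (((g : L →ₐ[E0 k] L)).restrictScalars k) (algebraMap _ L (sE k)) (algebraMap _ L (tE k))
    simpa using this
  rw [← Polynomial.derivative_map, h4] at h3
  have h5 : ((g : L →ₐ[E0 k] L) : L →+* L) α = α0 := hg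
  rw [h5] at h3
  rw [h3]
  have : Polynomial.eval α (p0 Q (algebraMap _ L (sE k)) (algebraMap _ L (tE k))).derivative = 0 := hr1
  rw [this, map_zero]
end
end IncAux

namespace IncAux

lemma V_trans (κ : Type) [Field κ] : Transcendental κ (V κ) := by
  rw [transcendental_iff]; intro p hp; exact aeval_V_eq_zero hp

lemma coeff_one_aux {k κ : Type} [Field k] [Field κ] [Algebra k κ] (g : Polynomial k) (a : κ) :
    PowerSeries.coeff 1 (g.eval₂ (algebraMap k (PowerSeries κ)) (PowerSeries.C a * PowerSeries.X)) = algebraMap k κ (g.derivative.eval 0) * a := by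
  have e := g.divX_mul_X_add
  have e2 := g.divX.divX_mul_X_add
  have hc : g.derivative.eval 0 = g.coeff 1 := by
    rw [← Polynomial.coeff_zero_eq_eval_zero, Polynomial.coeff_derivative]; simp
  rw [hc]
  conv_lhs => rw [← e, ← e2]
  simp only [Polynomial.eval₂_add, Polynomial.eval₂_mul, Polynomial.eval₂_X, Polynomial.eval₂_C]
  generalize Polynomial.eval₂ (algebraMap k (PowerSeries κ)) (PowerSeries.C a * PowerSeries.X) g.divX.divX = z
  rw [Polynomial.coeff_divX]
  simp only [PowerSeries.algebraMap_apply]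
  rw [add_mul, map_add, map_add]
  have h1 : z * (PowerSeries.C a * PowerSeries.X) * (PowerSeries.C a * PowerSeries.X) = (z * PowerSeries.C a * PowerSeries.C a) * PowerSeries.X ^ 2 := by ring
  rw [h1, PowerSeries.coeff_mul_X_pow']
  rw [← mul_assoc, ← map_mul, PowerSeries.coeff_C_mul, PowerSeries.coeff_one_X, PowerSeries.coeff_C]
  simp

section
variable {k : Type} [Field k] [IsAlgClosed k] {d : ℕ} (Q : MvPolynomial (Fin 3) k) (hd : 2 ≤ d) (hQ : Q.IsHomogeneous d)
    (h1 : eval ![0, 0, 1] Q = 1) (hirr : Irreducible Q) {s0 t0 ρ0 : k} {ρ : Fin (d-2) → k} (hT : Tan Q d s0 t0 ρ0 ρ)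
    (L : Type) [Field L] [Algebra k L] [Algebra (E0 k) L] [IsScalarTower k (E0 k) L] [Normal (E0 k) L]
    (hs : ((p0 Q (sE k) (tE k)).map (algebraMap (E0 k) L)).Splits) (hne : p0 Q (sE k) (tE k) ≠ 0)

include hd hQ h1 hirr hs hne hT in
lemma u1_swap : ∃ (α1 α2 : L) (g : L ≃ₐ[E0 k] L), Rt Q (algebraMap _ L (sE k)) (algebraMap _ L (tE k)) α1 ∧
    Rt Q (algebraMap _ L (sE k)) (algebraMap _ L (tE k)) α2 ∧ α1 ≠ α2 ∧ g α1 = α2 ∧ g α2 = α1 ∧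
    ∀ α, Rt Q (algebraMap _ L (sE k)) (algebraMap _ L (tE k)) α → α ≠ α1 → α ≠ α2 → g α = α := by
  have hsep0 := u1_sep Q hd hQ h1 hirr hT L hs hne
  set κ := FractionRing (Polynomial k) with hκ
  set c : κ := algebraMap (Polynomial k) κ Polynomial.X with hc
  have hcn : ∀ a : k, c ≠ algebraMap k κ a := by
    intro a h
    have : algebraMap (Polynomial k) κ Polynomial.X = algebraMap (Polynomial k) κ (Polynomial.C a) := by
      rw [← hc, h, IsScalarTower.algebraMap_apply k (Polynomial k) κ]; rfl
    exact Polynomial.X_ne_C a (IsFractionRing.injective (Polynomial k) κ this)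
  set S : PowerSeries κ := PowerSeries.C (algebraMap k κ s0) - PowerSeries.C c * PowerSeries.X with hS
  set T : PowerSeries κ := PowerSeries.C (algebraMap k κ t0) + PowerSeries.X with hTdef
  have tower : @IsScalarTower k κ (LaurentSeries κ) Algebra.toSMul Algebra.toSMul Algebra.toSMul := IsScalarTower.of_algebraMap_eq (fun x => by
    rw [algL, HahnSeries.algebraMap_apply', PowerSeries.algebraMap_apply]; simp [HahnSeries.ofPowerSeries_C])
  have tower4 : IsScalarTower k κ (PowerSeries κ) := inferInstance
  let am : PowerSeries κ →ₐ[k] LaurentSeries κ := { algebraMap (PowerSeries κ) (LaurentSeries κ) with commutes' := fun _ => rfl }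
  have hCam : ∀ a : κ, am (PowerSeries.C a) = algebraMap κ (LaurentSeries κ) a := by
    intro a; rfl
  have hVX : am PowerSeries.X * V κ = 1 := by
    have : am PowerSeries.X = HahnSeries.single 1 1 := HahnSeries.ofPowerSeries_X
    rw [this, V, HahnSeries.single_mul_single]; simp
  have htr : Transcendental κ (am T) := by
    intro h
    apply V_trans κ
    have h2 : IsAlgebraic κ (am PowerSeries.X) := by
      have : am PowerSeries.X = am T - algebraMap κ (LaurentSeries κ) (algebraMap k κ t0) := by
        rw [hTdef, map_add, hCam]; ring
      rw [this]; exact h.sub (isAlgebraic_algebraMap _)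
    have h3 : V κ = (am PowerSeries.X)⁻¹ := by
      exact eq_inv_of_mul_eq_one_right hVX
    rw [h3]; exact h2.inv
  obtain ⟨j, js, jt⟩ := E0_hom (k := k) _ _ (algind (A := LaurentSeries κ) c (algebraMap k κ (s0) + algebraMap k κ t0 * c)
    (by rintro ⟨a, b, ha, -⟩; exact hcn a ha) (am T) htr)
  have js' : j (sE k) = am S := by
    rw [js, hS, hTdef]
    simp only [map_add, map_sub, map_mul, hCam]; ring
  obtain ⟨ι, i1, i2, i3⟩ := transfer' Q L hs hne j
  set Ω := AlgebraicClosure (LaurentSeries κ) with hΩ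
  have hfm : (((p0 Q S T).map (algebraMap (PowerSeries κ) (LaurentSeries κ))).map (algebraMap (LaurentSeries κ) Ω))
      = p0 Q (algebraMap _ Ω (j (sE k))) (algebraMap _ Ω (j (tE k))) := by
    have e1 := p0_map Q am S T
    have e2 := p0_map Q (IsScalarTower.toAlgHom k (LaurentSeries κ) Ω) (am S) (am T)
    rw [js', jt]
    refine Eq.trans ?_ e2
    rw [← e1]; rfl
  have hfm2 : p0 Q (algebraMap _ Ω (j (sE k))) (algebraMap _ Ω (j (tE k))) = (p0 Q (sE k) (tE k)).map ((algebraMap (LaurentSeries κ) Ω).comp (j : E0 k →+* LaurentSeries κ)) := by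
    rw [← Polynomial.map_map, p0_map Q j]
    exact (p0_map Q (IsScalarTower.toAlgHom k (LaurentSeries κ) Ω) (j (sE k)) (j (tE k))).symm
  let cc : PowerSeries κ →ₐ[k] κ := { (PowerSeries.constantCoeff : PowerSeries κ →+* κ) with commutes' := fun a => (show PowerSeries.constantCoeff (algebraMap k (PowerSeries κ) a) = _ by
        simp [PowerSeries.algebraMap_apply]) }
  have hcc : ((p0 Q S T).map PowerSeries.constantCoeff) = (p0 Q s0 t0).map (algebraMap k κ) := by
    have e1 := p0_map Q cc S T
    have e2 := p0_map Q (Algebra.ofId k κ) s0 t0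
    refine Eq.trans e1 (Eq.trans ?_ e2.symm)
    have : cc S = algebraMap k κ s0 := by show PowerSeries.constantCoeff S = _; rw [hS]; simp
    rw [this]
    have : cc T = algebraMap k κ t0 := by show PowerSeries.constantCoeff T = _; rw [hTdef]; simp
    rw [this]; rfl
  have hdeg := p0_deg Q hQ S T
  have hlc : PowerSeries.constantCoeff ((p0 Q S T).coeff d) ≠ 0 := by
    rw [← Polynomial.coeff_map, hcc, Polynomial.coeff_map, (p0_deg Q hQ s0 t0).2]
    simpa using hT.lead
  have hnd : (p0 Q S T).natDegree = d := le_antisymm hdeg.1 (Polynomial.le_natDegree_of_ne_zero (fun h => hlc (by rw [h, map_zero])))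
  have hev : ∀ (g : Polynomial k) (a : k), (g.map (algebraMap k κ)).eval (algebraMap k κ a) = algebraMap k κ (g.eval a) := by
    intro g a; rw [Polynomial.eval_map_apply]
  obtain ⟨ϕ, r1, r2, hr, hr1, hr2, hp1, hp2, hfix⟩ := swap_abs (κ := κ) (n := d - 2) (p0 Q S T) (by rw [hnd]; omega)
    (by rw [Polynomial.leadingCoeff, hnd]; exact hlc) (fun i => algebraMap k κ (ρ i)) (fun a b h => hT.inj ((algebraMap k κ).injective h))
    (fun i => by rw [hcc, hev, hT.root, map_zero])
    (fun i => by rw [hcc, Polynomial.derivative_map, hev]; simpa using hT.simp i) (algebraMap k κ ρ0)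
    (by rw [hcc, hev, hT.root0, map_zero]) (by rw [hcc, Polynomial.derivative_map, hev, hT.dbl, map_zero])
    (by
      have e := coeff_one_aux (pl Q (![1, ρ0, s0 + ρ0 * t0] : Fin 3 → k) (![0,0,1] : Fin 3 → k)) (algebraMap k κ ρ0 - c)
      have e2 := pl_eval2 Q (![1, ρ0, s0 + ρ0 * t0] : Fin 3 → k) (![0,0,1] : Fin 3 → k) (Algebra.ofId k (PowerSeries κ)) (PowerSeries.C (algebraMap k κ ρ0 - c) * PowerSeries.X)
      have hk : ∀ a, Algebra.ofId k (PowerSeries κ) a = PowerSeries.C (algebraMap k κ a) := fun a => by rw [Algebra.ofId_apply, PowerSeries.algebraMap_apply]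
      have e3 : (p0 Q S T).eval (PowerSeries.C (algebraMap k κ ρ0)) = (pl Q (![1, ρ0, s0 + ρ0 * t0] : Fin 3 → k) (![0,0,1] : Fin 3 → k)).eval₂ (algebraMap k (PowerSeries κ)) (PowerSeries.C (algebraMap k κ ρ0 - c) * PowerSeries.X) := by
        refine Eq.trans ?_ e2.symm
        rw [p0_eval]
        congr 2; funext i; fin_cases i
        · simp
        · simp [hk]
        · simp [hk, hS, hTdef]; ring
      rw [e3, e]
      refine mul_ne_zero ?_ (sub_ne_zero.2 (hcn ρ0).symm)
      rw [Ne, FaithfulSMul.algebraMap_eq_zero_iff, pl_derivative, Polynomial.eval_finset_sum]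
      simp only [Polynomial.eval_mul, Polynomial.eval_C, pl_eval, Fin.sum_univ_three]
      simpa using hT.tr)
    (by rw [hfm, hfm2]; exact hsep0.map)
  rw [hfm] at hr1 hr2
  rw [hfm] at hfix
  obtain ⟨α1, ha1, hi1⟩ := i3 r1 ((p0_rt Q _ _ _).1 hr1)
  obtain ⟨α2, ha2, hi2⟩ := i3 r2 ((p0_rt Q _ _ _).1 hr2)
  obtain ⟨g, hg⟩ := i2 ϕ
  have inj : ∀ a b : L, ι a = ι b → a = b := fun a b h => ι.toRingHom.injective h
  refine ⟨α1, α2, g, ha1, ha2, ?_, ?_, ?_, ?_⟩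
  · rintro rfl; exact hr (hi1.symm.trans hi2)
  · apply inj; rw [hg, hi1, hi2, hp1]
  · apply inj; rw [hg, hi1, hi2, hp2]
  · intro α ha hn1 hn2
    apply inj
    rw [hg]
    refine hfix _ (fun h => hn1 (inj _ _ (h.trans hi1.symm))) (fun h => hn2 (inj _ _ (h.trans hi2.symm))) ?_
    rw [p0_rt]
    have := rt_map Q ι _ _ _ ha
    rwa [i1, i1] at this

include hd hQ h1 hirr hs hne hT in
theorem u1 (τ : Equiv.Perm {α : L // Rt Q (algebraMap _ L (sE k)) (algebraMap _ L (tE k)) α}) :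
    ∃ g : L ≃ₐ[E0 k] L, ∀ α : {α : L // Rt Q (algebraMap _ L (sE k)) (algebraMap _ L (tE k)) α}, g (α : L) = τ α := by
  classical
  revert τ
  set R := {α : L // Rt Q (algebraMap _ L (sE k)) (algebraMap _ L (tE k)) α} with hR
  have hn0 : p0 Q (algebraMap _ L (sE k)) (algebraMap _ L (tE k)) ≠ 0 := by
    rw [← p0L Q L hs]; exact (Polynomial.map_ne_zero_iff (algebraMap (E0 k) L).injective).2 hne
  intro τ
  haveI : Finite R := by
    have : Set.Finite {α : L | Rt Q (algebraMap _ L (sE k)) (algebraMap _ L (tE k)) α} := by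
      refine Set.Finite.subset (Finset.finite_toSet (p0 Q (algebraMap _ L (sE k)) (algebraMap _ L (tE k))).roots.toFinset) ?_
      intro α ha
      simp only [Finset.mem_coe, Multiset.mem_toFinset]
      exact (Polynomial.mem_roots hn0).2 ((p0_rt Q _ _ _).2 ha)
    exact this.to_subtype
  letI : MulAction (L ≃ₐ[E0 k] L) R :=
    { smul := fun g α => ⟨g α.1, rt_g Q L g α.2⟩
      one_smul := fun α => rfl
      mul_smul := fun g h α => rfl }
  have hsm : ∀ (g : L ≃ₐ[E0 k] L) (α : R), ((g • α : R) : L) = g α := fun g α => rfl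
  obtain ⟨α0, ha0, -, hst⟩ := u1_stab Q hd hQ h1 hirr hT L hs hne
  obtain ⟨α1, α2, g0, ha1, ha2, hn, hg1, hg2, hg3⟩ := u1_swap Q hd hQ h1 hirr hT L hs hne
  obtain ⟨g, hg⟩ := perm_all (G := L ≃ₐ[E0 k] L) (α := R)
    (fun x y => by
      obtain ⟨g, hg⟩ := u1_trans Q hd hQ h1 hirr L hs hne x.1 y.1 x.2 y.2
      exact ⟨g, Subtype.ext hg⟩) ⟨α0, ha0⟩
    (fun x y hx hy => by
      obtain ⟨g, hg, hg'⟩ := hst x.1 y.1 x.2 y.2 (fun h => hx (Subtype.ext h)) (fun h => hy (Subtype.ext h))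
      exact ⟨g, Subtype.ext hg, Subtype.ext hg'⟩) g0 ⟨α1, ha1⟩ ⟨α2, ha2⟩ (fun h => hn (congrArg Subtype.val h))
    (fun x => by
      apply Subtype.ext
      rw [hsm]
      by_cases hx1 : x = ⟨α1, ha1⟩
      · rw [hx1, Equiv.swap_apply_left]; exact hg1
      by_cases hx2 : x = ⟨α2, ha2⟩
      · rw [hx2, Equiv.swap_apply_right]; exact hg2
      rw [Equiv.swap_apply_of_ne_of_ne hx1 hx2]
      exact hg3 _ x.2 (fun h => hx1 (Subtype.ext h)) (fun h => hx2 (Subtype.ext h))) τ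
  exact ⟨g, fun α => congrArg Subtype.val (hg α)⟩
end
end IncAux

namespace IncAux

/-- embedding of power series in Laurent series over the base field -/
noncomputable def amk (k κ : Type) [Field k] [Field κ] [Algebra k κ] : PowerSeries κ →ₐ[k] LaurentSeries κ :=
  { algebraMap (PowerSeries κ) (LaurentSeries κ) with commutes' := fun _ => rfl }

section
variable {k κ : Type} [Field k] [Field κ] [Algebra k κ]

lemma amk_apply (f : PowerSeries κ) : amk k κ f = HahnSeries.ofPowerSeries ℤ κ f := rfl
lemma amk_inj : Function.Injective (amk k κ) := HahnSeries.ofPowerSeries_injective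
lemma amk_C (a : κ) : amk k κ (PowerSeries.C a) = algebraMap κ (LaurentSeries κ) a := rfl
lemma amk_XV : amk k κ PowerSeries.X * V κ = 1 := by
  have : amk k κ PowerSeries.X = HahnSeries.single 1 1 := HahnSeries.ofPowerSeries_X
  rw [this, V, HahnSeries.single_mul_single]; simp
lemma V_ne : V κ ≠ 0 := by rw [V]; simp
lemma amk_ow (f : PowerSeries κ) : (0 : WithTop ℤ) ≤ ow κ (amk k κ f) := by
  refine le_ow_of_coeff (n := 0) (fun m hm => ?_)
  rw [amk_apply, HahnSeries.ofPowerSeries_apply]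
  apply HahnSeries.embDomain_notin_range
  rintro ⟨n, hn⟩
  simp at hn; omega
lemma amk_coeff (f : PowerSeries κ) (n : ℕ) : (amk k κ f).coeff n = PowerSeries.coeff n f := by
  rw [amk_apply]; exact HahnSeries.ofPowerSeries_apply_coeff _ _

end

structure HR {k A : Type} [Field k] [CommRing A] [Algebra k A] {d : ℕ} (Q : MvPolynomial (Fin 3) k) (ρ : Fin d → k) (c : A)
    (R : Fin d → PowerSeries A) : Prop where
  root : ∀ i, Rt Q (-(PowerSeries.C c * PowerSeries.X)) PowerSeries.X (R i)
  const : ∀ i, PowerSeries.constantCoeff (R i) = algebraMap k A (ρ i)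

noncomputable def gT {k κ : Type} [Field k] [Field κ] [Algebra k κ] (Q : MvPolynomial (Fin 3) k) (c : κ) : Polynomial (Polynomial κ) :=
  Polynomial.C (Polynomial.C (MvPolynomial.aeval (![1, c, 0] : Fin 3 → κ) Q)⁻¹) * pl Q ![0, Polynomial.X, 1] ![1, Polynomial.C c, 0]

noncomputable def uu {A : Type} [CommRing A] {d : ℕ} (c : A) (R : Fin d → PowerSeries A) (i : Fin d) : PowerSeries A :=
  PowerSeries.C c - R i

noncomputable def xi {κ : Type} [Field κ] {d : ℕ} (c : κ) (R : Fin d → PowerSeries κ) (i : Fin d) : LaurentSeries κ :=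
  - V κ * (amk κ κ (uu c R i))⁻¹

noncomputable def ll {k : Type} (A : Type) [Field k] [CommRing A] [Algebra k A] (Q : MvPolynomial (Fin 3) k) : PowerSeries A :=
  MvPolynomial.aeval (![0, 1, PowerSeries.X] : Fin 3 → PowerSeries A) Q

open Classical in
noncomputable def ZZ {k A : Type} [Field k] [CommRing A] [Algebra k A] {d : ℕ} (Q : MvPolynomial (Fin 3) k) (c : A)
    (R : Fin d → PowerSeries A) (H : Subgroup (Equiv.Perm (Fin d))) (e : Fin d → Fin d) : PowerSeries A :=
  ll A Q ^ d * ∑ τ : Equiv.Perm (Fin d), if τ ∈ H then ∏ i, uu c R (τ i) ^ (d - (e i : ℕ)) else 0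

open Classical in
noncomputable def YY {B : Type} [CommRing B] {d : ℕ} (y : Fin d → B) (H : Subgroup (Equiv.Perm (Fin d))) (e : Fin d → Fin d) : B :=
  ∑ τ : Equiv.Perm (Fin d), if τ ∈ H then ∏ i, y (τ i) ^ (e i : ℕ) else 0

section
variable {k κ : Type} [Field k] [Field κ] [Algebra k κ] {d : ℕ} {Q : MvPolynomial (Fin 3) k} (hd : 2 ≤ d)
  (hQ : Q.IsHomogeneous d) {ρ : Fin d → k} (hρ : Function.Injective ρ) {c : κ} {R : Fin d → PowerSeries κ} (hR : HR Q ρ c R)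
  (hc : ∀ i, c ≠ algebraMap k κ (ρ i)) (hl : MvPolynomial.aeval (![0, 1, 0] : Fin 3 → k) Q ≠ 0)

include hR hc in
lemma uu_const (i : Fin d) : PowerSeries.constantCoeff (uu c R i) ≠ 0 := by
  rw [uu, map_sub, hR.const]; simpa [sub_ne_zero] using hc i

include hR hρ in
lemma R_inj : Function.Injective R := fun i j h => hρ ((algebraMap k κ).injective (by rw [← hR.const, ← hR.const, h]))

include hR hc in
lemma uu_ne (i : Fin d) : amk κ κ (uu c R i) ≠ 0 := by
  intro h
  have := amk_inj (h.trans (map_zero _).symm)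
  exact uu_const hR hc i (by rw [this, map_zero])

include hR hc hρ in
lemma xi_inj : Function.Injective (xi c R) := by
  intro i j h
  simp only [xi] at h
  have h2 := mul_left_cancel₀ (neg_ne_zero.2 V_ne) h
  have h3 := amk_inj (inv_injective h2)
  simp only [uu, sub_right_inj] at h3
  exact R_inj hρ hR h3

include hR hc in
lemma xi_ord (i : Fin d) : ((-1 : ℤ) : WithTop ℤ) ≤ ow κ (xi c R i) := by
  have e : xi c R i = - (V κ * amk κ κ (uu c R i)⁻¹) := by
    rw [xi, neg_mul]
    congr 2
    rw [eq_comm]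
    apply eq_inv_of_mul_eq_one_left
    rw [← map_mul, PowerSeries.inv_mul_cancel _ (uu_const hR hc i), map_one]
  rw [e, AddValuation.map_neg, AddValuation.map_mul, ow_V]
  calc ((-1 : ℤ) : WithTop ℤ) = ((-1 : ℤ) : WithTop ℤ) + 0 := by simp
    _ ≤ _ := by gcongr; exact amk_ow _

include hR hc in
lemma xi_eq (i : Fin d) : xi c R i * (amk κ κ (R i) - algebraMap κ _ c) = V κ := by
  have h := uu_ne hR hc i
  have e : amk κ κ (R i) - algebraMap κ _ c = - amk κ κ (uu c R i) := by
    rw [uu, map_sub, amk_C]; ring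
  rw [e, xi]; field_simp

include hQ hR hρ hl in
lemma p0_fac : p0 Q (-(PowerSeries.C c * PowerSeries.X)) PowerSeries.X =
    Polynomial.C (ll κ Q) * ∏ i, (Polynomial.X - Polynomial.C (R i)) := by
  have hdeg := p0_deg Q hQ (-(PowerSeries.C c * PowerSeries.X)) (PowerSeries.X : PowerSeries κ)
  have hll : ll κ Q ≠ 0 := by
    intro h
    let cc : PowerSeries κ →ₐ[k] κ := { (PowerSeries.constantCoeff : PowerSeries κ →+* κ) with commutes' := fun a => (show PowerSeries.constantCoeff (algebraMap k (PowerSeries κ) a) = _ by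
        simp [PowerSeries.algebraMap_apply]) }
    have h2 := congrArg cc h
    rw [ll, aeval_map_alg, map_zero] at h2
    have h3 := aeval_map_alg Q (Algebra.ofId k κ) (![0, 1, 0] : Fin 3 → k)
    apply hl
    apply (algebraMap k κ).injective
    rw [map_zero]
    refine Eq.trans h3 (Eq.trans ?_ h2)
    congr 2; funext i; fin_cases i
    · simp
    · simp
    · show (Algebra.ofId k κ) 0 = PowerSeries.constantCoeff PowerSeries.X
      simp
  set f := p0 Q (-(PowerSeries.C c * PowerSeries.X)) (PowerSeries.X : PowerSeries κ) with hf
  have hf0 : f ≠ 0 := by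
    intro h; rw [h] at hdeg; exact hll hdeg.2.symm
  obtain ⟨e, he⟩ := prod_dvd_of_roots f hf0 R (R_inj hρ hR) (fun i => (p0_rt Q _ _ _).2 (hR.root i))
  set D := ∏ i, (Polynomial.X - Polynomial.C (R i)) with hD
  have hDm : D.Monic := Polynomial.monic_prod_of_monic _ _ (fun i _ => Polynomial.monic_X_sub_C _)
  have hDd : D.natDegree = d := by
    rw [hD, Polynomial.natDegree_prod_of_monic _ _ (fun i _ => Polynomial.monic_X_sub_C _)]; simp
  have he0 : e ≠ 0 := by rintro rfl; simp at he; exact hf0 he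
  have hed : e.natDegree = 0 := by
    have := hDm.natDegree_mul' he0
    rw [← he, hDd] at this; omega
  rw [Polynomial.eq_C_of_natDegree_eq_zero hed] at he
  have h4 := hdeg.2
  rw [he, Polynomial.coeff_mul_C] at h4
  have h5 : D.coeff d = 1 := by rw [← hDd]; exact hDm
  rw [h5, one_mul] at h4
  rw [he, h4, mul_comm]; rfl

include hQ hR hρ hl in
lemma delta_fac : PowerSeries.C (MvPolynomial.aeval (![1, c, 0] : Fin 3 → κ) Q) = ll κ Q * ∏ i, uu c R i := by
  have h := congrArg (Polynomial.eval (PowerSeries.C c)) (p0_fac hQ hρ hR hl)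
  rw [p0_eval, Polynomial.eval_mul, Polynomial.eval_C, Polynomial.eval_prod] at h
  simp only [Polynomial.eval_sub, Polynomial.eval_X, Polynomial.eval_C] at h
  simp only [uu]
  rw [← h]
  let CC : κ →ₐ[k] PowerSeries κ := IsScalarTower.toAlgHom k κ (PowerSeries κ)
  refine Eq.trans (aeval_map_alg Q CC _) ?_
  congr 2; funext i; fin_cases i
  · simp [CC]
  · rfl
  · simp

include hQ hR hρ hl hc in
lemma delta_ne : MvPolynomial.aeval (![1, c, 0] : Fin 3 → κ) Q ≠ 0 := by
  intro h
  have h2 := delta_fac hQ hρ hR hl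
  rw [h, map_zero] at h2
  have hlc : PowerSeries.constantCoeff (ll κ Q) ≠ 0 := by
    intro h
    let cc : PowerSeries κ →ₐ[k] κ := { (PowerSeries.constantCoeff : PowerSeries κ →+* κ) with commutes' := fun a => (show PowerSeries.constantCoeff (algebraMap k (PowerSeries κ) a) = _ by
        simp [PowerSeries.algebraMap_apply]) }
    have h2 : cc (ll κ Q) = 0 := h
    rw [ll, aeval_map_alg] at h2
    have h3 := aeval_map_alg Q (Algebra.ofId k κ) (![0, 1, 0] : Fin 3 → k)
    apply hl
    apply (algebraMap k κ).injective
    rw [map_zero]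
    refine Eq.trans h3 (Eq.trans ?_ h2)
    congr 2; funext i; fin_cases i
    · simp
    · simp
    · show (Algebra.ofId k κ) 0 = PowerSeries.constantCoeff PowerSeries.X
      simp
  have h3 := congrArg PowerSeries.constantCoeff h2
  rw [map_zero, map_mul, map_prod, eq_comm, mul_eq_zero, Finset.prod_eq_zero_iff] at h3
  rcases h3 with h3 | ⟨i, -, h3⟩
  · exact hlc h3
  · exact uu_const hR hc i h3

include hQ hR hρ hl hc in
lemma gT_monic : (gT Q c).Monic ∧ (gT Q c).natDegree = d := by
  have hδ := delta_ne hQ hρ hR hc hl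
  have hdeg := pl_deg Q hQ (![0, Polynomial.X, 1] : Fin 3 → Polynomial κ) (![1, Polynomial.C c, 0] : Fin 3 → Polynomial κ)
  have h2 : MvPolynomial.aeval (![1, Polynomial.C c, 0] : Fin 3 → Polynomial κ) Q = Polynomial.C (MvPolynomial.aeval (![1, c, 0] : Fin 3 → κ) Q) := by
    refine Eq.trans ?_ (aeval_map_alg Q (IsScalarTower.toAlgHom k κ (Polynomial κ)) _).symm
    congr 2; funext i; fin_cases i
    · simp
    · rfl
    · simp
  rw [h2] at hdeg
  have hcoef : (gT Q c).coeff d = 1 := by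
    rw [gT, Polynomial.coeff_C_mul, hdeg.2, ← map_mul, inv_mul_cancel₀ hδ, map_one]
  have hle : (gT Q c).natDegree ≤ d := (Polynomial.natDegree_C_mul_le _ _).trans hdeg.1
  have hmon := Polynomial.monic_of_natDegree_le_of_coeff_eq_one d hle hcoef
  refine ⟨hmon, le_antisymm hle (Polynomial.le_natDegree_of_ne_zero (by rw [hcoef]; exact one_ne_zero))⟩

lemma gT_eval {S : Type} [CommRing S] [Algebra κ S] [Algebra k S] [IsScalarTower k κ S] (v x : S) :
    ((gT Q c).map (Polynomial.aeval v : Polynomial κ →ₐ[κ] S).toRingHom).eval x =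
      algebraMap κ S (MvPolynomial.aeval (![1, c, 0] : Fin 3 → κ) Q)⁻¹ *
        MvPolynomial.aeval (![x, v + x * algebraMap κ S c, 1] : Fin 3 → S) Q := by
  rw [gT, Polynomial.map_mul, Polynomial.eval_mul, Polynomial.map_C, Polynomial.eval_C]
  congr 1
  · simp
  · rw [Polynomial.eval_map]
    have := pl_eval2 Q (![0, Polynomial.X, 1] : Fin 3 → Polynomial κ) (![1, Polynomial.C c, 0] : Fin 3 → Polynomial κ)
      ((Polynomial.aeval v : Polynomial κ →ₐ[κ] S).restrictScalars k) x
    refine Eq.trans this ?_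
    congr 2; funext i; fin_cases i <;> simp

lemma towerL : @IsScalarTower k κ (LaurentSeries κ) Algebra.toSMul Algebra.toSMul Algebra.toSMul :=
  IsScalarTower.of_algebraMap_eq (fun x => by
    rw [algL, HahnSeries.algebraMap_apply', PowerSeries.algebraMap_apply]; simp [HahnSeries.ofPowerSeries_C])

include hQ hR hρ hl hc in
lemma xi_spl : Spl (gT Q c) (V κ) (xi c R) := by
  have hm := gT_monic hQ hρ hR hc hl
  have tower := towerL (k := k) (κ := κ)
  refine eq_prod_of_roots _ (hm.1.map _) ((hm.1.natDegree_map _).trans hm.2) _ (xi_inj hρ hR hc) (fun i => ?_)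
  rw [gT_eval]
  have h := rt_map Q (amk k κ) _ _ _ (hR.root i)
  rw [Rt] at h
  have hs := hom_scale Q hQ (xi c R i) (![1, amk k κ (R i), amk k κ (-(PowerSeries.C c * PowerSeries.X)) + amk k κ (R i) * amk k κ PowerSeries.X] : Fin 3 → LaurentSeries κ)
  rw [h, mul_zero] at hs
  rw [mul_eq_zero]; right
  refine Eq.trans ?_ hs
  have hx := xi_eq hR hc i
  have hXV := amk_XV (k := k) (κ := κ)
  have e : amk κ κ (R i) = amk k κ (R i) := rfl
  rw [e] at hx
  congr 2; funext j; fin_cases j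
  · simp
  · show V κ + xi c R i * algebraMap κ _ c = xi c R i * amk k κ (R i)
    linear_combination -hx
  · show (1 : LaurentSeries κ) = xi c R i * (amk k κ (-(PowerSeries.C c * PowerSeries.X)) + amk k κ (R i) * amk k κ PowerSeries.X)
    rw [map_neg, map_mul, amk_C]
    linear_combination -hXV - amk k κ PowerSeries.X * hx

include hQ hR hρ hl hc in
lemma YZ (H : Subgroup (Equiv.Perm (Fin d))) (e : Fin d → Fin d) :
    algebraMap κ _ (MvPolynomial.aeval (![1, c, 0] : Fin 3 → κ) Q) ^ d * YY (xi c R) H e =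
      (-V κ) ^ (∑ i, (e i : ℕ)) * amk κ κ (ZZ Q c R H e) := by
  classical
  rw [← amk_C (k := κ), delta_fac hQ hρ hR hl, YY, ZZ]
  simp only [map_mul, map_pow, map_sum, map_prod, Finset.mul_sum]
  apply Finset.sum_congr rfl
  intro τ _
  split_ifs
  · rw [map_prod]
    have h1 : ∏ i, amk κ κ (uu c R i) = ∏ i, amk κ κ (uu c R (τ i)) := (Equiv.prod_comp τ (fun i => amk κ κ (uu c R i))).symm
    rw [h1, mul_pow, mul_left_comm, mul_assoc]
    congr 1
    rw [← Finset.prod_pow_eq_pow_sum, ← Finset.prod_pow, ← Finset.prod_mul_distrib, ← Finset.prod_mul_distrib]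
    apply Finset.prod_congr rfl
    intro i _
    have hne := uu_ne hR hc (τ i)
    have hlt := (e i).2
    have h3 : amk κ κ (uu c R (τ i)) ^ d = amk κ κ (uu c R (τ i)) ^ (d - (e i : ℕ)) * amk κ κ (uu c R (τ i)) ^ (e i : ℕ) := by
      rw [← pow_add]; congr 1; omega
    rw [xi, h3, mul_pow, map_pow, inv_pow]
    field_simp
  · simp
end
end IncAux

namespace IncAux

def Dg {k : Type} [Field k] (a : ℕ) (f : PowerSeries (Polynomial k)) : Prop :=
  ∀ m, (PowerSeries.coeff m f).natDegree ≤ m + a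

section
variable {k : Type} [Field k]

lemma Dg.mul {a b : ℕ} {f g : PowerSeries (Polynomial k)} (hf : Dg a f) (hg : Dg b g) : Dg (a + b) (f * g) := by
  intro m
  rw [PowerSeries.coeff_mul]
  apply Polynomial.natDegree_sum_le_of_forall_le
  intro p hp
  have hp : p.1 + p.2 = m := Finset.HasAntidiagonal.mem_antidiagonal.1 hp
  have h1 := hf p.1
  have h2 := hg p.2
  have h3 := Polynomial.natDegree_mul_le (p := PowerSeries.coeff p.1 f) (q := PowerSeries.coeff p.2 g)
  omega

lemma Dg.mono {a b : ℕ} {f : PowerSeries (Polynomial k)} (hf : Dg a f) (h : a ≤ b) : Dg b f := fun m => (hf m).trans (by omega)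

lemma Dg.add {a : ℕ} {f g : PowerSeries (Polynomial k)} (hf : Dg a f) (hg : Dg a g) : Dg a (f + g) := by
  intro m; rw [map_add]; exact Polynomial.natDegree_add_le_of_degree_le (hf m) (hg m)

lemma Dg.neg {a : ℕ} {f : PowerSeries (Polynomial k)} (hf : Dg a f) : Dg a (-f) := by
  intro m; rw [map_neg, Polynomial.natDegree_neg]; exact hf m

lemma Dg.C (p : Polynomial k) : Dg p.natDegree (PowerSeries.C p) := by
  intro m; rw [PowerSeries.coeff_C]; split_ifs <;> simp

lemma Dg.X : Dg 0 (PowerSeries.X : PowerSeries (Polynomial k)) := by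
  intro m; rw [PowerSeries.coeff_X]; split_ifs <;> simp

lemma Dg.one : Dg 0 (1 : PowerSeries (Polynomial k)) := by
  intro m; rw [PowerSeries.coeff_one]; split_ifs <;> simp

lemma Dg.CX : Dg 0 (PowerSeries.C (Polynomial.X : Polynomial k) * PowerSeries.X) := by
  intro m
  rw [PowerSeries.coeff_C_mul, PowerSeries.coeff_X]
  split_ifs with h
  · simp [h]
  · simp

lemma Dg.pow {a : ℕ} {f : PowerSeries (Polynomial k)} (hf : Dg a f) (n : ℕ) : Dg (n * a) (f ^ n) := by
  induction n with
  | zero => simpa using Dg.one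
  | succ n ih => rw [pow_succ, add_mul, one_mul]; exact ih.mul hf

lemma Dg.prod {ι : Type} (s : Finset ι) (a : ℕ) (f : ι → PowerSeries (Polynomial k)) (hf : ∀ i, Dg a (f i)) : Dg (s.card * a) (∏ i ∈ s, f i) := by
  classical
  induction s using Finset.induction with
  | empty => simpa using Dg.one
  | insert i s hi ih => rw [Finset.prod_insert hi, Finset.card_insert_of_notMem hi]; exact ((hf i).mul ih).mono (by ring_nf; omega)

lemma Dg.sum {ι : Type} (s : Finset ι) (a : ℕ) (f : ι → PowerSeries (Polynomial k)) (hf : ∀ i, Dg a (f i)) : Dg a (∑ i ∈ s, f i) := by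
  intro m; rw [map_sum]
  apply Polynomial.natDegree_sum_le_of_forall_le
  intro i _; exact hf i m

noncomputable def Bd (k : Type) [Field k] : Subalgebra k (PowerSeries (Polynomial k)) where
  carrier := {f | Dg 0 f}
  mul_mem' := fun a b => a.mul b
  add_mem' := fun a b => a.add b
  algebraMap_mem' := fun a => by
    have := Dg.C (Polynomial.C a : Polynomial k)
    rw [Polynomial.natDegree_C] at this
    rw [PowerSeries.algebraMap_apply]
    exact this

lemma mem_Bd (f : PowerSeries (Polynomial k)) : f ∈ Bd k ↔ Dg 0 f := Iff.rfl

lemma aeval_mem_Bd (Q : MvPolynomial (Fin 3) k) (x : Fin 3 → PowerSeries (Polynomial k)) (h : ∀ i, Dg 0 (x i)) : Dg 0 (MvPolynomial.aeval x Q) := by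
  have := aeval_map_alg Q (Bd k).val (fun i => (⟨x i, h i⟩ : Bd k))
  rw [← mem_Bd]
  have e : MvPolynomial.aeval x Q = (Bd k).val (MvPolynomial.aeval (fun i => (⟨x i, h i⟩ : Bd k)) Q) := this.symm
  rw [e]; exact Subtype.property _

lemma pl_mem_Bd (Q : MvPolynomial (Fin 3) k) (a b : Fin 3 → PowerSeries (Polynomial k)) (ha : ∀ i, Dg 0 (a i)) (hb : ∀ i, Dg 0 (b i)) (n : ℕ) :
    Dg 0 ((pl Q a b).coeff n) := by
  have := pl_map Q (fun i => (⟨a i, ha i⟩ : Bd k)) (fun i => (⟨b i, hb i⟩ : Bd k)) (Bd k).val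
  have e : pl Q a b = (pl Q (fun i => (⟨a i, ha i⟩ : Bd k)) (fun i => (⟨b i, hb i⟩ : Bd k))).map ((Bd k).val : Bd k →+* _) := this.symm
  rw [e, Polynomial.coeff_map, ← mem_Bd]; exact Subtype.property _

lemma exists_R {d : ℕ} (Q : MvPolynomial (Fin 3) k) (ρ : Fin d → k) (h0 : ∀ i, (p0 Q (0:k) 0).eval (ρ i) = 0)
    (h1 : ∀ i, (p0 Q (0:k) 0).derivative.eval (ρ i) ≠ 0) :
    ∃ R : Fin d → PowerSeries (Polynomial k), HR Q ρ Polynomial.X R ∧ ∀ i, Dg 0 (R i) := by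
  set G := p0 Q (-(PowerSeries.C (Polynomial.X : Polynomial k) * PowerSeries.X)) (PowerSeries.X : PowerSeries (Polynomial k)) with hG
  let cc : PowerSeries (Polynomial k) →ₐ[k] Polynomial k := { (PowerSeries.constantCoeff : PowerSeries (Polynomial k) →+* Polynomial k) with commutes' := fun a => (show PowerSeries.constantCoeff (algebraMap k (PowerSeries (Polynomial k)) a) = _ by
        simp [PowerSeries.algebraMap_apply]) }
  have hGc : G.map PowerSeries.constantCoeff = (p0 Q (0:k) 0).map (Polynomial.C) := by
    have e1 := p0_map Q cc (-(PowerSeries.C (Polynomial.X : Polynomial k) * PowerSeries.X)) (PowerSeries.X : PowerSeries (Polynomial k))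
    have e2 := p0_map Q (Algebra.ofId k (Polynomial k)) 0 0
    refine Eq.trans e1 (Eq.trans ?_ e2.symm)
    have : cc (-(PowerSeries.C (Polynomial.X : Polynomial k) * PowerSeries.X)) = 0 := by
      show PowerSeries.constantCoeff _ = _; simp
    rw [this]
    have : cc PowerSeries.X = 0 := by
      show PowerSeries.constantCoeff _ = _; simp
    rw [this, map_zero]
  have hev : ∀ (g : Polynomial k) (a : k), (g.map Polynomial.C).eval (Polynomial.C a) = Polynomial.C (g.eval a) := by
    intro g a; rw [Polynomial.eval_map_apply]
  choose R hR1 hR2 hR3 using fun i => hensel G (Polynomial.C (ρ i)) (Polynomial.C ((p0 Q (0:k) 0).derivative.eval (ρ i))⁻¹)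
    (by rw [hGc, hev, h0, map_zero]) (by rw [hGc, Polynomial.derivative_map, hev, ← map_mul, inv_mul_cancel₀ (h1 i), map_one])
  refine ⟨R, ⟨fun i => (p0_rt Q _ _ _).1 (hR1 i), hR2⟩, fun i m => ?_⟩
  have hC : ∀ a : k, PowerSeries.C (Polynomial.C a) ∈ (Bd k).toSubring := by
    intro a
    have := Dg.C (Polynomial.C a : Polynomial k)
    rw [Polynomial.natDegree_C] at this
    exact this
  obtain ⟨b, hb, hbe⟩ := hR3 i (Bd k).toSubring (fun n => by
    show Dg 0 (G.coeff n)
    apply pl_mem_Bd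
    · intro j; fin_cases j
      · exact Dg.one
      · exact (Bd k).zero_mem
      · exact Dg.CX.neg
    · intro j; fin_cases j
      · exact (Bd k).zero_mem
      · exact Dg.one
      · exact Dg.X) (hC _) (hC _) m
  rw [hbe m le_rfl]
  exact hb m

lemma Z_deg {d : ℕ} (Q : MvPolynomial (Fin 3) k) (R : Fin d → PowerSeries (Polynomial k)) (hR : ∀ i, Dg 0 (R i))
    (H : Subgroup (Equiv.Perm (Fin d))) (e : Fin d → Fin d) : Dg (d * d) (ZZ Q Polynomial.X R H e) := by
  classical
  have hu : ∀ i, Dg 1 (uu Polynomial.X R i) := by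
    intro i
    rw [uu, sub_eq_add_neg]
    have := Dg.C (Polynomial.X : Polynomial k)
    rw [Polynomial.natDegree_X] at this
    exact this.add ((hR i).neg.mono (by omega))
  have hl : Dg 0 (ll (Polynomial k) Q) := by
    apply aeval_mem_Bd
    intro j; fin_cases j
    · exact (Bd k).zero_mem
    · exact Dg.one
    · exact Dg.X
  have h1 := hl.pow d
  rw [mul_zero] at h1
  rw [ZZ]
  have h2 : Dg (d * d) (∑ τ : Equiv.Perm (Fin d), if τ ∈ H then ∏ i, uu Polynomial.X R (τ i) ^ (d - (e i : ℕ)) else 0) := by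
    apply Dg.sum
    intro τ
    split_ifs
    · have := Dg.prod Finset.univ d (fun i => uu Polynomial.X R (τ i) ^ (d - (e i : ℕ))) (fun i => ((hu (τ i)).pow _).mono (by omega))
      simpa using this
    · intro m; simp
  have := h1.mul h2
  rwa [zero_add] at this

variable {A A' : Type} [CommRing A] [Algebra k A] [CommRing A'] [Algebra k A']

lemma mAH_C (f : A →ₐ[k] A') (a : A) : PowerSeries.mapAlgHom f (PowerSeries.C a) = PowerSeries.C (f a) :=
  PowerSeries.map_C (f : A →+* A') a

lemma mAH_X (f : A →ₐ[k] A') : PowerSeries.mapAlgHom f (PowerSeries.X : PowerSeries A) = PowerSeries.X :=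
  PowerSeries.map_X (f : A →+* A')

lemma HR.map {d : ℕ} {Q : MvPolynomial (Fin 3) k} {ρ : Fin d → k} {c : A} {R : Fin d → PowerSeries A} (h : HR Q ρ c R) (f : A →ₐ[k] A') :
    HR Q ρ (f c) (fun i => PowerSeries.mapAlgHom f (R i)) := by
  constructor
  · intro i
    have := rt_map Q (PowerSeries.mapAlgHom f) _ _ _ (h.root i)
    simpa [mAH_C, mAH_X] using this
  · intro i
    have h2 : PowerSeries.constantCoeff (PowerSeries.map (f : A →+* A') (R i)) = f (PowerSeries.constantCoeff (R i)) := by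
      rw [← PowerSeries.coeff_zero_eq_constantCoeff_apply, PowerSeries.coeff_map]; simp
    refine Eq.trans h2 ?_
    rw [h.const]; simp

lemma ZZ_map {d : ℕ} (Q : MvPolynomial (Fin 3) k) (c : A) (R : Fin d → PowerSeries A) (f : A →ₐ[k] A')
    (H : Subgroup (Equiv.Perm (Fin d))) (e : Fin d → Fin d) (m : ℕ) :
    PowerSeries.coeff m (ZZ Q (f c) (fun i => PowerSeries.mapAlgHom f (R i)) H e) = f (PowerSeries.coeff m (ZZ Q c R H e)) := by
  classical
  have h : ZZ Q (f c) (fun i => PowerSeries.mapAlgHom f (R i)) H e = PowerSeries.mapAlgHom f (ZZ Q c R H e) := by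
    have hu : ∀ i, uu (f c) (fun i => PowerSeries.mapAlgHom f (R i)) i = PowerSeries.mapAlgHom f (uu c R i) := by
      intro i; simp [uu, mAH_C]
    have hl : ll A' Q = PowerSeries.mapAlgHom f (ll A Q) := by
      rw [ll, ll, aeval_map_alg]
      congr 2; funext i; fin_cases i <;> simp [mAH_X]
    rw [ZZ, ZZ, map_mul, map_pow, hl, map_sum]
    congr 1
    apply Finset.sum_congr rfl
    intro τ _
    split_ifs
    · rw [map_prod]; apply Finset.prod_congr rfl; intro i _; rw [map_pow, hu]
    · simp
  rw [h]
  exact PowerSeries.coeff_map (f : A →+* A') m _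
end
end IncAux

namespace IncAux

lemma full_abs {κ L Λ Ω : Type} [Field κ] [Field L] [Field Λ] [Field Ω] [Algebra κ L] [Algebra κ Λ] [Algebra κ Ω] {d : ℕ}
    (ι : L →ₐ[κ] Ω) (m : Λ →ₐ[κ] Ω) (v : Λ) (ξ : Fin d → Λ) (vL : L) (xL : Fin d → L) (hv : ι vL = m v) (hx : ∀ i, ι (xL i) = m (ξ i))
    (g : L →ₐ[κ] L) (τ : Equiv.Perm (Fin d)) (gv : g vL = vL) (gx : ∀ i, g (xL i) = xL (τ i))
    (h : MvPolynomial (Option (Fin d)) κ) (h0 : ev v ξ h = 0) : ev v (ξ ∘ τ) h = 0 := by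
  have e1 := ev_map m v ξ h
  have e2 := ev_map ι vL xL h
  have e3 := ev_map g vL xL h
  have e4 := ev_map ι vL (xL ∘ τ) h
  have e5 := ev_map m v (ξ ∘ τ) h
  rw [h0, map_zero] at e1
  have a1 : ⇑ι ∘ xL = ⇑m ∘ ξ := funext hx
  rw [hv, a1, ← e1] at e2
  have e2' : ev vL xL h = 0 := ι.toRingHom.injective (by show ι _ = ι _; rw [e2, map_zero])
  have a2 : ⇑g ∘ xL = xL ∘ τ := funext gx
  rw [e2', map_zero, gv, a2] at e3
  have a3 : ⇑ι ∘ xL ∘ τ = ⇑m ∘ ξ ∘ τ := funext fun i => hx (τ i)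
  rw [← e3, map_zero, hv, a3, ← e5] at e4
  exact m.toRingHom.injective (by show m _ = m _; rw [← e4, map_zero])

abbrev K0 (k : Type) [Field k] : Type := FractionRing (Polynomial k)
noncomputable def cE (k : Type) [Field k] : K0 k := algebraMap (Polynomial k) _ Polynomial.X

lemma K0_hom {k : Type} [Field k] {B : Type} [Field B] [Algebra k B] (s : B) (h : Transcendental k s) :
    ∃ j : K0 k →ₐ[k] B, j (cE k) = s := by
  have h' : Function.Injective (Polynomial.aeval (R := k) s) := transcendental_iff_injective.1 h
  refine ⟨IsFractionRing.liftAlgHom (g := Polynomial.aeval (R := k) s) h', ?_⟩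
  rw [cE, IsFractionRing.liftAlgHom_apply, IsFractionRing.lift_algebraMap]; simp

lemma K0_ext {k : Type} [Field k] {B : Type} [Field B] [Algebra k B] (f g : K0 k →ₐ[k] B) (h : f (cE k) = g (cE k)) : f = g := by
  have h1 : f.comp (IsScalarTower.toAlgHom k (Polynomial k) (K0 k)) = g.comp (IsScalarTower.toAlgHom k (Polynomial k) (K0 k)) :=
    Polynomial.algHom_ext h
  have h2 : (f : K0 k →+* B) = (g : K0 k →+* B) := by
    apply IsLocalization.ringHom_ext (nonZeroDivisors (Polynomial k))
    ext1
    · ext1 x; exact DFunLike.congr_fun h1 (Polynomial.C x)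
    · exact h
  exact AlgHom.ext (fun x => RingHom.congr_fun h2 x)

lemma cE_trans (k : Type) [Field k] : Transcendental k (cE k) := by
  rw [transcendental_iff]
  intro p hp
  have h2 : Polynomial.aeval (cE k) p = algebraMap (Polynomial k) (K0 k) p := by
    rw [cE, Polynomial.aeval_algebraMap_apply, Polynomial.aeval_X_left_apply]
  rw [h2] at hp
  exact (IsFractionRing.injective (Polynomial k) (K0 k)) (hp.trans (map_zero _).symm)

section
variable {k : Type} [Field k] [IsAlgClosed k] {d : ℕ} (Q : MvPolynomial (Fin 3) k) (hd : 2 ≤ d) (hQ : Q.IsHomogeneous d)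
  (h1 : eval ![0, 0, 1] Q = 1) (hirr : Irreducible Q) {s0 t0 ρ0 : k} {ρ' : Fin (d-2) → k} (hT : Tan Q d s0 t0 ρ0 ρ')
  {ρ : Fin d → k} (hρ : Function.Injective ρ) {R : Fin d → PowerSeries (K0 k)} (hR : HR Q ρ (cE k) R)

lemma hcE (ρ : Fin d → k) (i : Fin d) : cE k ≠ algebraMap k (K0 k) (ρ i) := by
  intro h
  exact cE_trans k (h ▸ isAlgebraic_algebraMap _)

include hd hQ h1 hirr hT hρ hR in
lemma full_gen (h : MvPolynomial (Option (Fin d)) (K0 k)) (h0 : ev (V (K0 k)) (xi (cE k) R) h = 0) (τ : Equiv.Perm (Fin d)) :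
    ev (V (K0 k)) (xi (cE k) R ∘ τ) h = 0 := by
  classical
  have tower := towerL (k := k) (κ := K0 k)
  set lam := amk k (K0 k) PowerSeries.X with hlam
  have lV : lam * V (K0 k) = 1 := amk_XV
  have hlV : lam = (V (K0 k))⁻¹ := eq_inv_of_mul_eq_one_left lV
  have ltr : Transcendental (K0 k) lam := by
    rw [hlV]; intro h; exact V_trans (K0 k) (by simpa using h.inv)
  obtain ⟨j, js, jt⟩ := E0_hom (k := k) (B := LaurentSeries (K0 k)) _ _ (algind (N := K0 k) (cE k) 0 (by
    rintro ⟨a, b, ha, -⟩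
    exact cE_trans k (ha ▸ isAlgebraic_algebraMap _)) lam ltr)
  have l0 : lam ≠ 0 := fun h => by rw [h, zero_mul] at lV; exact zero_ne_one lV
  have jst : j (-sE k / tE k) = algebraMap (K0 k) _ (cE k) := by
    rw [map_div₀, map_neg, js, jt]; field_simp; simp
  have str : Transcendental k (-sE k / tE k) := by
    intro ha
    have h2 : IsAlgebraic k (j (-sE k / tE k)) := IsAlgebraic.algHom j ha
    rw [jst] at h2
    have h3 : IsAlgebraic k (cE k) := (isAlgebraic_algebraMap_iff (algebraMap (K0 k) (LaurentSeries (K0 k))).injective).1 h2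
    exact cE_trans k h3
  obtain ⟨e, he⟩ := K0_hom (-sE k / tE k) str
  have je : ∀ a, j (e a) = algebraMap (K0 k) (LaurentSeries (K0 k)) a := by
    have := K0_ext (j.comp e) (IsScalarTower.toAlgHom k (K0 k) (LaurentSeries (K0 k))) (by
      show j (e _) = algebraMap _ _ _
      rw [he, jst])
    intro a; exact DFunLike.congr_fun this a
  have hne : p0 Q (sE k) (tE k) ≠ 0 := p0_ne Q hd hQ hT
  let L := (p0 Q (sE k) (tE k)).SplittingField
  have hs : ((p0 Q (sE k) (tE k)).map (algebraMap (E0 k) L)).Splits := Polynomial.SplittingField.splits _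
  obtain ⟨ι, i1, -, i3⟩ := transfer' Q L hs hne j
  let Ω := AlgebraicClosure (LaurentSeries (K0 k))
  have hα : ∀ i, ∃ α, Rt Q (algebraMap _ L (sE k)) (algebraMap _ L (tE k)) α ∧ ι α = algebraMap _ Ω (amk k (K0 k) (R i)) := by
    intro i
    apply i3
    have r1 := rt_map Q (amk k (K0 k)) _ _ _ (hR.root i)
    have r2 := rt_map Q (IsScalarTower.toAlgHom k (LaurentSeries (K0 k)) Ω) _ _ _ r1
    rw [js, jt]
    have : amk k (K0 k) (-(PowerSeries.C (cE k) * PowerSeries.X)) = algebraMap (K0 k) (LaurentSeries (K0 k)) 0 - lam * algebraMap (K0 k) (LaurentSeries (K0 k)) (cE k) := by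
      rw [map_neg, map_mul, amk_C, map_zero]; ring
    rw [this] at r2
    exact r2
  choose α ha hia using hα
  have ainj : Function.Injective α := by
    intro i i' h
    have h2 := hia i
    rw [h, hia i'] at h2
    exact R_inj hρ hR (amk_inj ((algebraMap (LaurentSeries (K0 k)) Ω).injective h2)).symm
  let f : Fin d ↪ {α : L // Rt Q (algebraMap _ L (sE k)) (algebraMap _ L (tE k)) α} := ⟨fun i => ⟨α i, ha i⟩, fun i i' h => ainj (congrArg Subtype.val h)⟩
  obtain ⟨g, hg⟩ := u1 Q hd hQ h1 hirr hT L hs hne (τ.viaEmbedding f)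
  have hgα : ∀ i, g (α i) = α (τ i) := by
    intro i
    have h2 := hg (f i)
    rw [Equiv.Perm.viaEmbedding_apply] at h2
    exact h2
  letI algκ : Algebra (K0 k) L := ((algebraMap (E0 k) L).comp (e : K0 k →+* E0 k)).toAlgebra
  have hak : ∀ a : K0 k, algebraMap (K0 k) L a = algebraMap (E0 k) L (e a) := fun a => rfl
  let ι' : L →ₐ[K0 k] Ω := { (ι : L →+* Ω) with commutes' := fun a => (by rw [i1, je]; rfl : ι (algebraMap (E0 k) L (e a)) = algebraMap (K0 k) Ω a) }
  let g' : L →ₐ[K0 k] L := { (g : L →+* L) with commutes' := fun a => g.commutes (e a) }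
  let m : LaurentSeries (K0 k) →ₐ[K0 k] Ω := IsScalarTower.toAlgHom _ _ _
  have mi : ∀ x, ι' x = ι x := fun _ => rfl
  have mg : ∀ x, g' x = g x := fun _ => rfl
  have mm : ∀ x, m x = algebraMap (LaurentSeries (K0 k)) Ω x := fun _ => rfl
  have hv : ι (algebraMap (E0 k) L (tE k))⁻¹ = algebraMap (LaurentSeries (K0 k)) Ω (V (K0 k)) := by
    rw [map_inv₀, i1, jt, hlV, map_inv₀, inv_inv]
  refine full_abs ι' m (V (K0 k)) (xi (cE k) R) (algebraMap (E0 k) L (tE k))⁻¹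
    (fun i => (algebraMap (E0 k) L (tE k))⁻¹ / (α i - algebraMap (E0 k) L (e (cE k)))) hv ?_ g' τ ?_ ?_ h h0
  · intro i
    have h2 := xi_eq hR (hcE ρ) i
    have h3 : amk (K0 k) (K0 k) (R i) - algebraMap (K0 k) (LaurentSeries (K0 k)) (cE k) ≠ 0 := by
      intro h4; rw [h4, mul_zero] at h2; exact V_ne h2.symm
    rw [mi, mm, map_div₀, hv, map_sub, i1, je, hia, eq_div_of_mul_eq h3 h2, map_div₀, map_sub]
    rfl
  · rw [mg, map_inv₀, g.commutes]
  · intro i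
    rw [mg, map_div₀, map_inv₀, g.commutes, map_sub, g.commutes, hgα]
end
end IncAux

namespace IncAux

section
variable {κ : Type} [Field κ] {d : ℕ}

open Classical in
noncomputable def hY (H : Subgroup (Equiv.Perm (Fin d))) (e : Fin d → Fin d) (θ : Polynomial κ) : MvPolynomial (Option (Fin d)) κ :=
  (∑ τ : Equiv.Perm (Fin d), if τ ∈ H then ∏ i, (X (some (τ i)) : MvPolynomial (Option (Fin d)) κ) ^ (e i : ℕ) else 0) - Polynomial.aeval (X none) θ

lemma ev_hY {A : Type} [CommRing A] [Algebra κ A] (v : A) (x : Fin d → A) (H : Subgroup (Equiv.Perm (Fin d))) (e : Fin d → Fin d) (θ : Polynomial κ) :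
    ev v x (hY H e θ) = YY x H e - Polynomial.aeval v θ := by
  classical
  rw [hY, map_sub, map_sum, YY]
  congr 1
  · apply Finset.sum_congr rfl
    intro τ _
    split_ifs
    · rw [map_prod]
      apply Finset.prod_congr rfl
      intro i _
      rw [map_pow, ev, aeval_X]; rfl
    · simp
  · rw [← Polynomial.aeval_algHom_apply, ev, aeval_X]; rfl

lemma hY_deg (H : Subgroup (Equiv.Perm (Fin d))) (e : Fin d → Fin d) (θ : Polynomial κ) (hθ : θ.natDegree ≤ ∑ i, (e i : ℕ)) :
    (hY H e θ).totalDegree ≤ ∑ i, (e i : ℕ) := by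
  classical
  rw [hY]
  refine (totalDegree_sub _ _).trans (max_le ?_ ?_)
  · refine totalDegree_finsetSum_le (fun τ _ => ?_)
    split_ifs
    · refine (totalDegree_finset_prod _ _).trans (Finset.sum_le_sum fun i _ => ?_)
      exact (totalDegree_pow _ _).trans (by rw [totalDegree_X]; simp)
    · simp
  · rw [Polynomial.aeval_def, Polynomial.eval₂_eq_sum_range]
    refine totalDegree_finsetSum_le (fun n hn => ?_)
    rw [Finset.mem_range] at hn
    refine (totalDegree_mul _ _).trans ?_
    have h1 := totalDegree_pow (X none : MvPolynomial (Option (Fin d)) κ) n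
    rw [totalDegree_X] at h1
    have h2 : (algebraMap κ (MvPolynomial (Option (Fin d)) κ) (θ.coeff n)).totalDegree = 0 := by
      rw [MvPolynomial.algebraMap_eq]; exact totalDegree_C _
    omega

lemma sum_e_le (e : Fin d → Fin d) : ∑ i, (e i : ℕ) ≤ d * d := by
  calc _ ≤ ∑ i : Fin d, d := Finset.sum_le_sum (fun i _ => (e i).2.le)
    _ = d * d := by simp

lemma YY_comp {B : Type} [CommRing B] (y : Fin d → B) (H : Subgroup (Equiv.Perm (Fin d))) (e : Fin d → Fin d) (σ : Equiv.Perm (Fin d)) [DecidablePred (· ∈ H)] :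
    YY (y ∘ σ) H e = ∑ τ : Equiv.Perm (Fin d), if σ⁻¹ * τ ∈ H then ∏ i, y (τ i) ^ (e i : ℕ) else 0 := by
  classical
  rw [YY]
  refine Fintype.sum_equiv (Equiv.mulLeft σ) _ _ (fun τ => ?_)
  simp

lemma exists_e (Φ : Frame κ d) (H : Subgroup (Equiv.Perm (Fin d))) (hH : H ≠ ⊤) :
    ∃ e : Fin d → Fin d, ∀ θ : Polynomial κ, YY Φ.ξ H e ≠ Polynomial.aeval (V κ) θ := by
  classical
  by_contra hcon
  push Not at hcon
  choose θ hθ using hcon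
  obtain ⟨σ, hσ⟩ : ∃ σ, σ ∉ H := by
    by_contra h; push Not at h; exact hH (eq_top_iff.2 fun x _ => h x)
  have key : ∀ e, YY (Φ.ξ ∘ σ) H e = YY Φ.ξ H e := by
    intro e
    have h1 := Φ.full (hY H e (θ e)) (by rw [ev_hY, hθ, sub_self]) σ
    rw [ev_hY, sub_eq_zero] at h1
    rw [h1, hθ]
  have h2 := interp Φ.ξ Φ.inj (fun τ => (if τ ∈ H then 1 else 0) - (if σ⁻¹ * τ ∈ H then 1 else 0)) (by
    intro e
    have := key e
    rw [YY_comp, YY] at this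
    simp only [sub_mul, Finset.sum_sub_distrib, ite_mul, one_mul, zero_mul]
    rw [this, sub_eq_zero])
  have h3 := congrFun h2 1
  simp [H.one_mem, hσ] at h3

lemma exists_j (Φ : Frame κ d) (H : Subgroup (Equiv.Perm (Fin d))) (hH : H ≠ ⊤) :
    ∃ e : Fin d → Fin d, ∃ j : ℕ, 0 < j ∧ j ≤ d.factorial * (d * d) ∧ (YY Φ.ξ H e).coeff (j : ℤ) ≠ 0 := by
  classical
  obtain ⟨e, he⟩ := exists_e Φ H hH
  refine ⟨e, ?_⟩
  set n := ∑ i, (e i : ℕ) with hn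
  set Y := YY Φ.ξ H e with hYd
  set θ : Polynomial κ := ∑ m ∈ Finset.range (n + 1), Polynomial.monomial m (Y.coeff (-(m : ℤ))) with hθ
  have hcoef : ∀ m, θ.coeff m = if m < n + 1 then Y.coeff (-(m : ℤ)) else 0 := by
    intro m
    rw [hθ, Polynomial.finsetSum_coeff]
    simp_rw [Polynomial.coeff_monomial]
    rw [Finset.sum_ite_eq']
    simp
  have hθd : θ.natDegree ≤ n := by
    rw [Polynomial.natDegree_le_iff_coeff_eq_zero]
    intro m hm
    rw [hcoef, if_neg (by omega)]
  have hev : ev (V κ) Φ.ξ (hY H e θ) = Y - Polynomial.aeval (V κ) θ := ev_hY _ _ _ _ _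
  obtain ⟨-, -, -, -, how, -⟩ := Φ.norm (hY H e θ) (by rw [hev, sub_ne_zero]; exact he θ)
  have hYord : ((-(n : ℤ) : ℤ) : WithTop ℤ) ≤ ow κ Y := by
    have := ow_ev Φ.ξ Φ.ord (hY H e (0 : Polynomial κ)) (hY_deg H e 0 (by simp))
    rwa [ev_hY, map_zero, sub_zero] at this
  by_contra hcon
  push Not at hcon
  have hz : ((d.factorial * (d * d) + 1 : ℤ) : WithTop ℤ) ≤ ow κ (ev (V κ) Φ.ξ (hY H e θ)) := by
    refine le_ow_of_coeff (n := (d.factorial * (d * d) + 1 : ℤ)) (fun m hm => ?_)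
    rw [hev, HahnSeries.coeff_sub, coeff_aeval_V]
    by_cases h1 : 0 < m
    · rw [if_neg (by omega), sub_zero]
      have := hcon m.toNat (by omega) (by zify; rw [Int.toNat_of_nonneg h1.le]; omega)
      rwa [Int.toNat_of_nonneg h1.le] at this
    · rw [if_pos (by omega), hcoef]
      split_ifs with h2
      · rw [Int.toNat_of_nonneg (by omega), neg_neg, sub_self]
      · rw [sub_zero]
        apply coeff_zero_of_lt_ow
        refine lt_of_lt_of_le ?_ hYord
        rw [WithTop.coe_lt_coe]; omega
  have h4 := hz.trans how
  rw [WithTop.coe_le_coe] at h4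
  have h5 : (hY H e θ).totalDegree ≤ d * d := (hY_deg H e θ hθd).trans (sum_e_le e)
  have h6 : (1:ℤ) ≤ d.factorial := by exact_mod_cast Nat.factorial_pos d
  have h7 : ((hY H e θ).totalDegree : ℤ) ≤ d * d := by exact_mod_cast h5
  nlinarith

end

section
variable {k κ : Type} [Field k] [Field κ] [Algebra k κ] {d : ℕ} {Q : MvPolynomial (Fin 3) k}
  (hQ : Q.IsHomogeneous d) {ρ : Fin d → k} (hρ : Function.Injective ρ) {c : κ} {R : Fin d → PowerSeries κ} (hR : HR Q ρ c R)
  (hc : ∀ i, c ≠ algebraMap k κ (ρ i)) (hl : MvPolynomial.aeval (![0, 1, 0] : Fin 3 → k) Q ≠ 0)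
include hQ hρ hR hc hl

lemma YZ_coeff (H : Subgroup (Equiv.Perm (Fin d))) (e : Fin d → Fin d) (j : ℕ) :
    (MvPolynomial.aeval (![1, c, 0] : Fin 3 → κ) Q) ^ d * (YY (xi c R) H e).coeff (j : ℤ) =
      (-1) ^ (∑ i, (e i : ℕ)) * PowerSeries.coeff (∑ i, (e i : ℕ) + j) (ZZ Q c R H e) := by
  have h := congrArg (fun y => HahnSeries.coeff y (j : ℤ)) (YZ hQ hρ hR hc hl H e)
  rw [← map_pow, algL, HahnSeries.C_mul_eq_smul, HahnSeries.coeff_smul, smul_eq_mul] at h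
  rw [h]
  set n := ∑ i, (e i : ℕ)
  have e1 : (-V κ) ^ n = HahnSeries.single (-(n : ℤ)) ((-1) ^ n) := by
    rw [neg_pow, V, HahnSeries.single_pow]
    have : ((-1 : LaurentSeries κ)) ^ n = HahnSeries.C ((-1) ^ n) := by rw [map_pow, map_neg, map_one]
    rw [this, HahnSeries.C_mul_eq_smul]
    ext m
    simp [HahnSeries.coeff_single]
  rw [e1]
  have e2 : (j : ℤ) = ((n + j : ℕ) : ℤ) + (-(n : ℤ)) := by push_cast; ring
  rw [e2, HahnSeries.coeff_single_mul_add, amk_coeff]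

lemma YZ_iff (H : Subgroup (Equiv.Perm (Fin d))) (e : Fin d → Fin d) (j : ℕ) :
    (YY (xi c R) H e).coeff (j : ℤ) = 0 ↔ PowerSeries.coeff (∑ i, (e i : ℕ) + j) (ZZ Q c R H e) = 0 := by
  have h := YZ_coeff hQ hρ hR hc hl H e j
  have h2 := pow_ne_zero d (delta_ne hQ hρ hR hc hl)
  have h3 : (-1 : κ) ^ (∑ i, (e i : ℕ)) ≠ 0 := pow_ne_zero _ (by simp)
  constructor
  · intro h0; rw [h0, mul_zero] at h; exact (mul_eq_zero.1 h.symm).resolve_left h3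
  · intro h0; rw [h0, mul_zero] at h; exact (mul_eq_zero.1 h).resolve_left h2
end

/-- IV4 -/
lemma exists_sep {k : Type} [Field k] [IsAlgClosed k] {d : ℕ} (Q : MvPolynomial (Fin 3) k) (hd : 2 ≤ d) (hQ : Q.IsHomogeneous d)
    (h1 : eval ![0, 0, 1] Q = 1) (hirr : Irreducible Q) {s0 t0 ρ0 : k} {ρ' : Fin (d-2) → k} (hT : Tan Q d s0 t0 ρ0 ρ')
    {ρ : Fin d → k} (hρ : Function.Injective ρ) (hl : MvPolynomial.aeval (![0, 1, 0] : Fin 3 → k) Q ≠ 0)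
    {R : Fin d → PowerSeries (Polynomial k)} (hR : HR Q ρ Polynomial.X R) (hD : ∀ i, Dg 0 (R i))
    (H : Subgroup (Equiv.Perm (Fin d))) (hH : H ≠ ⊤) :
    ∃ e : Fin d → Fin d, ∃ j : ℕ, 0 < j ∧ PowerSeries.coeff (∑ i, (e i : ℕ) + j) (ZZ Q Polynomial.X R H e) ≠ 0 ∧
      (PowerSeries.coeff (∑ i, (e i : ℕ) + j) (ZZ Q Polynomial.X R H e)).natDegree ≤ 2 * (d * d) + d.factorial * (d * d) := by
  let f : Polynomial k →ₐ[k] K0 k := IsScalarTower.toAlgHom k _ _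
  have hR' := hR.map f
  have hfc : f Polynomial.X = cE k := rfl
  rw [hfc] at hR'
  let Φ : Frame (K0 k) d := ⟨gT Q (cE k), xi (cE k) (fun i => PowerSeries.mapAlgHom f (R i)), xi_spl hQ hρ hR' (hcE ρ) hl,
    xi_inj hρ hR' (hcE ρ), xi_ord hR' (hcE ρ), full_gen Q hd hQ h1 hirr hT hρ hR'⟩
  obtain ⟨e, j, hj, hj2, hne⟩ := exists_j Φ H hH
  refine ⟨e, j, hj, ?_, ?_⟩
  · intro h0
    apply hne
    refine (YZ_iff hQ hρ hR' (hcE ρ) hl H e j).2 ?_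
    rw [← hfc, ZZ_map, h0, map_zero]
  · have := Z_deg Q R hD H e (∑ i, (e i : ℕ) + j)
    have := sum_e_le e
    omega
end IncAux

namespace IncAux

lemma galH {N E : Type} [Field N] [Field E] [Algebra N E] {d : ℕ} (z : Fin d → E) (hz : Function.Injective z)
    (hp : ∀ (f : E ≃ₐ[N] E) (i : Fin d), ∃ j, f (z i) = z j) :
    ∃ H : Subgroup (Equiv.Perm (Fin d)), (∀ σ ∈ H, ∃ f : E ≃ₐ[N] E, ∀ i, f (z i) = z (σ i)) ∧
      ∀ (e : Fin d → Fin d) (f : E ≃ₐ[N] E), f (YY z H e) = YY z H e := by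
  classical
  let H : Subgroup (Equiv.Perm (Fin d)) :=
    { carrier := {σ | ∃ f : E ≃ₐ[N] E, ∀ i, f (z i) = z (σ i)}
      one_mem' := ⟨1, fun i => rfl⟩
      mul_mem' := by
        rintro a b ⟨f, hf⟩ ⟨g, hg⟩
        refine ⟨f * g, fun i => ?_⟩
        rw [AlgEquiv.mul_apply, hg, hf]; rfl
      inv_mem' := by
        rintro a ⟨f, hf⟩
        refine ⟨f⁻¹, fun i => ?_⟩
        have := hf (a⁻¹ i)
        rw [show a (a⁻¹ i) = i from a.apply_symm_apply i] at this
        rw [← this]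
        exact AlgEquiv.symm_apply_apply f _ }
  refine ⟨H, fun σ h => h, fun e f => ?_⟩
  choose s hs using hp f
  have sinj : Function.Injective s := by
    intro i j h
    apply hz; apply f.injective; rw [hs, hs, h]
  let σ : Equiv.Perm (Fin d) := Equiv.ofBijective s (Finite.injective_iff_bijective.1 sinj)
  have hσ : σ ∈ H := ⟨f, hs⟩
  have e1 : f (YY z H e) = YY (z ∘ σ) H e := by
    rw [YY, YY, map_sum]
    apply Finset.sum_congr rfl
    intro τ _
    split_ifs
    · rw [map_prod]; apply Finset.prod_congr rfl; intro i _; rw [map_pow, hs]; rfl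
    · simp
  rw [e1, YY_comp, YY]
  apply Finset.sum_congr rfl
  intro τ _
  rw [H.mul_mem_cancel_left (H.inv_mem hσ)]

lemma YY_map {B B' : Type} [CommRing B] [CommRing B'] {d : ℕ} (f : B →+* B') (y : Fin d → B) (H : Subgroup (Equiv.Perm (Fin d))) (e : Fin d → Fin d) :
    f (YY y H e) = YY (fun i => f (y i)) H e := by
  classical
  rw [YY, YY, map_sum]
  apply Finset.sum_congr rfl
  intro τ _
  split_ifs
  · rw [map_prod]; apply Finset.prod_congr rfl; intro i _; rw [map_pow]
  · simp

lemma YY_int {A B : Type} [CommRing A] [CommRing B] [Algebra A B] {d : ℕ} (y : Fin d → B) (hy : ∀ i, IsIntegral A (y i))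
    (H : Subgroup (Equiv.Perm (Fin d))) (e : Fin d → Fin d) : IsIntegral A (YY y H e) := by
  classical
  rw [YY]
  apply IsIntegral.sum
  intro τ _
  split_ifs
  · apply IsIntegral.prod; intro i _; exact (hy _).pow _
  · exact isIntegral_zero

lemma full_special {κ : Type} [Field κ] {d : ℕ} (g : Polynomial (Polynomial κ)) (ξ : Fin d → LaurentSeries κ)
    (hspl : Spl g (V κ) ξ) (hinj : Function.Injective ξ)
    (hsep : ∀ H : Subgroup (Equiv.Perm (Fin d)), H ≠ ⊤ → ∃ e : Fin d → Fin d, ∃ j : ℕ, 0 < j ∧ (YY ξ H e).coeff (j : ℤ) ≠ 0)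
    (h : MvPolynomial (Option (Fin d)) κ) (h0 : ev (V κ) ξ h = 0) (τ : Equiv.Perm (Fin d)) :
    ev (V κ) (ξ ∘ τ) h = 0 := by
  classical
  obtain ⟨ψ, hψ⟩ := K0_hom (k := κ) (V κ) (V_trans κ)
  letI : Algebra (K0 κ) (LaurentSeries κ) := (ψ : K0 κ →+* LaurentSeries κ).toAlgebra
  have aψ : ∀ x, algebraMap (K0 κ) (LaurentSeries κ) x = ψ x := fun _ => rfl
  have hψp : ∀ θ : Polynomial κ, ψ (algebraMap _ (K0 κ) θ) = Polynomial.aeval (V κ) θ := by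
    intro θ
    have : ψ.comp (IsScalarTower.toAlgHom κ (Polynomial κ) (K0 κ)) = Polynomial.aeval (V κ) := by
      apply Polynomial.algHom_ext
      rw [Polynomial.aeval_X]; exact hψ
    exact DFunLike.congr_fun this θ
  have hgm := (spl_monic hspl).1
  set G := g.map (algebraMap (Polynomial κ) (K0 κ)) with hG
  have hGΛ : G.map (algebraMap (K0 κ) (LaurentSeries κ)) = ∏ i, (Polynomial.X - Polynomial.C (ξ i)) := by
    rw [hG, Polynomial.map_map, ← hspl]
    congr 1
    ext1
    · ext1 a; exact hψp (Polynomial.C a)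
    · exact hψp Polynomial.X
  have hGs : (G.map (algebraMap (K0 κ) (LaurentSeries κ))).Splits := by
    rw [hGΛ]; exact Polynomial.Splits.prod (fun i _ => Polynomial.Splits.X_sub_C _)
  have hGsep : G.Separable := by
    rw [← Polynomial.separable_map (algebraMap (K0 κ) (LaurentSeries κ)), hGΛ]
    exact Polynomial.separable_prod_X_sub_C_iff.2 hinj
  let E := G.SplittingField
  have hEs : (G.map (algebraMap (K0 κ) E)).Splits := Polynomial.SplittingField.splits _
  let φ : E →ₐ[K0 κ] LaurentSeries κ := Polynomial.SplittingField.lift G hGs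
  haveI : IsGalois (K0 κ) E := IsGalois.of_separable_splitting_field hGsep
  have hG0 : G ≠ 0 := (hgm.map _).ne_zero
  have hφG : (G.map (algebraMap (K0 κ) E)).map (φ : E →+* LaurentSeries κ) = ∏ i, (Polynomial.X - Polynomial.C (ξ i)) := by
    rw [Polynomial.map_map, ← hGΛ]
    congr 1
    exact φ.comp_algebraMap
  have hrt := Polynomial.Splits.roots_map hEs (φ : E →+* LaurentSeries κ)
  have hzi : ∀ i, ∃ z : E, φ z = ξ i := by
    intro i
    have : ξ i ∈ ((G.map (algebraMap (K0 κ) E)).map (φ : E →+* LaurentSeries κ)).roots := by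
      rw [hφG, Polynomial.mem_roots (Polynomial.monic_prod_of_monic _ _ (fun i _ => Polynomial.monic_X_sub_C _)).ne_zero, Polynomial.IsRoot, Polynomial.eval_prod,
        Finset.prod_eq_zero (Finset.mem_univ i)]
      simp
    rw [hrt, Multiset.mem_map] at this
    obtain ⟨z, -, hz⟩ := this
    exact ⟨z, hz⟩
  choose z hz using hzi
  have zinj : Function.Injective z := fun i j hij => hinj (by rw [← hz, ← hz, hij])
  have hGz : ∀ x : E, Polynomial.aeval x G = 0 ↔ ∃ i, x = z i := by
    intro x
    have e1 : φ (Polynomial.aeval x G) = ∏ i, (φ x - ξ i) := by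
      rw [← Polynomial.aeval_algHom_apply, ← Polynomial.eval_map_algebraMap, hGΛ, Polynomial.eval_prod]
      simp
    constructor
    · intro hx
      rw [hx, map_zero, eq_comm, Finset.prod_eq_zero_iff] at e1
      obtain ⟨i, -, hi⟩ := e1
      refine ⟨i, φ.toRingHom.injective ?_⟩
      show φ x = φ (z i)
      rw [hz, sub_eq_zero.1 hi]
    · rintro ⟨i, rfl⟩
      apply φ.toRingHom.injective
      show φ _ = φ 0
      rw [e1, map_zero, Finset.prod_eq_zero (Finset.mem_univ i)]
      rw [hz, sub_self]
  obtain ⟨H, hH1, hH2⟩ := galH (N := K0 κ) z zinj (fun f i => by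
    apply (hGz _).1
    rw [Polynomial.aeval_algEquiv, AlgHom.comp_apply, (hGz _).2 ⟨i, rfl⟩]
    simp)
  have hHtop : H = ⊤ := by
    by_contra hH
    obtain ⟨e, j, hj, hne⟩ := hsep H hH
    obtain ⟨a, ha⟩ := (IsGalois.mem_range_algebraMap_iff_fixed (F := K0 κ) (YY z H e)).2 (hH2 e)
    have hint : IsIntegral (Polynomial κ) (YY z H e) := by
      apply YY_int
      intro i
      refine ⟨g, hgm, ?_⟩
      have := (hGz (z i)).2 ⟨i, rfl⟩
      rw [Polynomial.aeval_def] at this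
      have h8 := Polynomial.eval₂_map (p := g) (algebraMap (Polynomial κ) (K0 κ)) (algebraMap (K0 κ) E) (z i)
      exact h8.symm.trans this
    rw [← ha, isIntegral_algebraMap_iff (algebraMap (K0 κ) E).injective, IsIntegrallyClosed.isIntegral_iff] at hint
    obtain ⟨θ, rfl⟩ := hint
    have h5 := congrArg φ ha
    rw [φ.commutes, aψ, hψp] at h5
    have h6 := YY_map (φ : E →+* LaurentSeries κ) z H e
    have h7 : (fun i => (φ : E →+* LaurentSeries κ) (z i)) = ξ := funext hz
    rw [h7] at h6
    apply hne
    rw [← h6]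
    refine Eq.trans (congrArg (fun y => HahnSeries.coeff y (j : ℤ)) h5.symm) ?_
    show (Polynomial.aeval (V κ) θ).coeff (j : ℤ) = 0
    rw [coeff_aeval_V, if_neg (by omega)]
  obtain ⟨f, hf⟩ := hH1 τ (hHtop ▸ Subgroup.mem_top τ)
  let φ' : E →ₐ[κ] LaurentSeries κ := { (φ : E →+* LaurentSeries κ) with commutes' := fun a => (by
    rw [IsScalarTower.algebraMap_apply κ (K0 κ) E, φ.commutes, aψ, ψ.commutes] : φ (algebraMap κ E a) = algebraMap κ (LaurentSeries κ) a) }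
  let f' : E →ₐ[κ] E := { (f : E →+* E) with commutes' := fun a => (by
    rw [IsScalarTower.algebraMap_apply κ (K0 κ) E, f.commutes] : f (algebraMap κ E a) = algebraMap κ E a) }
  refine full_abs φ' (AlgHom.id κ _) (V κ) ξ (algebraMap (K0 κ) E (cE κ)) z ?_ hz f' τ ?_ hf h h0
  · show φ _ = V κ
    rw [φ.commutes, aψ, hψ]
  · exact f.commutes _
end IncAux

namespace IncAux

noncomputable def Bc (d : ℕ) : ℕ := d + Nat.card (Subgroup (Equiv.Perm (Fin d))) * (2 * (d * d) + d.factorial * (d * d))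

theorem bertini {k : Type} [Field k] [IsAlgClosed k] {d : ℕ} (Q : MvPolynomial (Fin 3) k) (hd : 2 ≤ d) (hQ : Q.IsHomogeneous d)
    (h1 : eval ![0, 0, 1] Q = 1) (hirr : Irreducible Q) {s0 t0 ρ0 : k} {ρ' : Fin (d-2) → k} (hT : Tan Q d s0 t0 ρ0 ρ')
    {ρ : Fin d → k} (hρ : Function.Injective ρ) (hl : MvPolynomial.aeval (![0, 1, 0] : Fin 3 → k) Q ≠ 0)
    (hr0 : ∀ i, (p0 Q (0:k) 0).eval (ρ i) = 0) (hr1 : ∀ i, (p0 Q (0:k) 0).derivative.eval (ρ i) ≠ 0) :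
    ∃ bad : Finset k, bad.card ≤ Bc d ∧ ∀ c ∉ bad, MvPolynomial.aeval (![1, c, 0] : Fin 3 → k) Q ≠ 0 ∧ ∃ Φ : Frame k d, Φ.g = gT Q c := by
  classical
  obtain ⟨R, hR, hD⟩ := exists_R Q ρ hr0 hr1
  have key : ∀ H : Subgroup (Equiv.Perm (Fin d)), ∃ f : Polynomial k, f ≠ 0 ∧ f.natDegree ≤ 2 * (d * d) + d.factorial * (d * d) ∧
      (H ≠ ⊤ → ∃ e : Fin d → Fin d, ∃ j : ℕ, 0 < j ∧ f = PowerSeries.coeff (∑ i, (e i : ℕ) + j) (ZZ Q Polynomial.X R H e)) := by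
    intro H
    by_cases hH : H = ⊤
    · exact ⟨1, one_ne_zero, by simp, fun h => absurd hH h⟩
    · obtain ⟨e, j, hj, hn, hdeg⟩ := exists_sep Q hd hQ h1 hirr hT hρ hl hR hD H hH
      exact ⟨_, hn, hdeg, fun _ => ⟨e, j, hj, rfl⟩⟩
  choose f hf0 hfd hf using key
  refine ⟨Finset.univ.image ρ ∪ Finset.univ.biUnion (fun H => (f H).roots.toFinset), ?_, ?_⟩
  · refine (Finset.card_union_le _ _).trans ?_
    rw [Bc]
    gcongr
    · exact Finset.card_image_le.trans (by simp)
    · refine Finset.card_biUnion_le.trans ?_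
      rw [Nat.card_eq_fintype_card, ← Finset.card_univ, ← smul_eq_mul, ← Finset.sum_const]
      exact Finset.sum_le_sum fun H _ => (Multiset.toFinset_card_le _).trans ((Polynomial.card_roots' _).trans (hfd H))
  · intro c hc
    simp only [Finset.mem_union, Finset.mem_image, Finset.mem_univ, true_and, Finset.mem_biUnion, Multiset.mem_toFinset, not_or, not_exists] at hc
    obtain ⟨hc1, hc2⟩ := hc
    have hc' : ∀ i, c ≠ algebraMap k k (ρ i) := fun i h => hc1 i h.symm
    have hR' := hR.map (Polynomial.aeval c : Polynomial k →ₐ[k] k)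
    have hac : (Polynomial.aeval c : Polynomial k →ₐ[k] k) Polynomial.X = c := Polynomial.aeval_X c
    rw [hac] at hR'
    refine ⟨delta_ne hQ hρ hR' hc' hl, ⟨gT Q c, xi c (fun i => PowerSeries.mapAlgHom (Polynomial.aeval c) (R i)), xi_spl hQ hρ hR' hc' hl,
      xi_inj hρ hR' hc', xi_ord hR' hc', full_special _ _ (xi_spl hQ hρ hR' hc' hl) (xi_inj hρ hR' hc') ?_⟩, rfl⟩
    intro H hH
    obtain ⟨e, j, hj, hfe⟩ := hf H hH
    refine ⟨e, j, hj, ?_⟩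
    intro h0
    have hz := ZZ_map Q Polynomial.X R (Polynomial.aeval c : Polynomial k →ₐ[k] k) H e (∑ i, (e i : ℕ) + j)
    rw [hac, ← hfe] at hz
    rw [YZ_iff hQ hρ hR' hc' hl, hz] at h0
    apply hc2 H
    rw [Polynomial.mem_roots (hf0 H)]
    rwa [Polynomial.coe_aeval_eq_eval] at h0
end IncAux

namespace IncAux

def Dm (d m : ℕ) : ℕ := (Finset.univ.filter (fun σ : Equiv.Perm (Fin d) => (Finset.univ.filter (fun i => σ i = i)).card = m)).card

noncomputable def hdisc (κ : Type) [Field κ] (d : ℕ) : MvPolynomial (Option (Fin d)) κ :=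
  ∏ i : Fin d, ∏ j : Fin d, if i = j then 1 else (X (some i) - X (some j))

lemma hdisc_ev {κ A : Type} [Field κ] [CommRing A] [IsDomain A] [Algebra κ A] {d : ℕ} (v : A) (y : Fin d → A) :
    ev v y (hdisc κ d) ≠ 0 ↔ Function.Injective y := by
  rw [hdisc, map_prod, Finset.prod_ne_zero_iff]
  constructor
  · intro h i j hij
    by_contra hne
    have := h i (Finset.mem_univ _)
    rw [map_prod, Finset.prod_ne_zero_iff] at this
    have := this j (Finset.mem_univ _)
    rw [if_neg hne, map_sub, ev, aeval_X, aeval_X] at this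
    exact this (sub_eq_zero.2 hij)
  · intro h i _
    rw [map_prod, Finset.prod_ne_zero_iff]
    intro j _
    split_ifs with hij
    · simp
    · rw [map_sub, ev, aeval_X, aeval_X]
      exact sub_ne_zero.2 (fun h2 => hij (h h2))

lemma hdisc_deg (κ : Type) [Field κ] (d : ℕ) : (hdisc κ d).totalDegree ≤ d * d := by
  rw [hdisc]
  refine (totalDegree_finset_prod _ _).trans ?_
  calc _ ≤ ∑ i : Fin d, d := Finset.sum_le_sum fun i _ => ?_
    _ = d * d := by simp
  refine (totalDegree_finset_prod _ _).trans ?_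
  calc _ ≤ ∑ i : Fin d, 1 := Finset.sum_le_sum fun j _ => ?_
    _ = d := by simp
  split_ifs
  · simp
  · refine (totalDegree_sub _ _).trans ?_
    rw [totalDegree_X, totalDegree_X]; simp

lemma exists_split {k : Type} [Field k] [IsAlgClosed k] (f : Polynomial k) (hfm : f.Monic) {d : ℕ} (hfd : f.natDegree = d) :
    ∃ y : Fin d → k, f = ∏ i, (Polynomial.X - Polynomial.C (y i)) := by
  have hs : f.Splits := IsAlgClosed.splits f
  have h1 := hs.eq_prod_roots_of_monic hfm
  have hl : f.roots.toList.length = d := by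
    rw [Multiset.length_toList, ← hfd]; exact hs.natDegree_eq_card_roots.symm
  rw [← Multiset.coe_toList f.roots, Multiset.map_coe, Multiset.prod_coe] at h1
  generalize f.roots.toList = l at h1 hl
  subst hl
  refine ⟨fun i => l[i], ?_⟩
  rw [h1]
  exact (Fin.prod_univ_fun_getElem l (fun a => Polynomial.X - Polynomial.C a)).symm

section
variable {k : Type} [Field k] [IsAlgClosed k] (p : ℕ) [Fact p.Prime] [CharP k p] {d : ℕ} {Q : MvPolynomial (Fin 3) k} {c : k}
  (hδ : MvPolynomial.aeval (![1, c, 0] : Fin 3 → k) Q ≠ 0) (Φ : Frame k d) (hg : Φ.g = gT Q c) (n : ℕ)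
  (hn : 2 * d.factorial * d ^ 2 + 3 * d ^ 2 + 8 ≤ p ^ (n / 2))
  (hF : ∀ x : Fin 3 → k, MvPolynomial.aeval (fun i => x i ^ (p ^ n)) Q = (MvPolynomial.aeval x Q) ^ (p ^ n)) (hcq : c ^ (p ^ n) = c) (m : ℕ)

include hδ hg in
lemma spl_root {v : k} {y : Fin d → k} (h : Spl Φ.g v y) (T : k) : MvPolynomial.aeval (![T, v + T * c, 1] : Fin 3 → k) Q = 0 ↔ ∃ i, T = y i := by
  have h1 := gT_eval (Q := Q) (c := c) v T
  have h2 : ((gT Q c).map (Polynomial.aeval v : Polynomial k →ₐ[k] k).toRingHom).eval T = ∏ i, (T - y i) := by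
    rw [← hg, h, Polynomial.eval_prod]; simp
  have h3 : MvPolynomial.aeval (![T, v + T * c, 1] : Fin 3 → k) Q = 0 ↔ ∏ i, (T - y i) = 0 := by
    rw [← h2]
    refine Iff.trans ?_ (Eq.congr_left (h1.symm)) 
    rw [mul_eq_zero]
    have : (algebraMap k k) (MvPolynomial.aeval (![1, c, 0] : Fin 3 → k) Q)⁻¹ ≠ 0 := by
      simpa only [ne_eq, Algebra.algebraMap_self, RingHom.id_apply, inv_eq_zero] using hδ
    exact (or_iff_right this).symm
  rw [h3, Finset.prod_eq_zero_iff]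
  simp [sub_eq_zero]

include hδ hg hF hcq in
lemma frob_root {v : k} (hv : v ^ (p ^ n) = v) {y : Fin d → k} (h : Spl Φ.g v y) (hy : Function.Injective y) : ∃ σ : Equiv.Perm (Fin d), ∀ i, y i ^ (p ^ n) = y (σ i) := by
  haveI : ExpChar k p := ExpChar.prime Fact.out
  have h1 : ∀ i, ∃ j, y i ^ (p ^ n) = y j := by
    intro i
    rw [← spl_root hδ Φ hg h]
    have h2 := (spl_root hδ Φ hg h (y i)).2 ⟨i, rfl⟩
    have h3 := hF (![y i, v + y i * c, 1] : Fin 3 → k)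
    rw [h2, zero_pow (pow_pos (Fact.out : p.Prime).pos n).ne'] at h3
    rw [← h3]
    congr 2; funext j; fin_cases j
    · rfl
    · show v + y i ^ (p ^ n) * c = (v + y i * c) ^ (p ^ n)
      rw [add_pow_expChar_pow, mul_pow, hv, hcq]
    · simp
  choose s hs using h1
  have sinj : Function.Injective s := by
    intro i j hij
    apply hy
    have h4 : y i ^ (p ^ n) = y j ^ (p ^ n) := by rw [hs, hs, hij]
    exact iterateFrobenius_inj k p n h4
  exact ⟨Equiv.ofBijective s (Finite.injective_iff_bijective.1 sinj), hs⟩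

include hδ hg hn hF hcq in
lemma count_good : {v : k | v ^ (p ^ n) = v ∧ {T : k | T ^ (p ^ n) = T ∧ MvPolynomial.aeval (![T, v + T * c, 1] : Fin 3 → k) Q = 0}.ncard = m}.Finite ∧
    d.factorial * {v : k | v ^ (p ^ n) = v ∧ {T : k | T ^ (p ^ n) = T ∧ MvPolynomial.aeval (![T, v + T * c, 1] : Fin 3 → k) Q = 0}.ncard = m}.ncard ≤
      Dm d m * (p ^ n + (1 + d.factorial * (4 * d ^ 2 + 4)) * p ^ (n - n / 2)) + d.factorial * (d.factorial * (d * d)) := by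
  classical
  set A := {v : k | v ^ (p ^ n) = v ∧ {T : k | T ^ (p ^ n) = T ∧ MvPolynomial.aeval (![T, v + T * c, 1] : Fin 3 → k) Q = 0}.ncard = m} with hA
  have hq1 : 1 < p ^ n := by
    have h1 : p ^ (n / 2) ≤ p ^ n := Nat.pow_le_pow_right (Fact.out : p.Prime).pos (Nat.div_le_self _ _)
    omega
  have hAf : A.Finite := by
    have hX : (Polynomial.X ^ (p ^ n) - Polynomial.X : Polynomial k) ≠ 0 := FiniteField.X_pow_card_sub_X_ne_zero k hq1
    apply Set.Finite.subset (Polynomial.X ^ (p ^ n) - Polynomial.X : Polynomial k).roots.toFinset.finite_toSet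
    intro v hv
    rw [Finset.mem_coe, Multiset.mem_toFinset, Polynomial.mem_roots hX, Polynomial.IsRoot]
    simp [hv.1]
  refine ⟨hAf, ?_⟩
  obtain ⟨θ, hθ0, hθ, hθd, -, -⟩ := Φ.norm (hdisc k d) ((hdisc_ev _ _).2 Φ.inj)
  set A' := A \ {v | θ.eval v = 0} with hA'
  have hZ : {v | θ.eval v = 0} = (θ.roots.toFinset : Set k) := by
    ext v; simp [hθ0]
  have hZc : {v | θ.eval v = 0}.ncard ≤ d.factorial * (d * d) := by
    rw [hZ, Set.ncard_coe_finset]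
    refine (Multiset.toFinset_card_le _).trans ((Polynomial.card_roots' _).trans (hθd.trans ?_))
    exact Nat.mul_le_mul_left _ (hdisc_deg k d)
  have hAA : A.ncard ≤ A'.ncard + d.factorial * (d * d) := by
    have h1 : A ⊆ A' ∪ {v | θ.eval v = 0} := by
      intro v hv
      by_cases h : θ.eval v = 0
      · exact Or.inr h
      · exact Or.inl ⟨hv, h⟩
    have hfin : (A' ∪ {v | θ.eval v = 0}).Finite := (hAf.subset Set.diff_subset).union (by rw [hZ]; exact Finset.finite_toSet _)
    exact (Set.ncard_le_ncard h1 hfin).trans ((Set.ncard_union_le _ _).trans (by omega))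
  have hmon := spl_monic Φ.spl
  -- choice of roots
  have hroots : ∀ v : k, ∃ y : Fin d → k, Spl Φ.g v y := by
    intro v
    exact exists_split _ (hmon.1.map _) (by rw [hmon.1.natDegree_map, hmon.2])
  choose y hy using hroots
  have hyinj : ∀ v ∈ A', Function.Injective (y v) := by
    intro v hv
    have h1 := hθ k v (y v) (hy v)
    have h2 : Polynomial.aeval v θ ≠ 0 := by rw [Polynomial.coe_aeval_eq_eval]; exact hv.2
    rw [← h1, Finset.prod_ne_zero_iff] at h2
    have h3 := h2 1 (Finset.mem_univ _)
    exact (hdisc_ev _ _).1 h3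
  let S : Equiv.Perm (Fin d) → Set (k × (Fin d → k)) := fun σ => {w : k × (Fin d → k) | Function.Injective w.2 ∧ Spl Φ.g w.1 w.2 ∧ w.1 ^ (p ^ n) = w.1 ∧ ∀ i, w.2 i ^ (p ^ n) = w.2 (σ i)}
  have hS : ∀ σ, (S σ).Finite ∧ (S σ).ncard ≤ p ^ n + (1 + d.factorial * (4 * d ^ 2 + 4)) * p ^ (n - n / 2) := fun σ => stepanov p Φ n hn σ
  let M := (Finset.univ.filter (fun σ : Equiv.Perm (Fin d) => (Finset.univ.filter (fun i => σ i = i)).card = m))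
  let U : Finset (k × (Fin d → k)) := M.biUnion (fun σ => (hS σ).1.toFinset)
  have hU : U.card ≤ Dm d m * (p ^ n + (1 + d.factorial * (4 * d ^ 2 + 4)) * p ^ (n - n / 2)) := by
    refine Finset.card_biUnion_le.trans ?_
    refine (Finset.sum_le_card_nsmul M _ (p ^ n + (1 + d.factorial * (4 * d ^ 2 + 4)) * p ^ (n - n / 2)) fun σ _ => ?_).trans le_rfl
    rw [← Set.ncard_eq_toFinset_card _ (hS σ).1]
    exact (hS σ).2
  have hA'f : A'.Finite := hAf.subset Set.diff_subset
  have hmap : (hA'f.toFinset ×ˢ (Finset.univ : Finset (Equiv.Perm (Fin d)))).card ≤ U.card := by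
    apply Finset.card_le_card_of_injOn (fun x => (x.1, y x.1 ∘ x.2))
    · rintro ⟨v, τ⟩ hx
      simp only [Finset.coe_product, Set.mem_prod, Finset.mem_coe, Set.Finite.mem_toFinset] at hx
      have hv := hx.1
      have hinj : Function.Injective (y v ∘ τ) := (hyinj v hv).comp τ.injective
      have hspl : Spl Φ.g v (y v ∘ τ) := (hy v).perm τ
      obtain ⟨σ, hσ⟩ := frob_root p hδ Φ hg n hF hcq hv.1.1 hspl hinj
      rw [Finset.mem_coe, Finset.mem_biUnion]
      refine ⟨σ, ?_, ?_⟩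
      · rw [Finset.mem_filter]
        refine ⟨Finset.mem_univ _, ?_⟩
        rw [← hv.1.2]
        have : {T : k | T ^ (p ^ n) = T ∧ MvPolynomial.aeval (![T, v + T * c, 1] : Fin 3 → k) Q = 0} = ((Finset.univ.filter (fun i => σ i = i)).image (y v ∘ τ) : Finset k) := by
          ext T
          simp only [Set.mem_setOf_eq, Finset.coe_image, Finset.coe_filter, Finset.mem_univ, true_and, Set.mem_image]
          rw [spl_root hδ Φ hg hspl]
          constructor
          · rintro ⟨h1, i, rfl⟩
            refine ⟨i, ?_, rfl⟩
            rw [hσ] at h1; exact hinj h1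
          · rintro ⟨i, hi, rfl⟩
            exact ⟨by rw [hσ, hi], i, rfl⟩
        rw [this, Set.ncard_coe_finset, Finset.card_image_of_injective _ hinj]
      · rw [Set.Finite.mem_toFinset]
        exact ⟨hinj, hspl, hv.1.1, hσ⟩
    · rintro ⟨v, τ⟩ hx ⟨v', τ'⟩ hx' heq
      simp only [Finset.coe_product, Set.mem_prod, Finset.mem_coe, Set.Finite.mem_toFinset] at hx
      simp only [Prod.mk.injEq] at heq
      obtain ⟨rfl, h2⟩ := heq
      congr 1
      ext1 i
      exact hyinj v hx.1 (congrFun h2 i)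
  rw [Finset.card_product, Finset.card_univ, Fintype.card_perm, Fintype.card_fin, ← Set.ncard_eq_toFinset_card _ hA'f] at hmap
  calc d.factorial * A.ncard ≤ d.factorial * (A'.ncard + d.factorial * (d * d)) := by gcongr
    _ = A'.ncard * d.factorial + d.factorial * (d.factorial * (d * d)) := by ring
    _ ≤ _ := Nat.add_le_add_right (hmap.trans hU) _
end
end IncAux

namespace IncAux
open IncidenceProb Matrix

section lin
variable {K : Type} [Field K] {d : ℕ}

lemma hom_eval {P : MvPolynomial (Fin 3) K} (hP : P.IsHomogeneous d) (c : K) (x : Fin 3 → K) :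
    eval (c • x) P = c ^ d * eval x P := by
  have := hom_scale P hP c x
  simpa [MvPolynomial.aeval_def, MvPolynomial.eval₂_id, MvPolynomial.coe_aeval_eq_eval, Pi.smul_def] using this

lemma onCurve_mk {P : MvPolynomial (Fin 3) K} (hP : P.IsHomogeneous d) (x : Fin 3 → K) (hx : x ≠ 0) :
    OnCurve P (Projectivization.mk K x hx) ↔ eval x P = 0 := by
  obtain ⟨a, ha⟩ := Projectivization.exists_smul_eq_mk_rep K x hx
  rw [OnCurve, ← ha, Units.smul_def, hom_eval hP]
  simp

lemma dot_mk (l x : Fin 3 → K) (hx : x ≠ 0) :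
    (∑ i, l i * (Projectivization.mk K x hx).rep i = 0) ↔ l ⬝ᵥ x = 0 := by
  obtain ⟨a, ha⟩ := Projectivization.exists_smul_eq_mk_rep K x hx
  rw [← ha, Units.smul_def]
  change l ⬝ᵥ ((a : K) • x) = 0 ↔ _
  rw [dotProduct_smul]; simp

variable (M : Matrix (Fin 3) (Fin 3) K) (hM : IsUnit M.det)

include hM in
lemma vm_inj {y z : Fin 3 → K} (h : y ᵥ* M = z ᵥ* M) : y = z := by
  have := congrArg (· ᵥ* M⁻¹) h
  simpa [vecMul_vecMul, Matrix.mul_nonsing_inv M hM] using this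

include hM in
lemma vm_surj (x : Fin 3 → K) : ∃ y, y ᵥ* M = x := by
  refine ⟨x ᵥ* M⁻¹, ?_⟩
  simp [vecMul_vecMul, Matrix.nonsing_inv_mul M hM]

include hM in
lemma vm_ne {y : Fin 3 → K} (h : y ≠ 0) : y ᵥ* M ≠ 0 := by
  intro h0
  apply h
  apply vm_inj M hM
  rw [h0, zero_vecMul]

lemma mv_line {L L' : P2 K} (hM : IsUnit M.det) {a : K} (h : M *ᵥ L.rep = a • (M *ᵥ L'.rep)) : L = L' := by
  rw [← mulVec_smul] at h
  have h2 := congrArg (M⁻¹ *ᵥ ·) h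
  simp only [mulVec_mulVec, Matrix.nonsing_inv_mul M hM, one_mulVec] at h2
  rw [← L.mk_rep, ← L'.mk_rep, Projectivization.mk_eq_mk_iff']
  exact ⟨a, h2.symm⟩

open Classical in
noncomputable def lcode (L : P2 K) : (K × K) ⊕ Option K :=
  if (M *ᵥ L.rep) 1 ≠ 0 then Sum.inl (-((M *ᵥ L.rep) 0 / (M *ᵥ L.rep) 1), -((M *ᵥ L.rep) 2 / (M *ᵥ L.rep) 1))
  else Sum.inr (if (M *ᵥ L.rep) 2 ≠ 0 then some ((M *ᵥ L.rep) 0 / (M *ᵥ L.rep) 2) else none)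

include hM in
lemma mv_ne (L : P2 K) : M *ᵥ L.rep ≠ 0 := by
  intro h
  have h2 := congrArg (M⁻¹ *ᵥ ·) h
  simp only [mulVec_mulVec, Matrix.nonsing_inv_mul M hM, one_mulVec, mulVec_zero] at h2
  exact L.rep_nonzero h2

include hM in
lemma lcode_inj : Function.Injective (lcode M) := by
  intro L L' h
  have hL := mv_ne M hM L
  have hL' := mv_ne M hM L'
  have key : ∀ a, M *ᵥ L.rep = a • (M *ᵥ L'.rep) → L = L' := fun a => mv_line M hM
  set m := M *ᵥ L.rep with hm
  set m' := M *ᵥ L'.rep with hm'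
  have ex : ∀ u : Fin 3 → K, u 0 = 0 → u 1 = 0 → u 2 = 0 → u = 0 := by
    intro u h0 h1 h2; funext i; fin_cases i <;> simpa
  rw [lcode, lcode, ← hm, ← hm'] at h
  clear_value m m'
  clear hm hm'
  by_cases h1 : m 1 = 0 <;> by_cases h1' : m' 1 = 0 <;> simp only [h1, h1', ne_eq, not_true, not_false_eq_true, if_true, if_false] at h
  · by_cases h2 : m 2 = 0 <;> by_cases h2' : m' 2 = 0 <;> simp [h2, h2'] at h
    · apply key (m 0 / m' 0)
      have h0 : m' 0 ≠ 0 := fun h0 => hL' (ex _ h0 h1' h2')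
      funext i; fin_cases i <;> simp [*]
    · apply key (m 2 / m' 2)
      funext i; fin_cases i <;> simp [*]
      field_simp at h ⊢; linear_combination h
  · simp at h
  · simp at h
  · simp at h
    apply key (m 1 / m' 1)
    obtain ⟨ha, hb⟩ := h
    funext i; fin_cases i <;> simp [*] <;> field_simp at ha hb ⊢
    · linear_combination ha
    · linear_combination hb

lemma lcode_inl {L : P2 K} {c v : K} (h : lcode M L = Sum.inl (c, v)) :
    (M *ᵥ L.rep) 1 ≠ 0 ∧ (M *ᵥ L.rep) 0 = - c * (M *ᵥ L.rep) 1 ∧ (M *ᵥ L.rep) 2 = - v * (M *ᵥ L.rep) 1 := by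
  rw [lcode] at h
  split_ifs at h with h1
  simp only [Sum.inl.injEq, Prod.mk.injEq] at h
  refine ⟨h1, ?_, ?_⟩
  · rw [← h.1]; field_simp; try simp
  · rw [← h.2]; field_simp; try simp

include hM in
/-- points of the line `L` on the curve, in terms of the affine parameter `T` -/
lemma pts_card {P : MvPolynomial (Fin 3) K} (hP : P.IsHomogeneous d) (hd : d ≠ 0) {L : P2 K} {c v : K} (h : lcode M L = Sum.inl (c, v))
    (hδ : eval ((![1, c, 0] : Fin 3 → K) ᵥ* M) P ≠ 0) :
    Nat.card {x : P2 K // OnCurve P x ∧ Incid L x} = Nat.card {T : K // eval ((![T, v + T * c, 1] : Fin 3 → K) ᵥ* M) P = 0} := by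
  obtain ⟨h1, h0, h2⟩ := lcode_inl M h
  have hne : ∀ T : K, (![T, v + T * c, 1] : Fin 3 → K) ≠ 0 := by
    intro T h; have := congrFun h 2; simp at this
  have hdot : ∀ y : Fin 3 → K, L.rep ⬝ᵥ (y ᵥ* M) = (M *ᵥ L.rep) 1 * (y 1 - c * y 0 - v * y 2) := by
    intro y
    rw [dotProduct_comm, ← dotProduct_mulVec, dotProduct, Fin.sum_univ_three, h0, h2]; ring
  symm
  refine Nat.card_congr (Equiv.ofBijective (fun T => ⟨Projectivization.mk K _ (vm_ne M hM (hne T.1)), ?_, ?_⟩) ⟨?_, ?_⟩)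
  · rw [onCurve_mk hP]; exact T.2
  · rw [Incid, dot_mk, hdot]; simp; right; ring
  · rintro ⟨T, hT⟩ ⟨T', hT'⟩ hTT
    simp only [Subtype.mk.injEq] at hTT ⊢
    rw [Projectivization.mk_eq_mk_iff'] at hTT
    obtain ⟨a, ha⟩ := hTT
    rw [← smul_vecMul] at ha
    have := vm_inj M hM ha
    have e2 := congrFun this 2
    have e0 := congrFun this 0
    simp at e2 e0
    rw [e2] at e0; simpa using e0.symm
  · rintro ⟨x, hx, hLx⟩
    obtain ⟨y, hy⟩ := vm_surj M hM x.rep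
    have hl : L.rep ⬝ᵥ x.rep = 0 := hLx
    rw [← hy, hdot] at hl
    have hl' := (mul_eq_zero.1 hl).resolve_left h1
    rw [OnCurve, ← hy] at hx
    have hy0 : y ≠ 0 := by
      rintro rfl; rw [zero_vecMul] at hy; exact x.rep_nonzero hy.symm
    have hy2 : y 2 ≠ 0 := by
      intro hy2
      have : y = y 0 • (![1, c, 0] : Fin 3 → K) := by
        funext i; fin_cases i <;> simp [hy2]
        rw [hy2] at hl'; linear_combination hl'
      rw [this, smul_vecMul, hom_eval hP] at hx
      have := (mul_eq_zero.1 hx).resolve_right hδ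
      have h00 := pow_eq_zero_iff hd |>.1 this
      apply hy0; rw [‹y = _›, h00, zero_smul]
    have hyy : y = y 2 • (![y 0 / y 2, v + y 0 / y 2 * c, 1] : Fin 3 → K) := by
      funext i; fin_cases i <;> simp <;> field_simp
      linear_combination hl'
    refine ⟨⟨y 0 / y 2, ?_⟩, ?_⟩
    · rw [hyy, smul_vecMul, hom_eval hP] at hx
      exact (mul_eq_zero.1 hx).resolve_left (pow_ne_zero _ hy2)
    · apply Subtype.ext
      simp only
      rw [← x.mk_rep, Projectivization.mk_eq_mk_iff']
      refine ⟨(y 2)⁻¹, ?_⟩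
      have e : y ᵥ* M = y 2 • ((![y 0 / y 2, v + y 0 / y 2 * c, 1] : Fin 3 → K) ᵥ* M) := by
        rw [← smul_vecMul, ← hyy]
      rw [← hy, e, smul_smul, inv_mul_cancel₀ hy2, one_smul]
end lin
end IncAux

namespace IncAux
open IncidenceProb Matrix

section lines
variable {K k : Type} [Field K] [Fintype K] [Field k] [IsAlgClosed k] (p : ℕ) [Fact p.Prime] [CharP k p] (ι : K →+* k)
  {n : ℕ} (hcard : Fintype.card K = p ^ n)

include hcard in
lemma fix_iff (x : k) : x ^ (p ^ n) = x ↔ ∃ a, ι a = x := by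
  classical
  constructor
  · intro h
    have h1 : 1 < p ^ n := hcard ▸ Fintype.one_lt_card
    have hX : (Polynomial.X ^ (p ^ n) - Polynomial.X : Polynomial k) ≠ 0 := FiniteField.X_pow_card_sub_X_ne_zero k h1
    have hsub : Finset.univ.image ι ⊆ (Polynomial.X ^ (p ^ n) - Polynomial.X : Polynomial k).roots.toFinset := by
      intro y hy
      obtain ⟨a, -, rfl⟩ := Finset.mem_image.1 hy
      rw [Multiset.mem_toFinset, Polynomial.mem_roots hX, Polynomial.IsRoot]
      simp [← map_pow, ← hcard, FiniteField.pow_card]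
    have he := Finset.eq_of_subset_of_card_le hsub (by
      rw [Finset.card_image_of_injective _ ι.injective, Finset.card_univ, hcard]
      refine (Multiset.toFinset_card_le _).trans ((Polynomial.card_roots' _).trans ?_)
      rw [FiniteField.X_pow_card_sub_X_natDegree_eq k h1])
    have : x ∈ (Polynomial.X ^ (p ^ n) - Polynomial.X : Polynomial k).roots.toFinset := by
      rw [Multiset.mem_toFinset, Polynomial.mem_roots hX, Polynomial.IsRoot]
      simp [h]
    rw [← he] at this
    obtain ⟨a, -, ha⟩ := Finset.mem_image.1 this
    exact ⟨a, ha⟩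
  · rintro ⟨a, rfl⟩
    rw [← map_pow, ← hcard, FiniteField.pow_card]

include hcard in
lemma frob_map (R : MvPolynomial (Fin 3) K) (x : Fin 3 → k) :
    MvPolynomial.aeval (fun i => x i ^ (p ^ n)) (map ι R) = (MvPolynomial.aeval x (map ι R)) ^ (p ^ n) := by
  induction R using MvPolynomial.induction_on with
  | C r =>
    have := (fix_iff p ι hcard (ι r)).2 ⟨r, rfl⟩
    simp [this]
  | add a b ha hb => simp only [map_add]; rw [ha, hb, add_pow_char_pow]
  | mul_X a i ha => simp only [map_mul, map_X, aeval_X]; rw [ha, mul_pow]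

lemma aeval_map_eval (R : MvPolynomial (Fin 3) K) (x : Fin 3 → K) (x' : Fin 3 → k) (h : ∀ i, x' i = ι (x i)) :
    MvPolynomial.aeval x' (map ι R) = ι (eval x R) := by
  have : x' = fun i => ι (x i) := funext h
  rw [this]
  induction R using MvPolynomial.induction_on with
  | C r => simp
  | add a b ha hb => simp only [map_add]; rw [ha, hb]
  | mul_X a i ha => simp only [map_mul, map_X, aeval_X]; rw [ha]; simp

variable {d : ℕ} {P : MvPolynomial (Fin 3) K} (hP : P.IsHomogeneous d) (hd : d ≠ 0) (M : Matrix (Fin 3) (Fin 3) K) (hM : IsUnit M.det)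
  {u : K} (hu : u ≠ 0) (Q : MvPolynomial (Fin 3) K) (hQ : ∀ y, eval y Q = u * eval (y ᵥ* M) P)
  (hn : 2 * d.factorial * d ^ 2 + 3 * d ^ 2 + 8 ≤ p ^ (n / 2))
  (bad : Finset k) (hb : ∀ c ∉ bad, MvPolynomial.aeval (![1, c, 0] : Fin 3 → k) (map ι Q) ≠ 0 ∧ ∃ Φ : Frame k d, Φ.g = gT (map ι Q) c)

include hu hQ in
lemma q_zero (y : Fin 3 → K) : eval (y ᵥ* M) P = 0 ↔ eval y Q = 0 := by
  rw [hQ]; simp [hu]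

include hcard hu hQ in
lemma t_count (c v : K) : {T : k | T ^ (p ^ n) = T ∧ MvPolynomial.aeval (![T, ι v + T * ι c, 1] : Fin 3 → k) (map ι Q) = 0}.ncard
    = Nat.card {T : K // eval ((![T, v + T * c, 1] : Fin 3 → K) ᵥ* M) P = 0} := by
  have : {T : k | T ^ (p ^ n) = T ∧ MvPolynomial.aeval (![T, ι v + T * ι c, 1] : Fin 3 → k) (map ι Q) = 0}
      = ι '' {T : K | eval ((![T, v + T * c, 1] : Fin 3 → K) ᵥ* M) P = 0} := by
    have key : ∀ T : K, MvPolynomial.aeval (![ι T, ι v + ι T * ι c, 1] : Fin 3 → k) (map ι Q) = 0 ↔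
        eval ((![T, v + T * c, 1] : Fin 3 → K) ᵥ* M) P = 0 := by
      intro T
      rw [q_zero M hu Q hQ, aeval_map_eval ι Q ![T, v + T * c, 1] _ (by intro i; fin_cases i <;> simp)]
      simp
    ext x
    simp only [Set.mem_setOf_eq, Set.mem_image, fix_iff p ι hcard]
    constructor
    · rintro ⟨⟨T, rfl⟩, h⟩
      exact ⟨T, (key T).1 h, rfl⟩
    · rintro ⟨T, h, rfl⟩
      exact ⟨⟨T, rfl⟩, (key T).2 h⟩
  rw [this, Set.ncard_image_of_injective _ ι.injective, ← Nat.card_coe_set_eq]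
  rfl

include hcard hu hQ hn hb hP hd hM in
theorem lines_le (m : ℕ) : d.factorial * Nat.card {L : P2 K // Nat.card {x : P2 K // OnCurve P x ∧ Incid L x} = m} ≤
    d.factorial * (p ^ n + 1) + d.factorial * bad.card * p ^ n +
    p ^ n * (Dm d m * (p ^ n + (1 + d.factorial * (4 * d ^ 2 + 4)) * p ^ (n - n / 2)) + d.factorial * (d.factorial * (d * d))) := by
  classical
  set B := Dm d m * (p ^ n + (1 + d.factorial * (4 * d ^ 2 + 4)) * p ^ (n - n / 2)) + d.factorial * (d.factorial * (d * d)) with hB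
  set g : K → K → Prop := fun c v => Nat.card {T : K // eval ((![T, v + T * c, 1] : Fin 3 → K) ᵥ* M) P = 0} = m with hg
  have h1 : ∀ c : K, ι c ∉ bad → d.factorial * (Finset.univ.filter (fun v => g c v)).card ≤ B := by
    intro c hc
    obtain ⟨hδ, Φ, hΦ⟩ := hb _ hc
    have hcg := count_good p hδ Φ hΦ n hn (frob_map p ι hcard Q) ((fix_iff p ι hcard _).2 ⟨c, rfl⟩) m
    refine le_trans (Nat.mul_le_mul_left _ ?_) hcg.2
    rw [← Finset.card_image_of_injective _ ι.injective, ← Set.ncard_coe_finset]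
    refine Set.ncard_le_ncard ?_ hcg.1
    intro x hx
    obtain ⟨v, hv, rfl⟩ := Finset.mem_image.1 (Finset.mem_coe.1 hx)
    refine ⟨(fix_iff p ι hcard _).2 ⟨v, rfl⟩, ?_⟩
    rw [t_count p ι hcard M hu Q hQ]
    exact (Finset.mem_filter.1 hv).2
  have h2 : Nat.card {L : P2 K // Nat.card {x : P2 K // OnCurve P x ∧ Incid L x} = m} ≤
      ((Finset.univ.filter (fun cv : K × K => ι cv.1 ∈ bad ∨ g cv.1 cv.2)).disjSum (Finset.univ : Finset (Option K))).card := by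
    set U := (Finset.univ.filter (fun cv : K × K => ι cv.1 ∈ bad ∨ g cv.1 cv.2)).disjSum (Finset.univ : Finset (Option K)) with hU
    have hmem : ∀ L : P2 K, Nat.card {x : P2 K // OnCurve P x ∧ Incid L x} = m → lcode M L ∈ U := by
      intro L hL
      rcases hl : lcode M L with ⟨c, v⟩ | o
      · rw [hU, Finset.inl_mem_disjSum, Finset.mem_filter]
        refine ⟨Finset.mem_univ _, ?_⟩
        by_cases hc : ι c ∈ bad
        · exact Or.inl hc
        · right
          have hδ := (hb _ hc).1
          rw [aeval_map_eval ι Q ![1, c, 0] _ (by intro i; fin_cases i <;> simp)] at hδ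
          rw [pts_card M hM hP hd hl (fun h0 => hδ (by rw [(q_zero M hu Q hQ _).1 h0, map_zero]))] at hL
          exact hL
      · rw [hU, Finset.inr_mem_disjSum]; exact Finset.mem_univ _
    have := Nat.card_le_card_of_injective (fun L : {L : P2 K // Nat.card {x : P2 K // OnCurve P x ∧ Incid L x} = m} => (⟨lcode M L.1, hmem _ L.2⟩ : U))
      (fun L L' h => Subtype.ext (lcode_inj M hM (congrArg Subtype.val h)))
    rwa [Nat.card_eq_fintype_card (α := U), Fintype.card_coe] at this
  refine (Nat.mul_le_mul_left _ h2).trans ?_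
  rw [Finset.card_disjSum, Finset.card_univ, Fintype.card_option, hcard]
  have h3 : (Finset.univ.filter (fun cv : K × K => ι cv.1 ∈ bad ∨ g cv.1 cv.2)).card = ∑ c : K, (Finset.univ.filter (fun v => ι c ∈ bad ∨ g c v)).card := by
    rw [Finset.card_filter, ← Finset.univ_product_univ, Finset.sum_product]
    simp_rw [Finset.card_filter]
  have h4 : d.factorial * (∑ c : K, (Finset.univ.filter (fun v => ι c ∈ bad ∨ g c v)).card) ≤ ∑ c : K, ((if ι c ∈ bad then d.factorial * p ^ n else 0) + B) := by
    rw [Finset.mul_sum]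
    refine Finset.sum_le_sum fun c _ => ?_
    split_ifs with h
    · refine le_trans (Nat.mul_le_mul_left _ ?_) (Nat.le_add_right _ _)
      rw [← hcard]; exact Finset.card_le_univ _
    · simpa [h] using h1 c h
  have h5 : (Finset.univ.filter (fun c : K => ι c ∈ bad)).card ≤ bad.card := by
    rw [← Finset.card_image_of_injective _ ι.injective]
    apply Finset.card_le_card
    intro x hx
    obtain ⟨v, hv, rfl⟩ := Finset.mem_image.1 hx
    exact (Finset.mem_filter.1 hv).2
  rw [Finset.sum_add_distrib, ← Finset.sum_filter, Finset.sum_const, Finset.sum_const, Finset.card_univ, hcard, smul_eq_mul, smul_eq_mul, ← h3] at h4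
  have h6 := Nat.mul_le_mul_right (d.factorial * p ^ n) h5
  nlinarith
end lines
end IncAux

namespace IncAux
open IncidenceProb Matrix

section res
lemma res_sep {k : Type} [Field k] {f : Polynomial k} {d : ℕ} (hd : 2 ≤ d) (hf : f.natDegree ≤ d)
    (h : f.resultant f.derivative d (d-1) ≠ 0) : f.Separable := by
  obtain ⟨a, b, -, -, e⟩ := Polynomial.exists_mul_add_mul_eq_C_resultant f f.derivative hf
    ((Polynomial.natDegree_derivative_le f).trans (Nat.sub_le_sub_right hf 1)) (Or.inl (by omega : d ≠ 0))
  refine ⟨Polynomial.C (f.resultant f.derivative d (d-1))⁻¹ * a, Polynomial.C (f.resultant f.derivative d (d-1))⁻¹ * b, ?_⟩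
  have : Polynomial.C (f.resultant f.derivative d (d-1))⁻¹ * Polynomial.C (f.resultant f.derivative d (d-1)) = 1 := by
    rw [← Polynomial.C_mul, inv_mul_cancel₀ h, Polynomial.C_1]
  rw [← this, ← e]; ring

lemma sep_res {k : Type} [Field k] {f : Polynomial k} {d : ℕ} (hf : f.natDegree = d) (hf0 : f ≠ 0) (h : f.Separable) :
    f.resultant f.derivative d (d-1) ≠ 0 := by
  have h2 := Polynomial.resultant_ne_zero f f.derivative h
  have h3 : f.derivative.natDegree ≤ d - 1 := by rw [← hf]; exact Polynomial.natDegree_derivative_le f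
  obtain ⟨e, he⟩ := Nat.exists_eq_add_of_le h3
  rw [he, Polynomial.resultant_add_right_deg _ _ _ _ e le_rfl, ← hf]
  refine mul_ne_zero (pow_ne_zero _ ?_) h2
  exact Polynomial.leadingCoeff_ne_zero.2 hf0
end res

section QM
variable {K : Type} [Field K] {d : ℕ}

noncomputable def lsub (M : Matrix (Fin 3) (Fin 3) K) : MvPolynomial (Fin 3) K →ₐ[K] MvPolynomial (Fin 3) K :=
  MvPolynomial.aeval (fun i => ∑ j, C (M j i) * X j)

noncomputable def QM (P : MvPolynomial (Fin 3) K) (M : Matrix (Fin 3) (Fin 3) K) : MvPolynomial (Fin 3) K :=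
  C (eval (M 2) P)⁻¹ * lsub M P

lemma aeval_lsub {A : Type} [CommRing A] [Algebra K A] (P : MvPolynomial (Fin 3) K) (M : Matrix (Fin 3) (Fin 3) K) (y : Fin 3 → A) :
    MvPolynomial.aeval y (lsub M P) = MvPolynomial.aeval (fun i => ∑ j, y j * algebraMap K A (M j i)) P := by
  rw [lsub, aeval_map_alg]
  congr 2; funext i
  simp [mul_comm]

lemma eval_lsub (P : MvPolynomial (Fin 3) K) (M : Matrix (Fin 3) (Fin 3) K) (y : Fin 3 → K) :
    eval y (lsub M P) = eval (y ᵥ* M) P := by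
  have := aeval_lsub P M y
  simp only [MvPolynomial.coe_aeval_eq_eval, Algebra.algebraMap_self, RingHom.id_apply] at this
  exact this

lemma eval_QM (P : MvPolynomial (Fin 3) K) (M : Matrix (Fin 3) (Fin 3) K) (y : Fin 3 → K) :
    eval y (QM P M) = (eval (M 2) P)⁻¹ * eval (y ᵥ* M) P := by
  rw [QM, map_mul, eval_C, eval_lsub]

lemma row2 (M : Matrix (Fin 3) (Fin 3) K) : (![0, 0, 1] : Fin 3 → K) ᵥ* M = M 2 := by
  funext i; simp [vecMul, dotProduct, Fin.sum_univ_three]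

lemma QM_h1 (P : MvPolynomial (Fin 3) K) (M : Matrix (Fin 3) (Fin 3) K) (h : eval (M 2) P ≠ 0) :
    eval ![0, 0, 1] (QM P M) = 1 := by
  rw [eval_QM, row2, inv_mul_cancel₀ h]

lemma QM_hom {P : MvPolynomial (Fin 3) K} (hP : P.IsHomogeneous d) (M : Matrix (Fin 3) (Fin 3) K) : (QM P M).IsHomogeneous d := by
  rw [QM, ← zero_add d]
  refine (isHomogeneous_C _ _).mul ?_
  rw [lsub]
  have := MvPolynomial.IsHomogeneous.aeval hP (fun i => ∑ j, C (M j i) * X j) (n := 1) (fun i => by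
    refine IsHomogeneous.sum _ _ _ fun j _ => ?_
    simpa using (isHomogeneous_C _ (M j i)).mul (isHomogeneous_X K j))
  simpa using this

lemma lsub_comp (M N : Matrix (Fin 3) (Fin 3) K) (h : N * M = 1) : (lsub N).comp (lsub M) = AlgHom.id K _ := by
  apply MvPolynomial.algHom_ext
  intro i
  simp only [lsub, AlgHom.comp_apply, aeval_X, map_sum, map_mul, AlgHom.coe_id, id]
  have : ∀ j, MvPolynomial.aeval (fun i => ∑ j, C (N j i) * X j) (C (M j i)) = (C (M j i) : MvPolynomial (Fin 3) K) := fun j => by simp [MvPolynomial.algebraMap_eq]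
  simp only [this, Finset.mul_sum]
  rw [Finset.sum_comm]
  have h2 : ∀ l, ∑ j, C (M j i) * (C (N l j) * X l) = C ((N * M) l i) * (X l : MvPolynomial (Fin 3) K) := by
    intro l
    rw [Matrix.mul_apply, map_sum, Finset.sum_mul]
    refine Finset.sum_congr rfl fun j _ => ?_
    rw [C_mul]; ring
  simp only [h2, h, Matrix.one_apply]
  simp

lemma QM_irr {P : MvPolynomial (Fin 3) K} (hP : Irreducible P) (M : Matrix (Fin 3) (Fin 3) K) (hM : IsUnit M.det) (h : eval (M 2) P ≠ 0) :
    Irreducible (QM P M) := by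
  have hu : IsUnit (C (eval (M 2) P)⁻¹ : MvPolynomial (Fin 3) K) := (IsUnit.mk0 _ (inv_ne_zero h)).map C
  rw [QM, irreducible_isUnit_mul hu]
  let e := AlgEquiv.ofAlgHom (lsub M) (lsub M⁻¹) (lsub_comp _ _ (Matrix.mul_nonsing_inv M hM)) (lsub_comp _ _ (Matrix.nonsing_inv_mul M hM))
  have := (MulEquiv.irreducible_iff e (x := P)).2 hP
  exact this

lemma pl_QM (P : MvPolynomial (Fin 3) K) (M : Matrix (Fin 3) (Fin 3) K) (a b : Fin 3 → K) :
    pl (QM P M) a b = Polynomial.C (eval (M 2) P)⁻¹ * pl P (a ᵥ* M) (b ᵥ* M) := by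
  have e : (fun i => ∑ j, (Polynomial.C (a j) + Polynomial.X * Polynomial.C (b j)) * algebraMap K (Polynomial K) (M j i)) =
      fun i => Polynomial.C ((a ᵥ* M) i) + Polynomial.X * Polynomial.C ((b ᵥ* M) i) := by
    funext i
    simp only [vecMul, dotProduct, Fin.sum_univ_three, Polynomial.algebraMap_apply, Algebra.algebraMap_self, RingHom.id_apply,
      Polynomial.C_add, Polynomial.C_mul]; ring
  rw [pl, QM, map_mul, aeval_lsub, pl, e]
  rw [MvPolynomial.aeval_C, Polynomial.algebraMap_apply, Algebra.algebraMap_self, RingHom.id_apply]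

/-- gradient -/
noncomputable def gr (P : MvPolynomial (Fin 3) K) (z : Fin 3 → K) : Fin 3 → K := fun r => eval z (pderiv r P)

lemma pl_eval' (P : MvPolynomial (Fin 3) K) (a b : Fin 3 → K) (x : K) : (pl P a b).eval x = eval (a + x • b) P := by
  rw [pl_eval, MvPolynomial.aeval_eq_eval]; rfl

lemma pl_der (P : MvPolynomial (Fin 3) K) (a b : Fin 3 → K) (x : K) : (pl P a b).derivative.eval x = b ⬝ᵥ gr P (a + x • b) := by
  rw [pl_derivative, Polynomial.eval_finset_sum, dotProduct]
  refine Finset.sum_congr rfl fun i _ => ?_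
  rw [Polynomial.eval_mul, Polynomial.eval_C, pl_eval', gr]

lemma gr_QM (P : MvPolynomial (Fin 3) K) (M : Matrix (Fin 3) (Fin 3) K) (z : Fin 3 → K) :
    eval z (pderiv 2 (QM P M)) = (eval (M 2) P)⁻¹ * (M 2 ⬝ᵥ gr P (z ᵥ* M)) := by
  have h := pl_der (QM P M) z ![0, 0, 1] 0
  rw [pl_QM, Polynomial.derivative_C_mul, Polynomial.eval_mul, Polynomial.eval_C, pl_der, row2] at h
  simp only [zero_smul, add_zero] at h
  rw [h]
  simp [dotProduct, Fin.sum_univ_three, gr]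

lemma gr_smul {P : MvPolynomial (Fin 3) K} (hP : P.IsHomogeneous d) (c : K) (z : Fin 3 → K) :
    gr P (c • z) = c ^ (d - 1) • gr P z := by
  funext i
  rw [gr, hom_eval hP.pderiv]; rfl

lemma gr_euler {P : MvPolynomial (Fin 3) K} (hP : P.IsHomogeneous d) (z : Fin 3 → K) :
    z ⬝ᵥ gr P z = d * eval z P := by
  have := congrArg (eval z) hP.sum_X_mul_pderiv
  simpa [map_sum, dotProduct, gr] using this
end QM
end IncAux

namespace IncAux
open IncidenceProb Matrix

lemma tan_of {k : Type} [Field k] {d : ℕ} {R : MvPolynomial (Fin 3) k} (hR : R.IsHomogeneous d) (hd : 2 ≤ d)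
    {a : Fin 3 → k} (hcard : Nat.card {x : P2 k // OnCurve R x ∧ (∑ i, a i * x.rep i = 0)} = d - 1)
    (hsm : ∀ x : P2 k, OnCurve R x → (∑ i, a i * x.rep i = 0) → gr R x.rep ≠ 0)
    {x₀ : P2 k} (hx₀ : OnCurve R x₀ ∧ (∑ i, a i * x₀.rep i = 0)) (hx₁ : ∃ c : k, gr R x₀.rep = c • a)
    (huniq : ∀ x : P2 k, OnCurve R x → (∑ i, a i * x.rep i = 0) → (∃ c : k, gr R x.rep = c • a) → x = x₀)
    (M : Matrix (Fin 3) (Fin 3) k) (hM : IsUnit M.det) (hw : eval (M 2) R ≠ 0) (haw : a ⬝ᵥ M 2 ≠ 0)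
    (h4 : eval ((a ⬝ᵥ M 2) • M 1 - (a ⬝ᵥ M 1) • M 2) R ≠ 0) :
    ∃ s0 t0 ρ0, ∃ ρ' : Fin (d-2) → k, Tan (QM R M) d s0 t0 ρ0 ρ' := by
  classical
  set s0 := - (a ⬝ᵥ M 0) / (a ⬝ᵥ M 2) with hs0
  set t0 := - (a ⬝ᵥ M 1) / (a ⬝ᵥ M 2) with ht0
  set A := (![1, 0, s0] : Fin 3 → k) ᵥ* M with hA
  set B := (![0, 1, t0] : Fin 3 → k) ᵥ* M with hB
  have eA : A = M 0 + s0 • M 2 := by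
    funext i; simp [hA, vecMul, dotProduct, Fin.sum_univ_three]
  have eB : B = M 1 + t0 • M 2 := by
    funext i; simp [hB, vecMul, dotProduct, Fin.sum_univ_three]
  have aA : a ⬝ᵥ A = 0 := by
    rw [eA, dotProduct_add, dotProduct_smul, hs0, smul_eq_mul]; field_simp; ring
  have aB : a ⬝ᵥ B = 0 := by
    rw [eB, dotProduct_add, dotProduct_smul, ht0, smul_eq_mul]; field_simp; ring
  have hRB : eval B R ≠ 0 := by
    have : (a ⬝ᵥ M 2) • M 1 - (a ⬝ᵥ M 1) • M 2 = (a ⬝ᵥ M 2) • B := by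
      rw [eB, smul_add, smul_smul, ht0, mul_div_cancel₀ _ haw, neg_smul, sub_eq_add_neg]
    rw [this, hom_eval hR] at h4
    exact right_ne_zero_of_mul h4
  have hspan : ∀ z, a ⬝ᵥ z = 0 → ∃ x y : k, z = x • A + y • B := by
    intro z hz
    obtain ⟨y, rfl⟩ := vm_surj M hM z
    have e : y ᵥ* M = y 0 • M 0 + y 1 • M 1 + y 2 • M 2 := by
      funext i; simp [vecMul, dotProduct, Fin.sum_univ_three]
    rw [e] at hz ⊢
    simp only [dotProduct_add, dotProduct_smul, smul_eq_mul] at hz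
    have : y 2 = y 0 * s0 + y 1 * t0 := by
      rw [hs0, ht0]; field_simp; linear_combination hz
    refine ⟨y 0, y 1, ?_⟩
    rw [eA, eB, this]; simp only [smul_add, smul_smul, add_smul]; abel
  have hli : ∀ x y x' y' : k, x • A + y • B = x' • A + y' • B → x = x' ∧ y = y' := by
    intro x y x' y' h
    rw [hA, hB, ← smul_vecMul, ← smul_vecMul, ← smul_vecMul, ← smul_vecMul, ← add_vecMul, ← add_vecMul] at h
    have := vm_inj M hM h
    have h0 := congrFun this 0
    have h1 := congrFun this 1
    simp at h0 h1
    exact ⟨h0, h1⟩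
  have hzne : ∀ T : k, A + T • B ≠ 0 := by
    intro T h
    have := (hli 1 T 0 0 (by simpa using h)).1
    exact one_ne_zero this
  have hza : ∀ T : k, a ⬝ᵥ (A + T • B) = 0 := by
    intro T; rw [dotProduct_add, dotProduct_smul, aA, aB]; simp
  have hpar : ∀ x : P2 k, OnCurve R x → (∑ i, a i * x.rep i = 0) → ∃ e T : k, e ≠ 0 ∧ x.rep = e • (A + T • B) := by
    intro x hx hax
    obtain ⟨e, y, h⟩ := hspan x.rep hax
    have he : e ≠ 0 := by
      rintro rfl
      rw [zero_smul, zero_add] at h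
      rw [OnCurve, h, hom_eval hR] at hx
      have := pow_eq_zero_iff (by omega) |>.1 ((mul_eq_zero.1 hx).resolve_right hRB)
      rw [this, zero_smul] at h
      exact x.rep_nonzero h
    exact ⟨e, y / e, he, by rw [smul_add, smul_smul, mul_div_cancel₀ _ he, h]⟩
  set f := pl R A B with hf
  have hfe : ∀ T, f.eval T = eval (A + T • B) R := pl_eval' R A B
  have hp0 : p0 (QM R M) s0 t0 = Polynomial.C (eval (M 2) R)⁻¹ * f := pl_QM R M _ _
  have hui : (eval (M 2) R)⁻¹ ≠ 0 := inv_ne_zero hw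
  have hf0 : f ≠ 0 := by
    intro h
    have := (pl_deg R hR A B).2
    rw [← hf, h, MvPolynomial.aeval_eq_eval] at this
    exact hRB (by simpa using this.symm)
  obtain ⟨e0, ρ0, he0, hρ0⟩ := hpar x₀ hx₀.1 hx₀.2
  have hroot0 : f.eval ρ0 = 0 := by
    have := hx₀.1
    rw [OnCurve, hρ0, hom_eval hR] at this
    rw [hfe]; exact (mul_eq_zero.1 this).resolve_left (pow_ne_zero _ he0)
  have hcnt : f.roots.toFinset.card = d - 1 := by
    rw [← hcard]
    have : Nat.card {T : k // T ∈ f.roots.toFinset} = f.roots.toFinset.card := by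
      rw [Nat.card_eq_fintype_card, Fintype.card_coe]
    rw [← this]
    have hmem : ∀ T, T ∈ f.roots.toFinset ↔ eval (A + T • B) R = 0 := by
      intro T; rw [Multiset.mem_toFinset, Polynomial.mem_roots hf0, Polynomial.IsRoot, hfe]
    refine Nat.card_congr (Equiv.ofBijective (fun T => ⟨Projectivization.mk k _ (hzne T.1), ?_, ?_⟩) ⟨?_, ?_⟩)
    · rw [onCurve_mk hR]; exact (hmem _).1 T.2
    · rw [dot_mk]; exact hza _
    · rintro ⟨T, hT⟩ ⟨T', hT'⟩ h
      simp only [Subtype.mk.injEq] at h ⊢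
      rw [Projectivization.mk_eq_mk_iff'] at h
      obtain ⟨b, hb⟩ := h
      have := hli b (b * T') 1 T (by rw [one_smul, ← hb, smul_add, smul_smul])
      rw [this.1, one_mul] at this
      exact this.2.symm
    · rintro ⟨x, hx, hax⟩
      obtain ⟨e, T, he, hT⟩ := hpar x hx hax
      refine ⟨⟨T, (hmem T).2 ?_⟩, ?_⟩
      · rw [OnCurve, hT, hom_eval hR] at hx
        exact (mul_eq_zero.1 hx).resolve_left (pow_ne_zero _ he)
      · apply Subtype.ext
        refine Eq.trans ?_ x.mk_rep
        rw [Projectivization.mk_eq_mk_iff']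
        exact ⟨e⁻¹, by simp only; rw [hT, smul_smul, inv_mul_cancel₀ he, one_smul]⟩
  have hcnt2 : (f.roots.toFinset.erase ρ0).card = d - 2 := by
    rw [Finset.card_erase_of_mem, hcnt]
    · omega
    · rw [Multiset.mem_toFinset, Polynomial.mem_roots hf0]; exact hroot0
  let en := (Finset.equivFinOfCardEq hcnt2).symm
  have hρ' : ∀ i, (en i : k) ≠ ρ0 ∧ f.eval (en i : k) = 0 := by
    intro i
    have := (en i).2
    rw [Finset.mem_erase, Multiset.mem_toFinset, Polynomial.mem_roots hf0] at this
    exact this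
  obtain ⟨c, hc⟩ := hx₁
  have hg0 : ∃ c' : k, c' ≠ 0 ∧ gr R (A + ρ0 • B) = c' • a := by
    have e1 : gr R (A + ρ0 • B) = (e0⁻¹ ^ (d - 1) * c) • a := by
      have : A + ρ0 • B = e0⁻¹ • x₀.rep := by rw [hρ0, smul_smul, inv_mul_cancel₀ he0, one_smul]
      rw [this, gr_smul hR, hc, smul_smul]
    refine ⟨e0⁻¹ ^ (d - 1) * c, ?_, e1⟩
    apply mul_ne_zero (pow_ne_zero _ (inv_ne_zero he0))
    rintro rfl
    exact hsm x₀ hx₀.1 hx₀.2 (by rw [hc, zero_smul])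
  obtain ⟨c', hc'0, hc'⟩ := hg0
  refine ⟨s0, t0, ρ0, fun i => en i, ?_, ?_, ?_, ?_, ?_, ?_, ?_⟩
  · rw [MvPolynomial.aeval_eq_eval]
    change eval _ _ ≠ 0
    rw [eval_QM]; exact mul_ne_zero hui hRB
  · intro i j h; exact en.injective (Subtype.ext h)
  · intro i; rw [hp0, Polynomial.eval_mul, (hρ' i).2, mul_zero]
  · intro i
    rw [hp0, Polynomial.derivative_C_mul, Polynomial.eval_mul, Polynomial.eval_C]
    refine mul_ne_zero hui ?_
    intro h0
    obtain ⟨hne, hr⟩ := hρ' i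
    set T : k := (en i : k) with hT
    rw [hf, pl_der] at h0
    rw [hfe] at hr
    set z := A + T • B with hz
    have hE := gr_euler hR z
    rw [hr, mul_zero] at hE
    have hAz : A ⬝ᵥ gr R z = 0 := by
      have : A = z - T • B := by rw [hz]; abel
      rw [this, sub_dotProduct, hE, smul_dotProduct, h0]; simp
    have hgr : gr R z = ((M 2 ⬝ᵥ gr R z) / (a ⬝ᵥ M 2)) • a := by
      rw [← sub_eq_zero]
      set v := gr R z - ((M 2 ⬝ᵥ gr R z) / (a ⬝ᵥ M 2)) • a with hv
      have v2 : M 2 ⬝ᵥ v = 0 := by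
        rw [hv, dotProduct_sub, dotProduct_smul, dotProduct_comm (M 2) a, smul_eq_mul, div_mul_cancel₀ _ haw, sub_self]
      have vA : A ⬝ᵥ v = 0 := by
        rw [hv, dotProduct_sub, dotProduct_smul, dotProduct_comm A a, aA, hAz]; simp
      have vB : B ⬝ᵥ v = 0 := by
        rw [hv, dotProduct_sub, dotProduct_smul, dotProduct_comm B a, aB, h0]; simp
      rw [eA, add_dotProduct, smul_dotProduct, v2, smul_zero, add_zero] at vA
      rw [eB, add_dotProduct, smul_dotProduct, v2, smul_zero, add_zero] at vB
      have hMv : M *ᵥ v = 0 := by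
        funext j; fin_cases j
        · exact vA
        · exact vB
        · exact v2
      have h2 := congrArg (M⁻¹ *ᵥ ·) hMv
      simpa only [mulVec_mulVec, Matrix.nonsing_inv_mul M hM, one_mulVec, mulVec_zero] using h2
    have hxx := huniq (Projectivization.mk k z (hzne T)) ((onCurve_mk hR _ _).2 hr) ((dot_mk _ _ _).2 (hza T)) (by
      obtain ⟨b, hb⟩ := Projectivization.exists_smul_eq_mk_rep k z (hzne T)
      rw [← hb, Units.smul_def, gr_smul hR, hgr, smul_smul]
      exact ⟨_, rfl⟩)
    rw [← x₀.mk_rep, Projectivization.mk_eq_mk_iff'] at hxx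
    obtain ⟨b, hb⟩ := hxx
    rw [hρ0, smul_smul, hz, smul_add, smul_smul] at hb
    have := hli (b * e0) (b * e0 * ρ0) 1 T (by rw [one_smul]; exact hb)
    rw [this.1, one_mul] at this
    exact hne this.2.symm
  · rw [hp0, Polynomial.eval_mul, hroot0, mul_zero]
  · rw [hp0, Polynomial.derivative_C_mul, Polynomial.eval_mul, hf, pl_der, hc', dotProduct_smul, dotProduct_comm, aB]; simp
  · rw [MvPolynomial.aeval_eq_eval]
    change eval _ _ ≠ 0
    rw [gr_QM]
    have : (![1, ρ0, s0 + ρ0 * t0] : Fin 3 → k) ᵥ* M = A + ρ0 • B := by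
      rw [hA, hB, ← smul_vecMul, ← add_vecMul]; congr 1; funext i; fin_cases i <;> simp
    rw [this, hc', dotProduct_smul, dotProduct_comm]
    exact mul_ne_zero hui (smul_ne_zero hc'0 haw)
end IncAux

namespace IncAux
open IncidenceProb Matrix

def TanLine {k : Type} [Field k] (d : ℕ) (R : MvPolynomial (Fin 3) k) (a : Fin 3 → k) : Prop :=
  Nat.card {x : P2 k // OnCurve R x ∧ (∑ i, a i * x.rep i = 0)} = d - 1 ∧
    (∀ x : P2 k, OnCurve R x → (∑ i, a i * x.rep i = 0) → gr R x.rep ≠ 0) ∧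
    ∃ x₀ : P2 k, (OnCurve R x₀ ∧ (∑ i, a i * x₀.rep i = 0)) ∧
      (∃ c : k, gr R x₀.rep = c • a) ∧
      ∀ x : P2 k, OnCurve R x → (∑ i, a i * x.rep i = 0) → (∃ c : k, gr R x.rep = c • a) → x = x₀

structure Good4 {k : Type} [Field k] (R : MvPolynomial (Fin 3) k) (a : Fin 3 → k) (M : Matrix (Fin 3) (Fin 3) k) : Prop where
  det : M.det ≠ 0
  w : eval (M 2) R ≠ 0
  aw : a ⬝ᵥ M 2 ≠ 0
  h4 : eval ((a ⬝ᵥ M 2) • M 1 - (a ⬝ᵥ M 1) • M 2) R ≠ 0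

structure Good6 {k : Type} [Field k] (d : ℕ) (R : MvPolynomial (Fin 3) k) (a : Fin 3 → k) (M : Matrix (Fin 3) (Fin 3) k) : Prop
    extends Good4 R a M where
  r : eval (M 1) R ≠ 0
  res : (pl R (M 0) (M 1)).resultant (pl R (M 0) (M 1)).derivative d (d-1) ≠ 0

section gen
variable {k : Type} [Field k] {d : ℕ} (R : MvPolynomial (Fin 3) k) (a : Fin 3 → k)

abbrev GA (k : Type) [Field k] : Type := MvPolynomial (Fin 3 × Fin 3) k
noncomputable def GM (k : Type) [Field k] : Matrix (Fin 3) (Fin 3) (GA k) := fun i j => X (i, j)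
noncomputable def evM (M : Matrix (Fin 3) (Fin 3) k) : GA k →ₐ[k] k := MvPolynomial.aeval (fun p : Fin 3 × Fin 3 => M p.1 p.2)

lemma evM_X (M : Matrix (Fin 3) (Fin 3) k) (i j) : evM M (GM k i j) = M i j := by simp [evM, GM]

noncomputable def G1 (k : Type) [Field k] : GA k := (GM k).det
noncomputable def GR (i : Fin 3) : GA k := MvPolynomial.aeval (GM k i) R
noncomputable def Gdot (j : Fin 3) : GA k := ∑ i, C (a i) * GM k j i
noncomputable def G4 : GA k := MvPolynomial.aeval (fun i => Gdot a 2 * GM k 1 i - Gdot a 1 * GM k 2 i) R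
noncomputable def G6 (d : ℕ) : GA k := (pl R (GM k 0) (GM k 1)).resultant (pl R (GM k 0) (GM k 1)).derivative d (d-1)

variable (M : Matrix (Fin 3) (Fin 3) k)
lemma ev_G1 : evM M (G1 k) = M.det := by
  have := RingHom.map_det (evM M).toRingHom (GM k)
  refine this.trans ?_
  congr 1; ext i j; exact evM_X M i j

lemma ev_GR (i : Fin 3) : evM M (GR R i) = eval (M i) R := by
  rw [GR, aeval_map_alg, MvPolynomial.aeval_eq_eval]
  congr 2; funext j; exact evM_X M i j

lemma ev_Gdot (j : Fin 3) : evM M (Gdot a j) = a ⬝ᵥ M j := by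
  rw [Gdot, map_sum, dotProduct]
  refine Finset.sum_congr rfl fun i _ => ?_
  rw [map_mul, evM_X, MvPolynomial.algHom_C]; rfl

lemma ev_G4 : evM M (G4 R a) = eval ((a ⬝ᵥ M 2) • M 1 - (a ⬝ᵥ M 1) • M 2) R := by
  rw [G4, aeval_map_alg, MvPolynomial.aeval_eq_eval]
  congr 2; funext j
  rw [map_sub, map_mul, map_mul, evM_X, evM_X, ev_Gdot, ev_Gdot]; rfl

lemma ev_G6 : evM M (G6 R d) = (pl R (M 0) (M 1)).resultant (pl R (M 0) (M 1)).derivative d (d-1) := by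
  have h := Polynomial.resultant_map_map (pl R (GM k 0) (GM k 1)) (pl R (GM k 0) (GM k 1)).derivative d (d-1) (evM M : GA k →+* k)
  rw [← Polynomial.derivative_map, pl_map] at h
  have e : ∀ i, (fun j => evM M (GM k i j)) = M i := fun i => funext fun j => evM_X M i j
  rw [e, e] at h
  exact h.symm

lemma exists_ne [Infinite k] {G : GA k} (h : G ≠ 0) : ∃ M, evM M G ≠ 0 := by
  by_contra hc
  push Not at hc
  apply h
  apply MvPolynomial.funext
  intro x
  have := hc (Matrix.of fun i j => x (i, j))
  rw [evM, MvPolynomial.aeval_eq_eval] at this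
  simpa using this

lemma ne_of_ev {G : GA k} {M} (h : evM M G ≠ 0) : G ≠ 0 := by
  rintro rfl; simp at h

lemma exists_eval_ne [Infinite k] (hR : R ≠ 0) : ∃ z, eval z R ≠ 0 := by
  by_contra hc
  push Not at hc
  exact hR (MvPolynomial.funext fun x => by rw [hc x, map_zero])

lemma line_pt [Infinite k] (hR : R.IsHomogeneous d) (hd : 2 ≤ d) (ha : a ≠ 0) (hT : TanLine d R a) : ∃ z, a ⬝ᵥ z = 0 ∧ eval z R ≠ 0 := by
  by_contra hc
  push Not at hc
  have hfin : Finite {x : P2 k // OnCurve R x ∧ (∑ i, a i * x.rep i = 0)} := by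
    apply Nat.finite_of_card_ne_zero; rw [hT.1]; omega
  -- two independent vectors in the plane orthogonal to `a`
  obtain ⟨u, v, hu, hv, huv⟩ : ∃ u v : Fin 3 → k, a ⬝ᵥ u = 0 ∧ a ⬝ᵥ v = 0 ∧ ∀ x y : k, x • u + y • v = 0 → x = 0 ∧ y = 0 := by
    have h3 : a 0 ≠ 0 ∨ a 1 ≠ 0 ∨ a 2 ≠ 0 := by
      by_contra h; push Not at h
      apply ha; funext i; fin_cases i <;> simp [h]
    have hcase : ∀ u v : Fin 3 → k, a ⬝ᵥ u = 0 → a ⬝ᵥ v = 0 → (∃ i j : Fin 3, u j = 0 ∧ v i = 0 ∧ u i ≠ 0 ∧ v j ≠ 0) →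
        ∃ u v : Fin 3 → k, a ⬝ᵥ u = 0 ∧ a ⬝ᵥ v = 0 ∧ ∀ x y : k, x • u + y • v = 0 → x = 0 ∧ y = 0 := by
      rintro u v hu hv ⟨i, j, h1, h2, h3, h4⟩
      refine ⟨u, v, hu, hv, fun x y h => ?_⟩
      have e1 := congrFun h i
      have e2 := congrFun h j
      simp [h1, h2, h3, h4] at e1 e2
      exact ⟨e1, e2⟩
    rcases h3 with h | h | h
    · exact hcase ![-a 1, a 0, 0] ![-a 2, 0, a 0] (by simp [dotProduct, Fin.sum_univ_three]; ring) (by simp [dotProduct, Fin.sum_univ_three]; ring) ⟨1, 2, by simp [h]⟩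
    · exact hcase ![a 1, -a 0, 0] ![0, -a 2, a 1] (by simp [dotProduct, Fin.sum_univ_three]; ring) (by simp [dotProduct, Fin.sum_univ_three]; ring) ⟨0, 2, by simp [h]⟩
    · exact hcase ![a 2, 0, -a 0] ![0, a 2, -a 1] (by simp [dotProduct, Fin.sum_univ_three]; ring) (by simp [dotProduct, Fin.sum_univ_three]; ring) ⟨0, 1, by simp [h]⟩
  have hne : ∀ T : k, u + T • v ≠ 0 := by
    intro T h; exact one_ne_zero (huv 1 T (by rwa [one_smul])).1
  have hdot : ∀ T : k, a ⬝ᵥ (u + T • v) = 0 := by intro T; rw [dotProduct_add, dotProduct_smul, hu, hv]; simp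
  refine not_injective_infinite_finite (fun T : k => (⟨Projectivization.mk k _ (hne T), (onCurve_mk hR _ _).2 (hc _ (hdot T)), (dot_mk _ _ _).2 (hdot T)⟩ :
    {x : P2 k // OnCurve R x ∧ (∑ i, a i * x.rep i = 0)})) ?_
  intro T T' h
  simp only [Subtype.mk.injEq] at h
  rw [Projectivization.mk_eq_mk_iff'] at h
  obtain ⟨b, hb⟩ := h
  have := huv (b - 1) (b * T' - T) (by
    have : b • (u + T' • v) - (u + T • v) = 0 := by rw [hb, sub_self]
    rw [← this]; simp only [sub_smul, smul_add, smul_smul, one_smul]; abel)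
  have h1 : b = 1 := sub_eq_zero.1 this.1
  rw [h1, one_mul] at this
  exact (sub_eq_zero.1 this.2).symm

lemma dot_one (ha : a ≠ 0) : ∃ w, a ⬝ᵥ w ≠ 0 := by
  by_contra h
  push Not at h
  apply ha; funext i
  have := h (Pi.single i 1)
  simpa using this

noncomputable def G14 : GA k := G1 k * GR R 2 * Gdot a 2 * G4 R a

lemma good4_of (h : evM M (G14 R a) ≠ 0) : Good4 R a M := by
  rw [G14, map_mul, map_mul, map_mul, ev_G1, ev_GR, ev_Gdot, ev_G4] at h
  have h4 := right_ne_zero_of_mul h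
  have h := left_ne_zero_of_mul h
  have h3 := right_ne_zero_of_mul h
  have h := left_ne_zero_of_mul h
  exact ⟨left_ne_zero_of_mul h, right_ne_zero_of_mul h, h3, h4⟩

lemma G14_ne [Infinite k] (hR : R.IsHomogeneous d) (hR0 : R ≠ 0) (hd : 2 ≤ d) (ha : a ≠ 0) (hT : TanLine d R a) : G14 R a ≠ 0 := by
  obtain ⟨z0, hz0⟩ := exists_eval_ne R hR0
  obtain ⟨w, hw⟩ := dot_one a ha
  obtain ⟨z, hz, hzR⟩ := line_pt R a hR hd ha hT
  refine mul_ne_zero (mul_ne_zero (mul_ne_zero ?_ ?_) ?_) ?_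
  · apply ne_of_ev (M := 1); rw [ev_G1]; simp
  · apply ne_of_ev (M := Matrix.of fun _ => z0); rw [ev_GR]; exact hz0
  · apply ne_of_ev (M := Matrix.of fun _ => w); rw [ev_Gdot]; exact hw
  · apply ne_of_ev (M := Matrix.of ![z, z, w]); rw [ev_G4]
    change eval ((a ⬝ᵥ w) • z - (a ⬝ᵥ z) • w) R ≠ 0
    simp only [ hz, zero_smul, sub_zero]
    rw [hom_eval hR]; exact mul_ne_zero (pow_ne_zero _ hw) hzR
end gen

section six
variable {k : Type} [Field k] [IsAlgClosed k] {d : ℕ} {R : MvPolynomial (Fin 3) k} {a : Fin 3 → k}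
  (hR : R.IsHomogeneous d) (hd : 2 ≤ d) (hirr : Irreducible R) (ha : a ≠ 0) (hT : TanLine d R a)

include hR hd hT in
lemma tan4 {M : Matrix (Fin 3) (Fin 3) k} (hM : Good4 R a M) : ∃ s0 t0 ρ0, ∃ ρ' : Fin (d-2) → k, Tan (QM R M) d s0 t0 ρ0 ρ' := by
  obtain ⟨h1, h2, x₀, h3, h4, h5⟩ := hT
  exact tan_of hR hd h1 h2 h3 h4 h5 M (IsUnit.mk0 _ hM.det) hM.w hM.aw hM.h4

include hR hd hirr ha hT in
lemma G6_ne : G6 R d ≠ 0 := by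
  haveI : Infinite k := IsAlgClosed.instInfinite
  obtain ⟨M, hM⟩ := exists_ne (G14_ne R a hR hirr.ne_zero hd ha hT)
  have hM := good4_of R a M hM
  obtain ⟨s0, t0, ρ0, ρ', hTan⟩ := tan4 hR hd hT hM
  set Q := QM R M with hQ
  have hQh : Q.IsHomogeneous d := QM_hom hR M
  have hne := p0_ne Q hd hQh hTan
  have hsep := u1_sep Q hd hQh (QM_h1 R M hM.w) (QM_irr hirr M (IsUnit.mk0 _ hM.det) hM.w) hTan (p0 Q (sE k) (tE k)).SplittingField
    (Polynomial.SplittingField.splits _) hne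
  have hr := sep_res (p0_natDegree Q hQh hTan) hne hsep
  set f : Polynomial (MvPolynomial (Fin 2) k) := p0 Q (X 0) (X 1) with hf
  have hr2 : f.resultant f.derivative d (d-1) ≠ 0 := by
    intro h0
    apply hr
    have h := Polynomial.resultant_map_map f f.derivative d (d-1) (IsScalarTower.toAlgHom k (MvPolynomial (Fin 2) k) (E0 k) : MvPolynomial (Fin 2) k →+* E0 k)
    rw [← Polynomial.derivative_map, hf, p0_map, ← hf, h0, map_zero] at h
    exact h
  obtain ⟨x, hx⟩ : ∃ x, eval x (f.resultant f.derivative d (d-1)) ≠ 0 := by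
    by_contra hc
    push Not at hc
    exact hr2 (MvPolynomial.funext fun x => by rw [hc x, map_zero])
  have h := Polynomial.resultant_map_map f f.derivative d (d-1) (MvPolynomial.aeval x : MvPolynomial (Fin 2) k →ₐ[k] k).toRingHom
  have e : f.map (MvPolynomial.aeval x : MvPolynomial (Fin 2) k →ₐ[k] k).toRingHom = p0 Q (x 0) (x 1) := by
    have := p0_map Q (MvPolynomial.aeval x : MvPolynomial (Fin 2) k →ₐ[k] k) (X 0) (X 1)
    rw [aeval_X, aeval_X] at this; exact this
  have hx' : (MvPolynomial.aeval x : MvPolynomial (Fin 2) k →ₐ[k] k).toRingHom (f.resultant f.derivative d (d-1)) ≠ 0 := by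
    have : (MvPolynomial.aeval x : MvPolynomial (Fin 2) k →ₐ[k] k).toRingHom (f.resultant f.derivative d (d-1)) = eval x (f.resultant f.derivative d (d-1)) := by
      change MvPolynomial.aeval x _ = _
      rw [MvPolynomial.aeval_eq_eval]
    rw [this]; exact hx
  rw [← h, ← Polynomial.derivative_map, e, p0, hQ, pl_QM, Polynomial.derivative_C_mul, Polynomial.resultant_C_mul_left, Polynomial.resultant_C_mul_right] at hx'
  apply ne_of_ev (M := Matrix.of ![(![1, 0, x 0] : Fin 3 → k) ᵥ* M, (![0, 1, x 1] : Fin 3 → k) ᵥ* M, 0])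
  rw [ev_G6]
  exact right_ne_zero_of_mul (right_ne_zero_of_mul hx')

include hR hd hirr ha hT in
theorem exists_good : ∃ D : ℕ, ∀ (K : Type) [Field K] [Fintype K] (ι : K →+* k), D < Fintype.card K →
    ∃ M : Matrix (Fin 3) (Fin 3) K, Good6 d R a (M.map ι) := by
  classical
  haveI : Infinite k := IsAlgClosed.instInfinite
  set G := G14 R a * GR R 1 * G6 R d with hG
  have hG0 : G ≠ 0 := by
    refine mul_ne_zero (mul_ne_zero (G14_ne R a hR hirr.ne_zero hd ha hT) ?_) (G6_ne hR hd hirr ha hT)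
    obtain ⟨z0, hz0⟩ := exists_eval_ne R hirr.ne_zero
    apply ne_of_ev (M := Matrix.of fun _ => z0); rw [ev_GR]; exact hz0
  refine ⟨G.totalDegree, fun K _ _ ι hK => ?_⟩
  by_contra hc
  push Not at hc
  apply hG0
  refine MvPolynomial.eq_zero_of_eval_zero_at_prod_finset G (fun _ => Finset.univ.image ι) (fun i => ?_) (fun x hx => ?_)
  · rw [Finset.card_image_of_injective _ ι.injective, Finset.card_univ]
    exact (degreeOf_le_totalDegree _ _).trans_lt hK
  · have : ∀ i, ∃ b, ι b = x i := by
      intro i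
      obtain ⟨b, -, hb⟩ := Finset.mem_image.1 (hx i)
      exact ⟨b, hb⟩
    choose y hy using this
    by_contra h0
    apply hc (fun i j => y (i, j))
    set M : Matrix (Fin 3) (Fin 3) k := Matrix.map (fun i j => y (i, j)) ι with hM
    have h1 : evM M G ≠ 0 := by
      rw [evM, MvPolynomial.aeval_eq_eval]
      have : (fun p : Fin 3 × Fin 3 => M p.1 p.2) = x := funext fun p => hy p
      rw [this]; exact h0
    rw [hG, map_mul, map_mul, ev_GR, ev_G6] at h1
    exact ⟨good4_of R a M (left_ne_zero_of_mul (left_ne_zero_of_mul h1)), right_ne_zero_of_mul (left_ne_zero_of_mul h1), right_ne_zero_of_mul h1⟩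

include hR hd hirr hT in
theorem good_bertini {M : Matrix (Fin 3) (Fin 3) k} (hM : Good6 d R a M) :
    ∃ bad : Finset k, bad.card ≤ Bc d ∧ ∀ c ∉ bad, MvPolynomial.aeval (![1, c, 0] : Fin 3 → k) (QM R M) ≠ 0 ∧ ∃ Φ : Frame k d, Φ.g = gT (QM R M) c := by
  classical
  obtain ⟨s0, t0, ρ0, ρ', hTan⟩ := tan4 hR hd hT hM.toGood4
  have hu := inv_ne_zero hM.w
  have r1 : (![0, 1, 0] : Fin 3 → k) ᵥ* M = M 1 := by
    funext i; simp [vecMul, dotProduct, Fin.sum_univ_three]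
  have r0 : (![1, 0, 0] : Fin 3 → k) ᵥ* M = M 0 := by
    funext i; simp [vecMul, dotProduct, Fin.sum_univ_three]
  have hl : MvPolynomial.aeval (![0, 1, 0] : Fin 3 → k) (QM R M) ≠ 0 := by
    rw [MvPolynomial.aeval_eq_eval]
    change eval _ _ ≠ 0
    rw [eval_QM, r1]
    exact mul_ne_zero hu hM.r
  set f := p0 (QM R M) (0:k) 0 with hf
  have hfe : f = Polynomial.C (eval (M 2) R)⁻¹ * pl R (M 0) (M 1) := by
    rw [hf, p0, pl_QM, r0, r1]
  have hfd := p0_deg (QM R M) (QM_hom hR M) (0:k) 0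
  rw [← hf] at hfd
  have hf0 : f ≠ 0 := by
    rintro h; rw [h] at hfd; exact hl (by simpa using hfd.2.symm)
  have hdeg : f.natDegree = d := le_antisymm hfd.1 (Polynomial.le_natDegree_of_ne_zero (by rw [hfd.2]; exact hl))
  have hsep : f.Separable := by
    apply res_sep hd hfd.1
    rw [hfe, Polynomial.derivative_C_mul, Polynomial.resultant_C_mul_left, Polynomial.resultant_C_mul_right]
    exact mul_ne_zero (pow_ne_zero _ hu) (mul_ne_zero (pow_ne_zero _ hu) hM.res)
  have hcard : f.roots.toFinset.card = d := by
    rw [Multiset.toFinset_card_of_nodup (Polynomial.nodup_roots hsep), ← hdeg]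
    exact (IsAlgClosed.splits f).natDegree_eq_card_roots.symm
  let en := (Finset.equivFinOfCardEq hcard).symm
  have hr : ∀ i, f.eval (en i : k) = 0 := by
    intro i
    have := (en i).2
    rw [Multiset.mem_toFinset, Polynomial.mem_roots hf0] at this
    exact this
  refine bertini (QM R M) hd (QM_hom hR M) (QM_h1 R M hM.w) (QM_irr hirr M (IsUnit.mk0 _ hM.det) hM.w) hTan
    (ρ := fun i => (en i : k)) (fun i j h => en.injective (Subtype.ext h)) hl hr (fun i => ?_)
  have := hsep.aeval_derivative_ne_zero (x := (en i : k)) (by rw [Polynomial.coe_aeval_eq_eval]; exact hr i)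
  rwa [Polynomial.coe_aeval_eq_eval] at this
end six
end IncAux

namespace IncAux
open IncidenceProb Matrix

section gt
variable {K k : Type} [Field K] [Fintype K] [Field k] (ι : K →+* k)
  {d : ℕ} {P : MvPolynomial (Fin 3) K} (hP : P.IsHomogeneous d) (hd : d ≠ 0) (M : Matrix (Fin 3) (Fin 3) K) (hM : IsUnit M.det)
  (bad : Finset k) (hb : ∀ c : K, ι c ∉ bad → eval ((![1, c, 0] : Fin 3 → K) ᵥ* M) P ≠ 0)

include hP hd hM hb in
theorem lines_gt : Nat.card {L : P2 K // d < Nat.card {x : P2 K // OnCurve P x ∧ Incid L x}} ≤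
    (Fintype.card K + 1) + bad.card * Fintype.card K := by
  classical
  have hle : ∀ c v : K, ι c ∉ bad → Nat.card {T : K // eval ((![T, v + T * c, 1] : Fin 3 → K) ᵥ* M) P = 0} ≤ d := by
    intro c v hc
    have hδ := hb c hc
    set f := pl P ((![0, v, 1] : Fin 3 → K) ᵥ* M) ((![1, c, 0] : Fin 3 → K) ᵥ* M) with hf
    obtain ⟨h1, h2⟩ := pl_deg P hP ((![0, v, 1] : Fin 3 → K) ᵥ* M) ((![1, c, 0] : Fin 3 → K) ᵥ* M)
    rw [← hf] at h1 h2
    have hf0 : f ≠ 0 := by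
      intro h0
      rw [h0, Polynomial.coeff_zero, MvPolynomial.aeval_eq_eval] at h2
      exact hδ h2.symm
    have hsub : (Finset.univ.filter (fun T : K => eval ((![T, v + T * c, 1] : Fin 3 → K) ᵥ* M) P = 0)) ⊆ f.roots.toFinset := by
      intro T hT
      rw [Multiset.mem_toFinset, Polynomial.mem_roots hf0, Polynomial.IsRoot, hf, pl_eval', ← smul_vecMul, ← add_vecMul]
      refine Eq.trans ?_ (Finset.mem_filter.1 hT).2
      congr 3
      funext i; fin_cases i <;> simp
    rw [Nat.card_eq_fintype_card, Fintype.card_subtype]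
    exact (Finset.card_le_card hsub).trans ((Multiset.toFinset_card_le _).trans ((Polynomial.card_roots' _).trans h1))
  set U := ((Finset.univ.filter (fun c : K => ι c ∈ bad)) ×ˢ (Finset.univ : Finset K)).disjSum (Finset.univ : Finset (Option K)) with hU
  have hmem : ∀ L : P2 K, d < Nat.card {x : P2 K // OnCurve P x ∧ Incid L x} → lcode M L ∈ U := by
    intro L hL
    rcases hl : lcode M L with ⟨c, v⟩ | o
    · rw [hU, Finset.inl_mem_disjSum, Finset.mem_product, Finset.mem_filter]
      refine ⟨⟨Finset.mem_univ _, ?_⟩, Finset.mem_univ _⟩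
      by_contra hc
      rw [pts_card M hM hP hd hl (hb c hc)] at hL
      exact absurd (hle c v hc) (by omega)
    · rw [hU, Finset.inr_mem_disjSum]; exact Finset.mem_univ _
  have h := Nat.card_le_card_of_injective (fun L : {L : P2 K // d < Nat.card {x : P2 K // OnCurve P x ∧ Incid L x}} => (⟨lcode M L.1, hmem _ L.2⟩ : U))
    (fun L L' h => Subtype.ext (lcode_inj M hM (congrArg Subtype.val h)))
  rw [Nat.card_eq_fintype_card (α := U), Fintype.card_coe, hU, Finset.card_disjSum, Finset.card_product, Finset.card_univ, Finset.card_univ, Fintype.card_option] at h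
  have h5 : (Finset.univ.filter (fun c : K => ι c ∈ bad)).card ≤ bad.card := by
    rw [← Finset.card_image_of_injective _ ι.injective]
    apply Finset.card_le_card
    intro x hx
    obtain ⟨v, hv, rfl⟩ := Finset.mem_image.1 hx
    exact (Finset.mem_filter.1 hv).2
  have h6 := Nat.mul_le_mul_right (Fintype.card K) h5
  omega
end gt

lemma QM_map {K k : Type} [Field K] [Fintype K] [Field k] [IsAlgClosed k] (ι : K →+* k) (P : MvPolynomial (Fin 3) K) (M : Matrix (Fin 3) (Fin 3) K) :
    map ι (QM P M) = QM (map ι P) (M.map ι) := by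
  have e1 : eval ((M.map ι) 2) (map ι P) = ι (eval (M 2) P) := by
    rw [← aeval_map_eval ι P (M 2) ((M.map ι) 2) (fun i => rfl), MvPolynomial.aeval_eq_eval]
  have e2 : map ι (lsub M P) = lsub (M.map ι) (map ι P) := by
    induction P using MvPolynomial.induction_on with
    | C r => simp [lsub]
    | add a b ha hb => 
      have h := fun P : MvPolynomial (Fin 3) K => (aeval_map_eval ι P (M 2) ((M.map ι) 2) (fun i => rfl))
      simp only [MvPolynomial.aeval_eq_eval] at h
      simp only [map_add]; rw [ha (h a), hb (h b)]
    | mul_X a i ha =>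
      have h := fun P : MvPolynomial (Fin 3) K => (aeval_map_eval ι P (M 2) ((M.map ι) 2) (fun i => rfl))
      simp only [MvPolynomial.aeval_eq_eval] at h
      simp only [map_mul]; rw [ha (h a)]; simp [lsub]
  rw [QM, QM, map_mul, map_C, e1, e2, map_inv₀]

section bound
variable {K k : Type} [Field K] [Fintype K] [Field k] [IsAlgClosed k] (p : ℕ) [Fact p.Prime] [CharP k p] (ι : K →+* k)
  {n : ℕ} (hcard : Fintype.card K = p ^ n)
  {d : ℕ} {P : MvPolynomial (Fin 3) K} (hP : P.IsHomogeneous d) (hd : 2 ≤ d) (hirr : Irreducible (map ι P)) {a : Fin 3 → k}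
  (hT : TanLine d (map ι P) a) (M : Matrix (Fin 3) (Fin 3) K) (hM : Good6 d (map ι P) a (M.map ι))
  (hn : 2 * d.factorial * d ^ 2 + 3 * d ^ 2 + 8 ≤ p ^ (n / 2))

include hcard hP hd hirr hT hM hn in
theorem bound : (∀ m, d.factorial * Nat.card {L : P2 K // Nat.card {x : P2 K // OnCurve P x ∧ Incid L x} = m} ≤
    d.factorial * (p ^ n + 1) + d.factorial * Bc d * p ^ n +
    p ^ n * (Dm d m * (p ^ n + (1 + d.factorial * (4 * d ^ 2 + 4)) * p ^ (n - n / 2)) + d.factorial * (d.factorial * (d * d)))) ∧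
    Nat.card {L : P2 K // d < Nat.card {x : P2 K // OnCurve P x ∧ Incid L x}} ≤ (p ^ n + 1) + Bc d * p ^ n := by
  have hR : (map ι P).IsHomogeneous d := hP.map ι
  obtain ⟨bad, hbc, hb⟩ := good_bertini hR hd hirr hT hM
  rw [← QM_map] at hb
  have hdet : IsUnit M.det := by
    refine IsUnit.mk0 _ fun h => hM.det ?_
    have := ι.map_det M
    rw [h, map_zero] at this
    exact this.symm
  have hw : eval (M 2) P ≠ 0 := by
    intro h
    apply hM.w
    have := aeval_map_eval ι P (M 2) ((M.map ι) 2) (fun i => rfl)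
    rw [h, map_zero, MvPolynomial.aeval_eq_eval] at this
    exact this
  have hu := inv_ne_zero hw
  have hQ := eval_QM P M
  constructor
  · intro m
    have h := lines_le p ι hcard hP (by omega) M hdet hu (QM P M) hQ hn bad hb m
    refine h.trans ?_
    gcongr
  · have h := lines_gt ι hP (by omega) M hdet bad (by
      intro c hc h0
      apply (hb _ hc).1
      rw [aeval_map_eval ι (QM P M) ![1, c, 0] _ (by intro i; fin_cases i <;> simp), hQ, h0, mul_zero, map_zero])
    rw [hcard] at h
    refine h.trans ?_
    gcongr
end bound
end IncAux

namespace IncAux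

lemma Dm_sum (d : ℕ) : ∑ m ∈ Finset.range (d+1), Dm d m = d.factorial := by
  unfold Dm
  rw [← Finset.card_eq_sum_card_fiberwise, Finset.card_univ, Fintype.card_perm, Fintype.card_fin]
  intro σ _
  simp only [Finset.coe_range, Set.mem_Iio]
  have := Finset.card_le_univ (Finset.univ.filter (fun i => σ i = i))
  rw [Fintype.card_fin] at this; omega

lemma Dm_eq {d m : ℕ} : Dm d m = d.choose m * numDerangements (d - m) := by
  classical
  unfold Dm
  have h1 : (Finset.univ.filter (fun σ : Equiv.Perm (Fin d) => (Finset.univ.filter (fun i => σ i = i)).card = m)).card =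
      ∑ S ∈ Finset.univ.powersetCard m, (Finset.univ.filter (fun σ : Equiv.Perm (Fin d) => Finset.univ.filter (fun i => σ i = i) = S)).card := by
    rw [Finset.card_eq_sum_card_fiberwise (f := fun σ : Equiv.Perm (Fin d) => Finset.univ.filter (fun i => σ i = i)) (t := Finset.univ.powersetCard m)]
    · refine Finset.sum_congr rfl fun S hS => ?_
      congr 1
      ext σ
      simp only [Finset.mem_filter, Finset.mem_univ, true_and, Finset.mem_powersetCard, Finset.subset_univ] at hS ⊢
      constructor
      · exact fun h => h.2
      · exact fun h => ⟨by rw [h, hS], h⟩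
    · intro σ hσ
      simpa [Finset.mem_powersetCard] using hσ
  rw [h1, Finset.sum_congr rfl (g := fun _ => numDerangements (d - m)), Finset.sum_const, Finset.card_powersetCard, Finset.card_univ, Fintype.card_fin, smul_eq_mul]
  intro S hS
  have hS := (Finset.mem_powersetCard.1 hS).2
  have e := derangements.subtypeEquiv (α := Fin d) (fun i => i ∉ S)
  have := Fintype.card_congr e
  rw [card_derangements_eq_numDerangements] at this
  have h2 : Fintype.card {i // i ∉ S} = d - m := by
    rw [Fintype.card_subtype_compl]; simp [hS]
  rw [h2] at this
  rw [this, ← Fintype.card_subtype]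
  apply Fintype.card_congr
  apply Equiv.subtypeEquivRight
  intro σ
  simp only [not_not, Finset.ext_iff, Finset.mem_filter, Finset.mem_univ, true_and]
  constructor
  · intro h i; exact (h i).symm
  · intro h i; exact (h i).symm

lemma Dm_formula {d k : ℕ} (hk : k ≤ d) : (Dm d k : ℝ) / d.factorial =
    ∑ s ∈ Finset.Icc k d, (-1 : ℝ) ^ (k + s) / (Nat.factorial s) * (Nat.choose s k) := by
  obtain ⟨e, rfl⟩ := Nat.exists_eq_add_of_le hk
  rw [Dm_eq, Nat.add_sub_cancel_left, Nat.cast_mul]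
  have h := numDerangements_sum e
  have h' : (numDerangements e : ℝ) = ∑ j ∈ Finset.range (e + 1), (-1 : ℝ) ^ j * (Nat.ascFactorial (j + 1) (e - j) : ℝ) := by
    exact_mod_cast h
  rw [h', Finset.mul_sum, Finset.sum_div, ← Finset.Ico_succ_right_eq_Icc, Finset.sum_Ico_eq_sum_range]
  have : Order.succ (k + e) - k = e + 1 := by simp [Nat.succ_eq_add_one]; omega
  rw [this]
  refine Finset.sum_congr rfl fun j hj => ?_
  have hj : j ≤ e := by have := Finset.mem_range.1 hj; omega
  have a1 : ((k+e).choose k : ℝ) = (k+e).factorial / (k.factorial * e.factorial) := Nat.cast_add_choose ℝ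
  have a2 : ((k+j).choose k : ℝ) = (k+j).factorial / (k.factorial * j.factorial) := Nat.cast_add_choose ℝ
  have a3 : (j.factorial : ℝ) * (Nat.ascFactorial (j + 1) (e - j) : ℝ) = e.factorial := by
    have := Nat.factorial_mul_ascFactorial j (e - j)
    rw [Nat.add_sub_cancel' hj] at this
    exact_mod_cast this
  have a4 : (-1 : ℝ) ^ (k + (k + j)) = (-1) ^ j := by
    rw [← add_assoc, pow_add, ← two_mul, pow_mul]; simp
  have f1 : ((k+e).factorial : ℝ) ≠ 0 := by positivity
  have f2 : ((k+j).factorial : ℝ) ≠ 0 := by positivity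
  have f3 : (k.factorial : ℝ) ≠ 0 := by positivity
  have f4 : (j.factorial : ℝ) ≠ 0 := by positivity
  have f5 : (e.factorial : ℝ) ≠ 0 := by positivity
  rw [a1, a2, a4]
  field_simp
  linear_combination a3

lemma Dm_d (d : ℕ) : Dm d d = 1 := by rw [Dm_eq]; simp
lemma Dm_d1 {d : ℕ} (hd : 1 ≤ d) : Dm d (d-1) = 0 := by
  rw [Dm_eq]; have : d - (d-1) = 1 := by omega
  rw [this]; simp
end IncAux

namespace IncAux
open IncidenceProb Matrix

lemma two_le {k : Type} [Field k] {d : ℕ} {R : MvPolynomial (Fin 3) k} (hR : R.IsHomogeneous d) (hirr : Irreducible R)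
    {a : Fin 3 → k} (hT : TanLine d R a) : 2 ≤ d := by
  have hconst : ∀ S : MvPolynomial (Fin 3) k, S.IsHomogeneous 0 → ∃ c, S = C c := by
    intro S hS
    exact ⟨_, totalDegree_eq_zero_iff_eq_C.1 ((totalDegree_zero_iff_isHomogeneous _).2 hS)⟩
  by_contra hlt
  have h01 : d = 0 ∨ d = 1 := by omega
  rcases h01 with rfl | rfl
  · obtain ⟨c, hc⟩ := hconst R hR
    by_cases h : c = 0
    · rw [h, map_zero] at hc; exact hirr.ne_zero hc
    · apply hirr.not_isUnit
      rw [hc]; exact (IsUnit.mk0 c h).map C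
  · obtain ⟨h1, h2, x₀, h3, h4, h5⟩ := hT
    have hg : ∀ x y, gr R x = gr R y := by
      intro x y
      funext i
      obtain ⟨c, hc⟩ := hconst (pderiv i R) hR.pderiv
      simp [gr, hc]
    have : Unique {x : P2 k // OnCurve R x ∧ (∑ i, a i * x.rep i = 0)} :=
      { default := ⟨x₀, h3⟩, uniq := fun x => Subtype.ext (h5 x.1 x.2.1 x.2.2 (by rw [hg x.1.rep x₀.rep]; exact h4)) }
    rw [Nat.card_unique] at h1
    omega

lemma count_sum {α : Type} [Finite α] (c : α → ℕ) (d : ℕ) :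
    ∑ m ∈ Finset.range (d+1), Nat.card {L // c L = m} + Nat.card {L // d < c L} = Nat.card α := by
  classical
  haveI := Fintype.ofFinite α
  simp only [Nat.card_eq_fintype_card, Fintype.card_subtype]
  have h := Finset.card_filter_add_card_filter_not (s := (Finset.univ : Finset α)) (fun L => c L ≤ d)
  simp only [not_le] at h
  rw [← Finset.card_univ, ← h]
  congr 1
  rw [Finset.card_eq_sum_card_fiberwise (f := c) (t := Finset.range (d+1))]
  · refine Finset.sum_congr rfl fun m hm => ?_
    congr 1
    ext L
    have := Finset.mem_range.1 hm
    simp only [Finset.mem_filter, Finset.mem_univ, true_and]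
    omega
  · intro L hL
    simp only [Finset.coe_filter, Finset.mem_univ, true_and, Set.mem_setOf_eq] at hL
    simp only [Finset.coe_range, Set.mem_Iio]; omega

lemma card_P2 (K : Type) [Field K] [Fintype K] : Nat.card (P2 K) = Fintype.card K ^ 2 + Fintype.card K + 1 := by
  have h := Projectivization.card_of_finrank K (Fin 3 → K) (n := 3) (by simp)
  rw [h, Nat.card_eq_fintype_card]
  simp [Finset.sum_range_succ]; ring

lemma squeeze_sum {d : ℕ} {a u : ℕ → ℕ → ℝ} {s : ℕ → ℝ} {L : ℕ → ℝ}
    (hu : ∀ m ≤ d, ∀ᶠ N in atTop, a m N ≤ u m N) (hs : ∀ᶠ N in atTop, s N ≤ ∑ m ∈ Finset.range (d+1), a m N)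
    (hul : ∀ m, Tendsto (u m) atTop (nhds (L m))) (hsl : Tendsto s atTop (nhds 1)) (hL : ∑ m ∈ Finset.range (d+1), L m = 1) :
    ∀ m ≤ d, Tendsto (a m) atTop (nhds (L m)) := by
  intro m hm
  have hmem : m ∈ Finset.range (d+1) := Finset.mem_range.2 (by omega)
  have hlow : Tendsto (fun N => s N - ∑ j ∈ (Finset.range (d+1)).erase m, u j N) atTop (nhds (L m)) := by
    have h1 : Tendsto (fun N => s N - ∑ j ∈ (Finset.range (d+1)).erase m, u j N) atTop
        (nhds (1 - ∑ j ∈ (Finset.range (d+1)).erase m, L j)) :=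
      hsl.sub (tendsto_finset_sum _ fun j _ => hul j)
    have h2 := Finset.add_sum_erase _ L hmem
    rw [hL] at h2
    have : 1 - ∑ j ∈ (Finset.range (d+1)).erase m, L j = L m := by linarith
    rwa [this] at h1
  have hall : ∀ᶠ N in atTop, ∀ j ∈ Finset.range (d+1), a j N ≤ u j N :=
    (Filter.eventually_all_finset _).2 fun j hj => hu j (by have := Finset.mem_range.1 hj; omega)
  refine tendsto_of_tendsto_of_tendsto_of_le_of_le' hlow (hul m) ?_ (hu m hm)
  filter_upwards [hs, hall] with N h1 h2
  have h3 := Finset.add_sum_erase _ (fun j => a j N) hmem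
  have h4 : ∑ j ∈ (Finset.range (d+1)).erase m, a j N ≤ ∑ j ∈ (Finset.range (d+1)).erase m, u j N :=
    Finset.sum_le_sum fun j hj => h2 j (Finset.mem_of_mem_erase hj)
  linarith

lemma real_up {D Z B Cc C2 q r y c T : ℝ} (hD : 0 < D) (hq : 0 < q) (hr : r = q * y) (hZ : 0 ≤ Z) (hB : 0 ≤ B) (hCc : 0 ≤ Cc) (hC2 : 0 ≤ C2) (hy : 0 ≤ y)
    (hT : q ^ 2 ≤ T)
    (h : D * c ≤ D * (q + 1) + D * B * q + q * (Z * (q + Cc * r) + C2)) :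
    c / T ≤ q⁻¹ + q⁻¹ ^ 2 + B * q⁻¹ + (Z / D) * (1 + Cc * y) + (C2 / D) * q⁻¹ := by
  have hT0 : 0 < T := lt_of_lt_of_le (by positivity) hT
  set V := q⁻¹ + q⁻¹ ^ 2 + B * q⁻¹ + (Z / D) * (1 + Cc * y) + (C2 / D) * q⁻¹ with hV
  have hV0 : 0 ≤ V := by positivity
  rw [div_le_iff₀ hT0]
  have e : D * (q ^ 2 * V) = D * (q + 1) + D * B * q + q * (Z * (q + Cc * r) + C2) := by
    rw [hV, hr]; field_simp; ring
  have h1 : c ≤ q ^ 2 * V := by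
    rw [← e] at h; exact le_of_mul_le_mul_left h hD
  nlinarith [mul_le_mul_of_nonneg_left hT hV0]

theorem lim (F : Type) [Field F] [Fintype F]
    (K : ℕ → Type) [∀ N, Field (K N)] [∀ N, Fintype (K N)] [∀ N, Algebra F (K N)]
    (hcard : ∀ N, 1 ≤ N → Fintype.card (K N) = Fintype.card F ^ N)
    (d : ℕ) (P : MvPolynomial (Fin 3) F) (hhom : P.IsHomogeneous d)
    (hirr : Irreducible (MvPolynomial.map (algebraMap F (AlgebraicClosure F)) P))
    (htan : SimpleTangencyPlane d (MvPolynomial.map (algebraMap F (AlgebraicClosure F)) P)) :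
    2 ≤ d ∧ ∀ m ≤ d, Tendsto (fun N => probLine (K N) (MvPolynomial.map (algebraMap F (K N)) P) m) atTop (nhds ((Dm d m : ℝ) / d.factorial)) := by
  obtain ⟨a, ha, hT⟩ := htan
  change TanLine d _ a at hT
  set R := MvPolynomial.map (algebraMap F (AlgebraicClosure F)) P with hRdef
  have hR : R.IsHomogeneous d := hhom.map _
  have hd := two_le hR hirr hT
  refine ⟨hd, ?_⟩
  obtain ⟨p, hpc⟩ := CharP.exists F
  obtain ⟨e, hp, hFc⟩ := FiniteField.card F p
  haveI : Fact p.Prime := ⟨hp⟩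
  haveI : CharP (AlgebraicClosure F) p := charP_of_injective_algebraMap (algebraMap F (AlgebraicClosure F)).injective p
  obtain ⟨D0, hD0⟩ := exists_good hR hd hirr ha hT
  have he : 1 ≤ (e : ℕ) := e.2
  have hp2 : 2 ≤ p := hp.two_le
  set n : ℕ → ℕ := fun N => (e : ℕ) * N with hn
  have hKc : ∀ N, 1 ≤ N → Fintype.card (K N) = p ^ (n N) := by
    intro N hN; rw [hcard N hN, hFc, hn, pow_mul]
  have hn_top : Tendsto n atTop atTop := tendsto_atTop_mono (fun N => Nat.le_mul_of_pos_left N he) tendsto_id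
  have hn2_top : Tendsto (fun N => n N / 2) atTop atTop := (Nat.tendsto_div_const_atTop two_ne_zero).comp hn_top
  have hpp : Tendsto (fun j : ℕ => p ^ j) atTop atTop := tendsto_pow_atTop_atTop_of_one_lt hp.one_lt
  have hbound : ∀ᶠ N in atTop, 1 ≤ N ∧ (∀ m, d.factorial * Nat.card {L : P2 (K N) // Nat.card {x : P2 (K N) // OnCurve (MvPolynomial.map (algebraMap F (K N)) P) x ∧ Incid L x} = m} ≤
      d.factorial * (p ^ n N + 1) + d.factorial * Bc d * p ^ n N +
      p ^ n N * (Dm d m * (p ^ n N + (1 + d.factorial * (4 * d ^ 2 + 4)) * p ^ (n N - n N / 2)) + d.factorial * (d.factorial * (d * d)))) ∧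
      Nat.card {L : P2 (K N) // d < Nat.card {x : P2 (K N) // OnCurve (MvPolynomial.map (algebraMap F (K N)) P) x ∧ Incid L x}} ≤ (p ^ n N + 1) + Bc d * p ^ n N := by
    filter_upwards [eventually_ge_atTop 1, (hpp.comp hn_top).eventually_gt_atTop D0,
      (hpp.comp hn2_top).eventually_ge_atTop (2 * d.factorial * d ^ 2 + 3 * d ^ 2 + 8)] with N h1 h2 h3
    refine ⟨h1, ?_⟩
    haveI : Algebra.IsAlgebraic F (K N) := Algebra.IsAlgebraic.of_finite F (K N)
    let ι : K N →ₐ[F] AlgebraicClosure F := IsAlgClosed.lift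
    have hmap : MvPolynomial.map (ι : K N →+* AlgebraicClosure F) (MvPolynomial.map (algebraMap F (K N)) P) = R := by
      rw [MvPolynomial.map_map, ι.comp_algebraMap]
    obtain ⟨M, hM⟩ := hD0 (K N) (ι : K N →+* AlgebraicClosure F) (by rw [hKc N h1]; exact h2)
    rw [← hmap] at hM hirr hT
    exact bound p (ι : K N →+* AlgebraicClosure F) (hKc N h1) (hhom.map _) hd hirr hT M hM h3
  have hqx : Tendsto (fun N => ((p : ℝ) ^ n N)⁻¹) atTop (nhds 0) :=
    tendsto_inv_atTop_zero.comp ((tendsto_pow_atTop_atTop_of_one_lt (by exact_mod_cast hp.one_lt)).comp hn_top)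
  have hqy : Tendsto (fun N => ((p : ℝ) ^ (n N / 2))⁻¹) atTop (nhds 0) :=
    tendsto_inv_atTop_zero.comp ((tendsto_pow_atTop_atTop_of_one_lt (by exact_mod_cast hp.one_lt)).comp hn2_top)
  have hfac : (0 : ℝ) < d.factorial := by positivity
  have hp0 : (0 : ℝ) < p := by positivity
  refine squeeze_sum (a := fun m N => probLine (K N) (MvPolynomial.map (algebraMap F (K N)) P) m)
    (u := fun m N => ((p : ℝ) ^ n N)⁻¹ + ((p : ℝ) ^ n N)⁻¹ ^ 2 + (Bc d : ℝ) * ((p : ℝ) ^ n N)⁻¹ +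
      ((Dm d m : ℝ) / d.factorial) * (1 + (1 + d.factorial * (4 * d ^ 2 + 4) : ℝ) * ((p : ℝ) ^ (n N / 2))⁻¹) +
      ((d.factorial * (d.factorial * (d * d)) : ℝ) / d.factorial) * ((p : ℝ) ^ n N)⁻¹)
    (s := fun N => 1 - (((p : ℝ) ^ n N)⁻¹ + ((p : ℝ) ^ n N)⁻¹ ^ 2 + (Bc d : ℝ) * ((p : ℝ) ^ n N)⁻¹))
    ?_ ?_ ?_ ?_ ?_
  · intro m _
    filter_upwards [hbound] with N ⟨h1, h2, _⟩
    have h := h2 m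
    rw [probLine, hKc N h1]
    refine real_up (r := (p : ℝ) ^ (n N - n N / 2)) hfac (by positivity) ?_ (by positivity) (by positivity) (by positivity) (by positivity) (by positivity) ?_ (by exact_mod_cast h)
    · rw [← div_eq_mul_inv, eq_div_iff (by positivity), ← pow_add, Nat.sub_add_cancel (Nat.div_le_self _ _)]
    · push_cast
      have : (0 : ℝ) < (p : ℝ) ^ n N := by positivity
      linarith
  · filter_upwards [hbound] with N ⟨h1, _, h3⟩
    have hsum := count_sum (fun L : P2 (K N) => Nat.card {x : P2 (K N) // OnCurve (MvPolynomial.map (algebraMap F (K N)) P) x ∧ Incid L x}) d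
    rw [card_P2, hKc N h1] at hsum
    simp only [probLine, hKc N h1]
    rw [← Finset.sum_div]
    have hsum' : (∑ m ∈ Finset.range (d+1), (Nat.card {L : P2 (K N) // Nat.card {x : P2 (K N) // OnCurve (MvPolynomial.map (algebraMap F (K N)) P) x ∧ Incid L x} = m} : ℝ)) +
      (Nat.card {L : P2 (K N) // d < Nat.card {x : P2 (K N) // OnCurve (MvPolynomial.map (algebraMap F (K N)) P) x ∧ Incid L x}} : ℝ) = ((p : ℝ) ^ n N) ^ 2 + (p : ℝ) ^ n N + 1 := by
      exact_mod_cast hsum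
    have h3' : (Nat.card {L : P2 (K N) // d < Nat.card {x : P2 (K N) // OnCurve (MvPolynomial.map (algebraMap F (K N)) P) x ∧ Incid L x}} : ℝ) ≤ ((p : ℝ) ^ n N + 1) + Bc d * (p : ℝ) ^ n N := by
      exact_mod_cast h3
    rw [eq_sub_of_add_eq hsum']
    push_cast
    set q := (p : ℝ) ^ n N with hq
    have hq0 : 0 < q := by positivity
    have hTp : 0 < q ^ 2 + q + 1 := by positivity
    rw [le_div_iff₀ hTp, sub_mul, one_mul]
    refine sub_le_sub_left (h3'.trans ?_) _
    have e : (q + 1) + Bc d * q = (q⁻¹ + q⁻¹ ^ 2 + (Bc d : ℝ) * q⁻¹) * q ^ 2 := by field_simp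
    rw [e]
    refine mul_le_mul_of_nonneg_left (by linarith) (by positivity)
  · intro m
    have h := (((hqx.add (hqx.pow 2)).add (hqx.const_mul (Bc d : ℝ))).add
      (((hqy.const_mul (1 + d.factorial * (4 * d ^ 2 + 4) : ℝ)).const_add 1).const_mul ((Dm d m : ℝ) / d.factorial))).add
      (hqx.const_mul ((d.factorial * (d.factorial * (d * d)) : ℝ) / d.factorial))
    simpa using h
  · have h := ((hqx.add (hqx.pow 2)).add (hqx.const_mul (Bc d : ℝ))).const_sub 1
    simpa using h
  · rw [← Finset.sum_div, div_eq_one_iff_eq hfac.ne']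
    exact_mod_cast Dm_sum d
end IncAux

namespace IncidenceProb

/-- Let `q` be a prime power and `C` an absolutely irreducible plane
algebraic curve of degree `d` over `𝔽_q` with simple tangency.  Then for every
`k ∈ {0, …, d}` the probabilities of intersection satisfy
`p_k(C) = ∑_{s=k}^d (-1)^{k+s}/s! · C(s,k)`; in particular `p_{d-1}(C) = 0` and
`p_d(C) = 1/d!`. -/
theorem statement1
    (F : Type) [Field F] [Fintype F]
    (K : ℕ → Type) [∀ N, Field (K N)] [∀ N, Fintype (K N)] [∀ N, Algebra F (K N)]
    (hcard : ∀ N, 1 ≤ N → Fintype.card (K N) = Fintype.card F ^ N)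
    (d : ℕ) (P : MvPolynomial (Fin 3) F)
    (hP0 : P ≠ 0) (hhom : P.IsHomogeneous d)
    (hirr : Irreducible (MvPolynomial.map (algebraMap F (AlgebraicClosure F)) P))
    (htan : SimpleTangencyPlane d (MvPolynomial.map (algebraMap F (AlgebraicClosure F)) P)) :
    (∀ k ≤ d, Filter.Tendsto
      (fun N => probLine (K N) (MvPolynomial.map (algebraMap F (K N)) P) k)
      Filter.atTop
      (nhds (∑ s ∈ Finset.Icc k d,
        (-1 : ℝ) ^ (k + s) / (Nat.factorial s) * (Nat.choose s k)))) ∧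
    Filter.Tendsto
      (fun N => probLine (K N) (MvPolynomial.map (algebraMap F (K N)) P) (d - 1))
      Filter.atTop (nhds 0) ∧
    Filter.Tendsto
      (fun N => probLine (K N) (MvPolynomial.map (algebraMap F (K N)) P) d)
      Filter.atTop (nhds (1 / (Nat.factorial d))) := by
  obtain ⟨hd, h⟩ := IncAux.lim F K hcard d P hhom hirr htan
  refine ⟨fun k hk => ?_, ?_, ?_⟩
  · rw [← IncAux.Dm_formula hk]; exact h k hk
  · have := h (d-1) (Nat.sub_le _ _)
    rw [IncAux.Dm_d1 (by omega)] at this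
    simpa using this
  · have := h d le_rfl
    rw [IncAux.Dm_d] at this
    simpa using this

end IncidenceProb
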